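/- Let (A, 𝔪) be a two-dimensional excellent normal local domain over an algebraically closed field and let I, J ⊆ A be 𝔪-primary ideals. Then the multi-Rees algebra 𝓡(I,J) = A[It₁, Jt₂] is a Cohen–Macaulay normal domain if and only if I and J are integrally closed and the Rees algebra 𝓡(IJ) = A[(IJ)t] of the product ideal is a Cohen–Macaulay normal domain. -/

import Mathlib

/-! Auxiliary definitions.

Mathlib does not yet know about excellent rings; the excellence hypothesis of the paper
is used only to guarantee the existence of resolutions and of the normal Hilbert
polynomial, which we hypothesize directly where needed. -/

/-- The length `ℓ_R(M)` of a module, defined as the Krull dimension of its lattice of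
submodules (for modules of finite length this is the usual Jordan–Hölder length). -/
noncomputable def moduleLength (R M : Type*) [CommRing R] [AddCommGroup M] [Module R M] :
    WithBot ℕ∞ :=
  Order.krullDim (Submodule R M)

/-- `x` is integral over the ideal `I`: it satisfies an equation of integral dependence
`x ^ n + c 1 * x ^ (n-1) + ⋯ + c n = 0` with `c i ∈ I ^ i`. -/
def IsIntegralOverIdeal {A : Type*} [CommRing A] (I : Ideal A) (x : A) : Prop :=
  ∃ n : ℕ, 0 < n ∧ ∃ c : ℕ → A, (∀ i, 1 ≤ i → i ≤ n → c i ∈ I ^ i) ∧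
    x ^ n + ∑ i ∈ Finset.Icc 1 n, c i * x ^ (n - i) = 0

/-- The integral closure `J̄` of an ideal `J`: the set of elements integral over `J`
(this set is an ideal; we take the ideal it generates). -/
noncomputable def idealIntegralClosure {A : Type*} [CommRing A] (I : Ideal A) : Ideal A :=
  Ideal.span {x | IsIntegralOverIdeal I x}

/-- An ideal is integrally closed if it contains every element integral over it. -/
def IdealIsIntegrallyClosed {A : Type*} [CommRing A] (I : Ideal A) : Prop :=
  ∀ x, IsIntegralOverIdeal I x → x ∈ I

/-- A Noetherian local ring is Cohen–Macaulay if some regular sequence contained in the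
maximal ideal has length equal to the Krull dimension of the ring. -/
def IsCohenMacaulayLocalRing (R : Type*) [CommRing R] : Prop :=
  IsNoetherianRing R ∧ ∃ h : IsLocalRing R,
    letI := h
    ∃ rs : List R, (∀ x ∈ rs, x ∈ IsLocalRing.maximalIdeal R) ∧
      RingTheory.Sequence.IsRegular R rs ∧ (rs.length : WithBot ℕ∞) = ringKrullDim R

/-- A Noetherian ring is Cohen–Macaulay if all its localizations at primes are
Cohen–Macaulay local rings. -/
def IsCohenMacaulayRing (R : Type*) [CommRing R] : Prop :=
  IsNoetherianRing R ∧ ∀ (P : Ideal R) (hP : P.IsPrime),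
    letI := hP
    IsCohenMacaulayLocalRing (Localization.AtPrime P)

/-- A Cohen–Macaulay normal domain. -/
def IsCMNormalDomain (R : Type*) [CommRing R] : Prop :=
  IsCohenMacaulayRing R ∧ IsDomain R ∧ IsIntegrallyClosed R

/-- The multi-Rees algebra `A[I₁t₁, …, I_r t_r]`: the `A`-subalgebra of the polynomial
ring `A[t₁, …, t_r]` generated by the elements `a·tᵢ` with `a ∈ Iᵢ`. -/
noncomputable def multiReesAlgebra {A : Type*} [CommRing A] {r : ℕ} (I : Fin r → Ideal A) :
    Subalgebra A (MvPolynomial (Fin r) A) :=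
  Algebra.adjoin A (⋃ i, (fun a => MvPolynomial.C a * MvPolynomial.X i) '' ((I i : Set A)))

section Part1
open RingTheory.Sequence IsLocalRing

namespace MR

lemma regular_or_socle {R N : Type*} [CommRing R] [IsNoetherianRing R] [IsLocalRing R]
    [AddCommGroup N] [Module R N] [Module.Finite R N]
    (h : ∀ u : N, (∀ t ∈ maximalIdeal R, t • u = 0) → u = 0) :
    ∃ z ∈ maximalIdeal R, IsSMulRegular N z := by
  by_contra hcon
  push Not at hcon
  obtain ⟨p, hp, hle⟩ := ((maximalIdeal R).subset_union_prime_finite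
    (associatedPrimes.finite R N) (f := id) 0 0 fun _ h _ _ ↦ h.1).1 (by
      simp only [id]
      rw [biUnion_associatedPrimes_eq_compl_regular]
      exact fun x hx => hcon x hx)
  rw [AssociatedPrimes.mem_iff, isAssociatedPrime_iff] at hp
  obtain ⟨hprime, x, rfl⟩ := hp
  have := h x (fun t ht => by
    have := hle ht
    simpa [Submodule.mem_colon_singleton] using this)
  exact hprime.ne_top (by simp [this])

lemma mem_quot_zero {R M : Type*} [CommRing R] [AddCommGroup M] [Module R M] (x : R) (u : M) :
    (Submodule.Quotient.mk u : QuotSMulTop x M) = 0 ↔ ∃ w, u = x • w := by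
  rw [Submodule.Quotient.mk_eq_zero, Submodule.mem_smul_pointwise_iff_exists]
  constructor
  · rintro ⟨w, -, rfl⟩; exact ⟨w, rfl⟩
  · rintro ⟨w, rfl⟩; exact ⟨w, trivial, rfl⟩

lemma exchange {R : Type*} [CommRing R] [IsNoetherianRing R] [IsLocalRing R] (n : ℕ) :
    ∀ {M : Type _} [AddCommGroup M] [Module R M] [Module.Finite R M] (rs : List R)
      (_ : ∀ r ∈ rs, r ∈ maximalIdeal R) (_ : IsWeaklyRegular M rs) (_ : rs.length = n + 1)
      (y : R) (_ : y ∈ maximalIdeal R) (_ : IsSMulRegular M y),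
      ∃ ts : List R, (∀ r ∈ ts, r ∈ maximalIdeal R) ∧ ts.length = n ∧
        IsWeaklyRegular (QuotSMulTop y M) ts := by
  induction n with
  | zero => intro M _ _ _ rs _ _ _ y hy hyr; exact ⟨[], by simp, rfl, by simp⟩
  | succ k ih =>
    intro M _ _ _ rs hrs hreg hlen y hy hyr
    match rs, hlen with
    | x :: x' :: rest, hlen =>
    rw [isWeaklyRegular_cons_iff, isWeaklyRegular_cons_iff] at hreg
    obtain ⟨hx, hx', hrest⟩ := hreg
    have hxm : x ∈ maximalIdeal R := hrs x (by simp)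
    have hxm' : x' ∈ maximalIdeal R := hrs x' (by simp)
    have key1 : ∀ u : QuotSMulTop x M, (∀ t ∈ maximalIdeal R, t • u = 0) → u = 0 := by
      intro u hu
      exact (isSMulRegular_iff_right_eq_zero_of_smul.mp hx') u (hu x' hxm')
    have key2 : ∀ u : QuotSMulTop y M, (∀ t ∈ maximalIdeal R, t • u = 0) → u = 0 := by
      intro u hu
      obtain ⟨u, rfl⟩ := Submodule.Quotient.mk_surjective _ u
      have hu' : ∀ t ∈ maximalIdeal R, ∃ w, t • u = y • w := fun t ht => by
        rw [← mem_quot_zero]; exact hu t ht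
      obtain ⟨w, hw⟩ := hu' x hxm
      have : (Submodule.Quotient.mk w : QuotSMulTop x M) = 0 := by
        refine key1 _ (fun t ht => ?_)
        rw [← Submodule.Quotient.mk_smul, mem_quot_zero]
        obtain ⟨v, hv⟩ := hu' t ht
        refine ⟨v, hyr ?_⟩
        show y • t • w = y • x • v
        rw [smul_comm y t w, ← hw, smul_comm t x, hv, smul_comm]
      obtain ⟨w', rfl⟩ := (mem_quot_zero _ _).mp this
      rw [mem_quot_zero]
      refine ⟨w', hx ?_⟩
      show x • u = x • y • w'
      rw [hw, smul_comm]
    obtain ⟨z, hz, hzreg⟩ := regular_or_socle (R := R) (N := QuotSMulTop x M × QuotSMulTop y M)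
      (by
        rintro ⟨u1, u2⟩ hu
        ext
        · exact key1 _ (fun t ht => congrArg Prod.fst (hu t ht))
        · exact key2 _ (fun t ht => congrArg Prod.snd (hu t ht)))
    have hz1 : IsSMulRegular (QuotSMulTop x M) z := by
      rw [isSMulRegular_iff_right_eq_zero_of_smul] at hzreg ⊢
      intro u hu
      exact congrArg Prod.fst (hzreg (u, 0) (by ext <;> simp [hu]))
    have hz2 : IsSMulRegular (QuotSMulTop y M) z := by
      rw [isSMulRegular_iff_right_eq_zero_of_smul] at hzreg ⊢
      intro u hu
      exact congrArg Prod.snd (hzreg (0, u) (by ext <;> simp [hu]))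
    obtain ⟨ts, hts, htl, htr⟩ := ih (M := QuotSMulTop x M) (x' :: rest)
      (fun r hr => hrs r (by simp at hr ⊢; tauto))
      ((isWeaklyRegular_cons_iff _ _ _).mpr ⟨hx', hrest⟩) (by simpa using hlen) z hz hz1
    have h1 : IsWeaklyRegular M (x :: z :: ts) := by
      rw [isWeaklyRegular_cons_iff, isWeaklyRegular_cons_iff]; exact ⟨hx, hz1, htr⟩
    have h2 : IsWeaklyRegular M (z :: x :: ts) :=
      IsLocalRing.isWeaklyRegular_of_perm_of_subset_maximalIdeal h1 (List.Perm.swap _ _ _) (by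
        intro r hr; simp at hr; rcases hr with rfl | rfl | hr
        exacts [hxm, hz, hts r hr])
    have h3 : IsWeaklyRegular M [y, z] := by
      rw [isWeaklyRegular_cons_iff, isWeaklyRegular_singleton_iff]; exact ⟨hyr, hz2⟩
    have h4 : IsWeaklyRegular M [z, y] :=
      IsLocalRing.isWeaklyRegular_of_perm_of_subset_maximalIdeal h3 (List.Perm.swap _ _ _) (by
        intro r hr; simp at hr; rcases hr with rfl | rfl
        exacts [hy, hz])
    rw [isWeaklyRegular_cons_iff] at h2 h4
    rw [isWeaklyRegular_singleton_iff] at h4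
    obtain ⟨us, hus, hul, hur⟩ := ih (M := QuotSMulTop z M) (x :: ts)
      (by intro r hr; simp at hr; rcases hr with rfl | hr
          exacts [hxm, hts r hr]) h2.2 (by simp [htl]) y hy h4.2
    have h5 : IsWeaklyRegular M (z :: y :: us) := by
      rw [isWeaklyRegular_cons_iff, isWeaklyRegular_cons_iff]; exact ⟨h4.1, h4.2, hur⟩
    have h6 : IsWeaklyRegular M (y :: z :: us) :=
      IsLocalRing.isWeaklyRegular_of_perm_of_subset_maximalIdeal h5 (List.Perm.swap _ _ _) (by
        intro r hr; simp at hr; rcases hr with rfl | rfl | hr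
        exacts [hz, hy, hus r hr])
    rw [isWeaklyRegular_cons_iff] at h6
    exact ⟨z :: us, by intro r hr; simp at hr; rcases hr with rfl | hr; exacts [hz, hus r hr],
      by simp [hul], h6.2⟩

lemma dim_lt_of_lt {R : Type*} [CommRing R] (p q : Ideal R) [p.IsPrime] (h : p ≤ q) (x : R)
    (hx : x ∈ q) (hxp : x ∉ p) : ringKrullDim (R ⧸ q) + 1 ≤ ringKrullDim (R ⧸ p) := by
  refine ringKrullDim_succ_le_of_surjective (Ideal.Quotient.factor h)
    (Ideal.Quotient.factor_surjective h) (r := Ideal.Quotient.mk p x) ?_ ?_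
  · rw [mem_nonZeroDivisors_iff_ne_zero, Ne, Ideal.Quotient.eq_zero_iff_mem]; exact hxp
  · rw [Ideal.Quotient.factor_mk, Ideal.Quotient.eq_zero_iff_mem]; exact hx

lemma depth_le_ass {R : Type*} [CommRing R] [IsNoetherianRing R] [IsLocalRing R] (n : ℕ) :
    ∀ {M : Type _} [AddCommGroup M] [Module R M] [Module.Finite R M] (rs : List R)
      (_ : ∀ r ∈ rs, r ∈ maximalIdeal R) (_ : IsWeaklyRegular M rs) (_ : rs.length = n)
      (p : Ideal R) (_ : p ∈ associatedPrimes R M), (n : WithBot ℕ∞) ≤ ringKrullDim (R ⧸ p) := by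
  induction n with
  | zero =>
    intro M _ _ _ rs _ _ _ p hp
    have := Ideal.Quotient.nontrivial_iff.mpr hp.1.ne_top
    exact_mod_cast ringKrullDim_nonneg_of_nontrivial
  | succ k ih =>
    intro M _ _ _ rs hrs hreg hlen p hp
    match rs, hlen with
    | x :: rest, hlen =>
    rw [isWeaklyRegular_cons_iff] at hreg
    obtain ⟨hx, hrest⟩ := hreg
    have hxm : x ∈ maximalIdeal R := hrs x (by simp)
    have hp' := hp
    rw [AssociatedPrimes.mem_iff, isAssociatedPrime_iff] at hp'
    obtain ⟨hprime, u, hpu⟩ := hp'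
    have hmem : ∀ t, t ∈ p ↔ t • u = 0 := fun t => by
      rw [hpu]; simp [Submodule.mem_colon_singleton]
    have hu0 : u ≠ 0 := by
      rintro rfl
      exact hprime.ne_top ((Ideal.eq_top_iff_one _).mpr ((hmem 1).mpr (by simp)))
    let N : Submodule R M :=
      { carrier := {w | ∀ t ∈ p, t • w = 0}
        add_mem' := fun {a b} ha hb t ht => by rw [smul_add, ha t ht, hb t ht, add_zero]
        zero_mem' := fun t _ => smul_zero t
        smul_mem' := fun c w hw t ht => by rw [smul_comm, hw t ht, smul_zero] }
    have hNfg : N.FG := IsNoetherian.noetherian N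
    have hN : ∃ w ∈ N, ∀ w' ∈ N, w ≠ x • w' := by
      by_contra hcon
      push Not at hcon
      have : N = ⊥ := by
        refine Submodule.eq_bot_of_le_smul_of_le_jacobson_bot (maximalIdeal R) N hNfg ?_
          (IsLocalRing.maximalIdeal_le_jacobson _)
        intro w hw
        obtain ⟨w', hw', rfl⟩ := hcon w hw
        exact Submodule.smul_mem_smul hxm hw'
      have hu : u ∈ N := fun t ht => (hmem t).mp ht
      rw [this] at hu
      exact hu0 (by simpa using hu)
    obtain ⟨w, hwN, hw⟩ := hN
    have hw0 : (Submodule.Quotient.mk w : QuotSMulTop x M) ≠ 0 := by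
      rw [Ne, mem_quot_zero]
      rintro ⟨w', rfl⟩
      refine hw w' (fun t ht => ?_) rfl
      refine hx ?_
      show x • t • w' = x • 0
      rw [smul_comm, hwN t ht, smul_zero]
    obtain ⟨q, hq, hqle⟩ := exists_le_isAssociatedPrime_of_isNoetherianRing R _ hw0
    have h1 := ih (M := QuotSMulTop x M) rest (fun r hr => hrs r (by simp [hr])) hrest
      (by simpa using hlen) q hq
    have hpq : p ≤ q := fun t ht => hqle (by
      rw [Submodule.mem_colon_singleton, ← Submodule.Quotient.mk_smul, hwN t ht]; simp)
    have hxq : x ∈ q := hqle (by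
      rw [Submodule.mem_colon_singleton, ← Submodule.Quotient.mk_smul]
      exact (mem_quot_zero _ _).mpr ⟨w, rfl⟩)
    have hxp : x ∉ p := fun h => hu0 (hx (by
      show x • u = x • 0
      rw [(hmem x).mp h, smul_zero]))
    have h2 := dim_lt_of_lt p q hpq x hxq hxp
    push_cast
    exact (add_le_add_left h1 1).trans h2

lemma sop_regular_aux {R : Type*} [CommRing R] [IsNoetherianRing R] [IsLocalRing R]
    (ys : List R) : ∀ {M : Type _} [AddCommGroup M] [Module R M] [Module.Finite R M]
      (rs : List R) (_ : ∀ r ∈ rs, r ∈ maximalIdeal R) (_ : IsWeaklyRegular M rs)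
      (_ : rs.length = ys.length) (_ : ∀ r ∈ ys, r ∈ maximalIdeal R)
      (_ : ∀ p : Ideal R, p.IsPrime → Module.annihilator R M ≤ p → (∀ y ∈ ys, y ∈ p) →
        p = maximalIdeal R), IsWeaklyRegular M ys := by
  induction ys with
  | nil => intros; simp
  | cons y ys ih =>
    intro M _ _ _ rs hrs hreg hlen hys hmin
    have hym := hys y (by simp)
    have hy : IsSMulRegular M y := by
      by_contra hcon
      have : y ∈ ⋃ p ∈ associatedPrimes R M, (p : Set R) := by
        rw [biUnion_associatedPrimes_eq_compl_regular]; exact hcon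
      simp only [Set.mem_iUnion] at this
      obtain ⟨p, hp, hyp⟩ := this
      have h1 := depth_le_ass _ rs hrs hreg hlen p hp
      have hann : Module.annihilator R M ≤ p := by
        rw [← Submodule.annihilator_top]; exact IsAssociatedPrime.annihilator_le hp
      have hpp : p.IsPrime := hp.1
      have hnt : Nontrivial (R ⧸ p) := Ideal.Quotient.nontrivial_iff.mpr hpp.ne_top
      have : IsLocalRing (R ⧸ p) :=
        IsLocalRing.of_surjective' (Ideal.Quotient.mk p) Ideal.Quotient.mk_surjective
      classical
      let s : Finset (R ⧸ p) := (ys.map (Ideal.Quotient.mk p)).toFinset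
      have hs : maximalIdeal (R ⧸ p) ∈ (Ideal.span (s : Set (R ⧸ p))).minimalPrimes := by
        refine ⟨⟨inferInstance, ?_⟩, ?_⟩
        · rw [Ideal.span_le]
          intro a ha
          simp only [s, List.coe_toFinset, List.mem_map, Set.mem_ofPred_eq] at ha
          obtain ⟨b, hb, rfl⟩ := ha
          have hb' := hys b (by simp [hb])
          rw [SetLike.mem_coe, mem_maximalIdeal, mem_nonunits_iff]
          intro hu
          have : IsLocalHom (Ideal.Quotient.mk p) := 
            .of_surjective _ Ideal.Quotient.mk_surjective
          exact hb' (isUnit_of_map_unit (Ideal.Quotient.mk p) b hu)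
        · rintro Q ⟨hQ, hsQ⟩ -
          have hcm := hmin (Q.comap (Ideal.Quotient.mk p)) inferInstance
            (hann.trans (fun t ht => by
              rw [Ideal.mem_comap, Ideal.Quotient.eq_zero_iff_mem.mpr ht]; exact Q.zero_mem))
            (by
              intro z hz
              rw [List.mem_cons] at hz
              rw [Ideal.mem_comap]
              rcases hz with rfl | hz
              · rw [Ideal.Quotient.eq_zero_iff_mem.mpr hyp]; exact Q.zero_mem
              · apply hsQ; apply Ideal.subset_span
                simp only [s, List.coe_toFinset, List.mem_map, Set.mem_ofPred_eq]
                exact ⟨z, hz, rfl⟩)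
          intro a ha
          obtain ⟨a, rfl⟩ := Ideal.Quotient.mk_surjective a
          rw [← Ideal.mem_comap, hcm, mem_maximalIdeal, mem_nonunits_iff]
          intro hu
          exact ha (hu.map _)
      have h2 := Ideal.height_le_card_of_mem_minimalPrimes_span_finset hs
      have h3 : s.card ≤ ys.length := (List.toFinset_card_le _).trans (by simp)
      have h4 := IsLocalRing.maximalIdeal_height_eq_ringKrullDim (R := R ⧸ p)
      rw [← h4] at h1
      have h5 : ((y :: ys).length : ℕ∞) ≤ (maximalIdeal (R ⧸ p)).height := by exact_mod_cast h1
      have h6 := h5.trans h2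
      have h7 : (y :: ys).length ≤ s.card := by exact_mod_cast h6
      simp at h7
      omega
    obtain ⟨ts, hts, htl, htr⟩ := exchange ys.length rs hrs hreg hlen y hym hy
    rw [isWeaklyRegular_cons_iff]
    refine ⟨hy, ih ts hts htr htl (fun r hr => hys r (by simp [hr])) ?_⟩
    intro p hp hann hall
    refine hmin p hp (le_trans ?_ hann) ?_
    · intro t ht
      rw [Module.mem_annihilator] at ht ⊢
      intro m
      obtain ⟨m, rfl⟩ := Submodule.Quotient.mk_surjective _ m
      rw [← Submodule.Quotient.mk_smul, ht m]; rfl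
    · intro z hz
      rw [List.mem_cons] at hz
      rcases hz with rfl | hz
      · exact hann (QuotSMulTop.mem_annihilator _ _)
      · exact hall z hz

end MR

end Part1

section Part2
open RingTheory.Sequence IsLocalRing

namespace MR

/-- local regularity at `P` of the sequence `rs` modulo `𝔞`. -/
def LocReg {R : Type*} [CommRing R] (P : Ideal R) : Ideal R → List R → Prop
  | _, [] => True
  | 𝔞, (r :: rs) => (∀ x, r * x ∈ 𝔞 → ∃ s, s ∉ P ∧ s * x ∈ 𝔞) ∧ LocReg P (𝔞 ⊔ Ideal.span {r}) rs

lemma locReg_iff {R : Type*} [CommRing R] (P : Ideal R) (rs : List R) : ∀ (𝔞 : Ideal R),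
    LocReg P 𝔞 rs ↔ ∀ (i : ℕ) (h : i < rs.length) (x : R),
      rs[i] * x ∈ 𝔞 ⊔ Ideal.ofList (rs.take i) → ∃ s, s ∉ P ∧ s * x ∈ 𝔞 ⊔ Ideal.ofList (rs.take i) := by
  induction rs with
  | nil => intro 𝔞; simp [LocReg]
  | cons r rs ih =>
    intro 𝔞
    rw [LocReg, ih]
    constructor
    · rintro ⟨h1, h2⟩ i hi x hx
      cases i with
      | zero => simpa using h1 x (by simpa using hx)
      | succ i =>
        have := h2 i (by simpa using hi) x (by simpa [sup_assoc] using hx)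
        simpa [sup_assoc] using this
    · intro h
      refine ⟨fun x hx => by simpa using h 0 (by simp) x (by simpa using hx), fun i hi x hx => ?_⟩
      have := h (i+1) (by simpa using hi) x (by simpa [sup_assoc] using hx)
      simpa [sup_assoc] using this

lemma locReg_iff_weak {R : Type*} [CommRing R] (P : Ideal R) [P.IsPrime] (rs : List R) :
    LocReg P ⊥ rs ↔ IsWeaklyRegular (Localization.AtPrime P)
      (rs.map (algebraMap R (Localization.AtPrime P))) := by
  rw [locReg_iff, isWeaklyRegular_iff]
  simp only [isSMulRegular_quotient_iff_mem_of_smul_mem, List.length_map]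
  refine forall_congr' fun i => forall_congr' fun hi => ?_
  have e : (Ideal.ofList (List.take i (List.map (algebraMap R (Localization.AtPrime P)) rs))) •
      (⊤ : Submodule (Localization.AtPrime P) (Localization.AtPrime P)) =
      (Ideal.ofList (rs.take i)).map (algebraMap R (Localization.AtPrime P)) := by
    rw [Ideal.map_ofList, List.map_take]; simp
  rw [e]
  simp only [bot_sup_eq, List.getElem_map, smul_eq_mul]
  constructor
  · intro h x hx
    obtain ⟨y, t, rfl⟩ := IsLocalization.exists_mk'_eq P.primeCompl x
    have h1 : algebraMap R (Localization.AtPrime P) (rs[i] * y) ∈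
        (Ideal.ofList (rs.take i)).map (algebraMap R (Localization.AtPrime P)) := by
      have := Ideal.mul_mem_right (algebraMap R (Localization.AtPrime P) t) _ hx
      rwa [mul_assoc, IsLocalization.mk'_spec, ← map_mul] at this
    rw [IsLocalization.algebraMap_mem_map_algebraMap_iff P.primeCompl] at h1
    obtain ⟨m, hm, hmem⟩ := h1
    obtain ⟨s, hs, hs'⟩ := h (m * y) (by rwa [mul_left_comm])
    rw [IsLocalization.mk'_mem_map_algebraMap_iff P.primeCompl]
    exact ⟨s * m, mul_mem (s := P.primeCompl) hs hm, by rwa [mul_assoc]⟩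
  · intro h x hx
    have := h (algebraMap R _ x) (by rw [← map_mul]; exact Ideal.mem_map_of_mem _ hx)
    rw [IsLocalization.algebraMap_mem_map_algebraMap_iff P.primeCompl] at this
    exact this

theorem cm_crit {R : Type*} [CommRing R] [IsNoetherianRing R] (P : Ideal R) [P.IsPrime]
    (rs : List R) (hrs : ∀ r ∈ rs, r ∈ P) (hreg : LocReg P ⊥ rs) (hht : P.height ≤ rs.length) :
    IsCohenMacaulayLocalRing (Localization.AtPrime P) := by
  have hmem : ∀ r ∈ rs.map (algebraMap R (Localization.AtPrime P)), r ∈ maximalIdeal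
      (Localization.AtPrime P) := by
    intro r hr
    obtain ⟨r, hr', rfl⟩ := List.mem_map.mp hr
    rw [IsLocalization.AtPrime.to_map_mem_maximal_iff _ P]
    exact hrs r hr'
  have hR : RingTheory.Sequence.IsRegular (Localization.AtPrime P)
      (rs.map (algebraMap R (Localization.AtPrime P))) :=
    .of_isWeaklyRegular_of_mem_maximalIdeal _ hmem ((locReg_iff_weak P rs).mp hreg)
  refine ⟨inferInstance, inferInstance, _, hmem, hR, ?_⟩
  have h1 := ringKrullDim_add_length_eq_ringKrullDim_of_isRegular _ hR
  have h2 := IsLocalization.AtPrime.ringKrullDim_eq_height P (Localization.AtPrime P)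
  have h3 : (0 : WithBot ℕ∞) ≤ ringKrullDim (Localization.AtPrime P ⧸
      Ideal.ofList (rs.map (algebraMap R (Localization.AtPrime P)))) := by
    have : Nontrivial (Localization.AtPrime P ⧸
      Ideal.ofList (rs.map (algebraMap R (Localization.AtPrime P)))) := by
      rw [Ideal.Quotient.nontrivial_iff]
      intro h
      have : Ideal.ofList (rs.map (algebraMap R (Localization.AtPrime P))) ≤ maximalIdeal _ :=
        Ideal.span_le.mpr hmem
      rw [h] at this
      exact (maximalIdeal.isMaximal _).ne_top (top_le_iff.mp this)
    exact ringKrullDim_nonneg_of_nontrivial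
  apply le_antisymm
  · rw [← h1]; exact le_add_of_nonneg_left h3
  · rw [h2]; simp only [List.length_map]; exact_mod_cast hht

lemma height_le_of_min {R : Type*} [CommRing R] [IsNoetherianRing R] (P : Ideal R) [P.IsPrime]
    (rs : List R) (hrs : ∀ r ∈ rs, r ∈ P)
    (hmin : ∀ Q : Ideal R, Q.IsPrime → Q ≤ P → (∀ r ∈ rs, r ∈ Q) → P ≤ Q) :
    P.height ≤ rs.length := by
  classical
  have : P ∈ (Ideal.span ((rs.toFinset : Finset R) : Set R)).minimalPrimes := by
    refine ⟨⟨inferInstance, Ideal.span_le.mpr (by intro x hx; exact hrs x (by simpa using hx))⟩, ?_⟩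
    rintro Q ⟨hQ, hs⟩ hle
    exact hmin Q hQ hle (fun r hr => hs (Ideal.subset_span (by simpa using hr)))
  exact (Ideal.height_le_card_of_mem_minimalPrimes_span_finset this).trans
    (by exact_mod_cast List.toFinset_card_le rs)

theorem cm_crit' {R : Type*} [CommRing R] [IsNoetherianRing R] (P : Ideal R) [P.IsPrime]
    (rs : List R) (hrs : ∀ r ∈ rs, r ∈ P) (hreg : LocReg P ⊥ rs)
    (hmin : ∀ Q : Ideal R, Q.IsPrime → Q ≤ P → (∀ r ∈ rs, r ∈ Q) → P ≤ Q) :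
    IsCohenMacaulayLocalRing (Localization.AtPrime P) :=
  cm_crit P rs hrs hreg (height_le_of_min P rs hrs hmin)

theorem cm_sop {R : Type*} [CommRing R] [IsNoetherianRing R] (P : Ideal R) [P.IsPrime]
    (hcm : IsCohenMacaulayLocalRing (Localization.AtPrime P)) (rs : List R)
    (hrs : ∀ r ∈ rs, r ∈ P)
    (hmin : ∀ Q : Ideal R, Q.IsPrime → Q ≤ P → (∀ r ∈ rs, r ∈ Q) → P ≤ Q)
    (hlen : (rs.length : ℕ∞) ≤ P.height) : LocReg P ⊥ rs := by
  rw [locReg_iff_weak]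
  obtain ⟨-, hloc, xs, hxs, hreg, hl⟩ := hcm
  have h2 := IsLocalization.AtPrime.ringKrullDim_eq_height P (Localization.AtPrime P)
  have h3 := le_antisymm hlen (height_le_of_min P rs hrs hmin)
  rw [h2, ← h3] at hl
  refine sop_regular_aux (R := Localization.AtPrime P) _ xs hxs hreg.toIsWeaklyRegular
    (by simp only [List.length_map]; exact_mod_cast hl) ?_ ?_
  · intro r hr
    obtain ⟨r, hr', rfl⟩ := List.mem_map.mp hr
    rw [IsLocalization.AtPrime.to_map_mem_maximal_iff _ P]
    exact hrs r hr'
  · intro p hp _ hall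
    refine le_antisymm (IsLocalRing.le_maximalIdeal hp.ne_top) ?_
    have hle : p.comap (algebraMap R (Localization.AtPrime P)) ≤ P := by
      intro x hx
      rw [← IsLocalization.AtPrime.to_map_mem_maximal_iff (Localization.AtPrime P) P]
      exact IsLocalRing.le_maximalIdeal hp.ne_top hx
    have := hmin (p.comap (algebraMap R (Localization.AtPrime P))) inferInstance hle
      (fun r hr => hall _ (List.mem_map_of_mem hr))
    rw [← Localization.AtPrime.map_eq_maximalIdeal, Ideal.map_le_iff_le_comap]
    exact this

theorem cm_list {R : Type*} [CommRing R] [IsNoetherianRing R] (P : Ideal R) [P.IsPrime]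
    (hcm : IsCohenMacaulayLocalRing (Localization.AtPrime P)) :
    ∃ rs : List R, (∀ r ∈ rs, r ∈ P) ∧ LocReg P ⊥ rs ∧ (rs.length : ℕ∞) = P.height ∧
    (∀ Q : Ideal R, Q.IsPrime → Q ≤ P → (∀ r ∈ rs, r ∈ Q) → P ≤ Q) := by
  obtain ⟨s, hs, hc⟩ := P.exists_finset_card_eq_height_of_isNoetherianRing
  have h1 : ∀ r ∈ s.toList, r ∈ P := fun r hr => hs.1.2 (Ideal.subset_span (by simpa using hr))
  have h2 : ∀ Q : Ideal R, Q.IsPrime → Q ≤ P → (∀ r ∈ s.toList, r ∈ Q) → P ≤ Q :=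
    fun Q hQ hle hall => hs.2 ⟨hQ, Ideal.span_le.mpr (fun x hx => hall x (by simpa using hx))⟩ hle
  have h3 : ((s.toList.length : ℕ) : ℕ∞) = P.height := by rw [Finset.length_toList]; exact hc
  exact ⟨s.toList, h1, cm_sop P hcm _ h1 h2 h3.le, h3, h2⟩

lemma cm_local_equiv {R S : Type*} [CommRing R] [CommRing S] (e : R ≃+* S)
    (h : IsCohenMacaulayLocalRing R) : IsCohenMacaulayLocalRing S := by
  obtain ⟨hn, hl, rs, hrs, hreg, hlen⟩ := h
  have hS : IsLocalRing S := e.isLocalRing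
  refine ⟨isNoetherianRing_of_ringEquiv R e, hS, rs.map e, ?_, ?_, ?_⟩
  · intro x hx
    obtain ⟨r, hr, rfl⟩ := List.mem_map.mp hx
    have := hrs r hr
    rw [mem_maximalIdeal, mem_nonunits_iff] at this ⊢
    simpa using this
  · refine (AddEquiv.isRegular_congr (e := e.toAddEquiv) (as := rs) (bs := rs.map e) ?_).mp hreg
    rw [List.forall₂_map_right_iff, List.forall₂_same]
    intro x _ y
    simp
  · rw [List.length_map, hlen, ringKrullDim_eq_of_ringEquiv e]

/-- Chart lemma. -/
theorem cm_chart {R R' : Type*} [CommRing R] [CommRing R'] (j : R →+* R')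
    (hj : Function.Injective j) (f : R) (hf : ∀ y : R', ∃ (n : ℕ) (r : R), j f ^ n * y = j r)
    (hR' : IsCohenMacaulayRing R') (P : Ideal R) [hP : P.IsPrime] (hfP : f ∉ P) :
    IsCohenMacaulayLocalRing (Localization.AtPrime P) := by
  have hmap : ∀ z ∈ P.map j, ∃ (n : ℕ), ∃ r ∈ P, j f ^ n * z = j r := by
    intro z hz
    refine Submodule.span_induction ?_ ?_ ?_ ?_ hz
    · rintro x ⟨r, hr, rfl⟩; exact ⟨0, r, hr, by simp⟩
    · exact ⟨0, 0, P.zero_mem, by simp⟩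
    · rintro x y _ _ ⟨n, r, hr, e⟩ ⟨m, r', hr', e'⟩
      refine ⟨n + m, f ^ m * r + f ^ n * r', P.add_mem (P.mul_mem_left _ hr)
        (P.mul_mem_left _ hr'), ?_⟩
      rw [map_add, map_mul, map_mul, ← e, ← e', map_pow, map_pow]; ring
    · rintro a x _ ⟨n, r, hr, e⟩
      obtain ⟨m, r', e'⟩ := hf a
      refine ⟨m + n, r' * r, P.mul_mem_left _ hr, ?_⟩
      rw [map_mul, ← e, ← e', smul_eq_mul]; ring
  have hex : ∃ q : Ideal R', q.IsPrime ∧ q.comap j = P := by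
    rw [← Ideal.comap_map_eq_self_iff_of_isPrime]
    refine le_antisymm ?_ Ideal.le_comap_map
    intro x hx
    obtain ⟨n, r, hr, e⟩ := hmap _ hx
    rw [← map_pow, ← map_mul] at e
    have := hj e
    rw [← this] at hr
    exact (hP.mem_or_mem hr).resolve_left (fun h => hfP (hP.mem_of_pow_mem _ h))
  obtain ⟨q, hq, hqP⟩ := hex
  have hfq : j f ∉ q := fun h => hfP (by rw [← hqP]; exact h)
  have key : Function.Bijective (Localization.localRingHom P q j hqP.symm) := by
    constructor
    · rw [injective_iff_map_eq_zero]
      intro x hx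
      obtain ⟨r, s, rfl⟩ := IsLocalization.exists_mk'_eq P.primeCompl x
      rw [Localization.localRingHom_mk', IsLocalization.mk'_eq_zero_iff] at hx
      obtain ⟨⟨t, ht⟩, hx⟩ := hx
      obtain ⟨n, r', e⟩ := hf t
      rw [IsLocalization.mk'_eq_zero_iff]
      refine ⟨⟨r', fun h => ?_⟩, hj ?_⟩
      · have h' : j r' ∈ q := by rw [← hqP] at h; exact h
        rw [← e] at h'
        rcases hq.mem_or_mem h' with h | h
        · exact hfq (hq.mem_of_pow_mem _ h)
        · exact ht h
      · simp only at hx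
        rw [map_mul, ← e, map_zero, mul_assoc, hx, mul_zero]
    · intro x
      obtain ⟨y, ⟨t, ht⟩, rfl⟩ := IsLocalization.exists_mk'_eq q.primeCompl x
      obtain ⟨n, r, e⟩ := hf y
      obtain ⟨m, r', e'⟩ := hf t
      have hr' : r' ∉ P := fun h => by
        have h' : j r' ∈ q := by rw [← hqP] at h; exact h
        rw [← e'] at h'
        rcases hq.mem_or_mem h' with h | h
        · exact hfq (hq.mem_of_pow_mem _ h)
        · exact ht h
      have hden : f ^ n * r' ∈ P.primeCompl := fun h => by
        rcases hP.mem_or_mem h with h | h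
        · exact hfP (hP.mem_of_pow_mem _ h)
        · exact hr' h
      refine ⟨IsLocalization.mk' _ (f ^ m * r) ⟨f ^ n * r', hden⟩, ?_⟩
      · rw [Localization.localRingHom_mk', IsLocalization.mk'_eq_iff_eq]
        congr 1
        simp only [map_mul, map_pow, ← e, ← e']
        ring
  exact cm_local_equiv (RingEquiv.ofBijective _ key).symm (hR'.2 q hq)

theorem cm_equiv {R S : Type*} [CommRing R] [CommRing S] (e : R ≃+* S)
    (h : IsCohenMacaulayRing R) : IsCohenMacaulayRing S := by
  have := h.1
  refine ⟨isNoetherianRing_of_ringEquiv R e, fun P hP => ?_⟩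
  have := hP
  refine cm_chart e.symm.toRingHom e.symm.injective 1 (fun y => ⟨0, e y, by simp⟩) h P
    (fun h => hP.ne_top ((Ideal.eq_top_iff_one _).mpr h))

end MR

end Part2

section Part3
open RingTheory.Sequence IsLocalRing Polynomial

namespace MR

lemma locReg_append {R : Type*} [CommRing R] (P : Ideal R) (rs ss : List R) : ∀ (𝔞 : Ideal R),
    LocReg P 𝔞 rs → LocReg P (𝔞 ⊔ Ideal.ofList rs) ss → LocReg P 𝔞 (rs ++ ss) := by
  induction rs with
  | nil => intro 𝔞 _ h; simpa using h
  | cons r rs ih =>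
    intro 𝔞 h1 h2
    exact ⟨h1.1, ih _ h1.2 (by simpa [sup_assoc] using h2)⟩

lemma poly_clear {B : Type*} [CommRing B] (p : Ideal B) [hp : p.IsPrime] (𝔞 : Ideal B) (q : B[X])
    (h : ∀ i, ∃ s, s ∉ p ∧ s * q.coeff i ∈ 𝔞) : ∃ s, s ∉ p ∧ C s * q ∈ 𝔞.map C := by
  choose s hs hs' using h
  refine ⟨∏ i ∈ q.support, s i, ?_, ?_⟩
  · rw [hp.prod_mem_iff]; push Not; intro i _; exact hs i
  · rw [Ideal.mem_map_C_iff]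
    intro i
    rw [coeff_C_mul]
    by_cases hi : i ∈ q.support
    · rw [← Finset.prod_erase_mul _ _ hi, mul_assoc]
      exact 𝔞.mul_mem_left _ (hs' i)
    · rw [notMem_support_iff.mp hi, mul_zero]; exact 𝔞.zero_mem

lemma locReg_map_C {B : Type*} [CommRing B] (p : Ideal B) [hp : p.IsPrime] (P : Ideal B[X])
    (hPp : P.comap C = p) (rs : List B) : ∀ 𝔞 : Ideal B, LocReg p 𝔞 rs →
    LocReg P (𝔞.map C) (rs.map C) := by
  induction rs with
  | nil => intros; trivial
  | cons r rs ih =>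
    intro 𝔞 h
    refine ⟨?_, ?_⟩
    · intro q hq
      have := poly_clear p 𝔞 q (fun i => h.1 _ (by
        rw [Ideal.mem_map_C_iff] at hq
        have := hq i
        rwa [coeff_C_mul] at this))
      obtain ⟨s, hs, hs'⟩ := this
      exact ⟨C s, fun h => hs (by rw [← hPp]; exact h), hs'⟩
    · have := ih _ h.2
      rwa [Ideal.map_sup, Ideal.map_span, Set.image_singleton] at this

lemma lead_cancel {B : Type*} [CommRing B] (𝔞 : Ideal B) (g : B[X]) (n : ℕ) :
    ∀ q : B[X], q.natDegree < n → g * q ∈ 𝔞.map C →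
      ∃ N : ℕ, C g.leadingCoeff ^ N * q ∈ 𝔞.map C := by
  induction n with
  | zero => intro q h; omega
  | succ n ih =>
    intro q hq hmem
    by_cases h0 : q = 0
    · exact ⟨0, by simp [h0]⟩
    have h1 : g.leadingCoeff * q.leadingCoeff ∈ 𝔞 := by
      rw [Ideal.mem_map_C_iff] at hmem
      have := hmem (g.natDegree + q.natDegree)
      rwa [coeff_mul_degree_add_degree] at this
    have h2 : C (g.leadingCoeff * q.leadingCoeff) * X ^ q.natDegree ∈ 𝔞.map C :=
      Ideal.mul_mem_right _ _ (Ideal.mem_map_of_mem _ h1)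
    have hq' : C g.leadingCoeff * q.eraseLead = C g.leadingCoeff * q
        - C (g.leadingCoeff * q.leadingCoeff) * X ^ q.natDegree := by
      rw [← self_sub_C_mul_X_pow, C_mul]; ring
    by_cases hd : q.natDegree = 0
    · refine ⟨1, ?_⟩
      have e : q = C q.leadingCoeff := by
        rw [leadingCoeff, hd]; exact eq_C_of_natDegree_eq_zero hd
      have e2 : C g.leadingCoeff ^ 1 * q = C (g.leadingCoeff * q.leadingCoeff) := by
        rw [pow_one, C_mul, ← e]
      rw [e2]
      exact Ideal.mem_map_of_mem _ h1
    obtain ⟨N, hN⟩ := ih (C g.leadingCoeff * q.eraseLead) (by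
      have := natDegree_C_mul_le g.leadingCoeff q.eraseLead
      have := eraseLead_natDegree_le q
      omega) (by
      rw [hq', mul_sub]
      refine Ideal.sub_mem _ ?_ (Ideal.mul_mem_left _ _ h2)
      rw [mul_left_comm]; exact Ideal.mul_mem_left _ _ hmem)
    refine ⟨N + 1, ?_⟩
    have : C g.leadingCoeff ^ (N + 1) * q = C g.leadingCoeff ^ N * (C g.leadingCoeff * q.eraseLead)
        + C g.leadingCoeff ^ N * (C (g.leadingCoeff * q.leadingCoeff) * X ^ q.natDegree) := by
      rw [hq']; ring
    rw [this]
    exact Ideal.add_mem _ hN (Ideal.mul_mem_left _ _ h2)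

theorem cm_poly {B : Type*} [CommRing B] (hB : IsCohenMacaulayRing B) :
    IsCohenMacaulayRing B[X] := by
  have hN := hB.1
  refine ⟨inferInstance, fun P hP => ?_⟩
  have := hP
  set p := P.comap (C : B →+* B[X]) with hp
  have hpp : p.IsPrime := inferInstance
  obtain ⟨rs, hrs, hreg, hlen, hmin⟩ := cm_list p (hB.2 p inferInstance)
  have hreg' : LocReg P ⊥ (rs.map C) := by
    have := locReg_map_C p P hp.symm rs ⊥ hreg
    rwa [Ideal.map_bot] at this
  have hrs' : ∀ r ∈ rs.map (C : B →+* B[X]), r ∈ P := by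
    intro r hr
    obtain ⟨b, hb, rfl⟩ := List.mem_map.mp hr
    exact hrs b hb
  have hQp : ∀ Q : Ideal B[X], Q.IsPrime → Q ≤ P → (∀ r ∈ rs.map (C : B →+* B[X]), r ∈ Q) →
      p ≤ Q.comap C := by
    intro Q hQ hle hall
    exact hmin _ inferInstance (Ideal.comap_mono hle) (fun r hr => hall _ (List.mem_map_of_mem hr))
  by_cases hPeq : P ≤ p.map C
  · refine cm_crit' P (rs.map C) hrs' hreg' ?_
    intro Q hQ hle hall
    exact hPeq.trans (Ideal.map_le_iff_le_comap.mpr (hQp Q hQ hle hall))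
  · have hex : ∃ n : ℕ, ∃ g ∈ P, g ∉ p.map C ∧ g.natDegree = n := by
      obtain ⟨g, hg, hg'⟩ := Set.not_subset.mp hPeq
      exact ⟨_, g, hg, hg', rfl⟩
    classical
    obtain ⟨g, hgP, hgp, hgn⟩ := Nat.find_spec hex
    have hmindeg : ∀ h ∈ P, h.natDegree < g.natDegree → h ∈ p.map C := by
      intro h hh hlt
      by_contra hcon
      exact Nat.find_min hex (by rw [← hgn]; exact hlt) ⟨h, hh, hcon, rfl⟩
    have hpP : p.map C ≤ P := Ideal.map_comap_le
    have hu : g.leadingCoeff ∉ p := by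
      intro hu
      have h1 : C g.leadingCoeff * X ^ g.natDegree ∈ p.map C :=
        Ideal.mul_mem_right _ _ (Ideal.mem_map_of_mem _ hu)
      have h2 : g.eraseLead ∈ P := by
        rw [← self_sub_C_mul_X_pow]; exact P.sub_mem hgP (hpP h1)
      have h3 : g.eraseLead ∈ p.map C := by
        by_cases hd : g.natDegree = 0
        · have : g.eraseLead = 0 := by
            rw [← self_sub_C_mul_X_pow, hd, pow_zero, mul_one, leadingCoeff, hd,
              ← eq_C_of_natDegree_eq_zero hd, sub_self]
          rw [this]; exact Ideal.zero_mem _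
        · exact hmindeg _ h2 (by have := eraseLead_natDegree_le g; omega)
      apply hgp
      rw [← eraseLead_add_C_mul_X_pow g]
      exact Ideal.add_mem _ h3 h1
    have hred : ∀ n : ℕ, ∀ h ∈ P, h.natDegree < n → ∃ N : ℕ,
        C g.leadingCoeff ^ N * h ∈ p.map C ⊔ Ideal.span {g} := by
      intro n
      induction n with
      | zero => intro h _ hlt; omega
      | succ n ih =>
        intro h hh hlt
        by_cases hlt' : h.natDegree < g.natDegree
        · exact ⟨0, by simpa using Ideal.mem_sup_left (hmindeg h hh hlt')⟩
        by_cases hd : h.natDegree = 0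
        · have hg0 : g.natDegree = 0 := by omega
          refine ⟨1, Ideal.mem_sup_right ?_⟩
          rw [Ideal.mem_span_singleton, pow_one, leadingCoeff, hg0,
            ← eq_C_of_natDegree_eq_zero hg0]
          exact dvd_mul_right _ _
        set d := h.natDegree - g.natDegree with hdd
        set h' := C g.leadingCoeff * h - C h.leadingCoeff * X ^ d * g with hh'
        have hdeg : h'.natDegree < h.natDegree := by
          have h1 : h'.natDegree ≤ h.natDegree := by
            refine (natDegree_sub_le _ _).trans (max_le (natDegree_C_mul_le _ _) ?_)
            refine natDegree_mul_le.trans ?_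
            have := natDegree_C_mul_X_pow_le h.leadingCoeff d
            omega
          refine lt_of_le_of_ne h1 (fun heq => ?_)
          have h2 : h'.coeff h.natDegree = 0 := by
            have e : h.natDegree = g.natDegree + d := by omega
            rw [hh', coeff_sub, coeff_C_mul, mul_assoc, coeff_C_mul]
            conv_lhs => enter [2, 2]; rw [e, mul_comm, coeff_mul_X_pow]
            rw [← leadingCoeff, ← leadingCoeff]; ring
          rw [← heq] at h2
          have h3 : h' = 0 := leadingCoeff_eq_zero.mp h2
          rw [h3] at heq; simp at heq; omega
        obtain ⟨N, hN⟩ := ih h' (P.sub_mem (P.mul_mem_left _ hh) (P.mul_mem_left _ hgP)) (by omega)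
        refine ⟨N + 1, ?_⟩
        have : C g.leadingCoeff ^ (N + 1) * h = C g.leadingCoeff ^ N * h' +
            (C g.leadingCoeff ^ N * (C h.leadingCoeff * X ^ d)) * g := by rw [hh']; ring
        rw [this]
        exact Ideal.add_mem _ hN (Ideal.mul_mem_left _ _ (Ideal.mem_sup_right
          (Ideal.mem_span_singleton_self g)))
    refine cm_crit' P (rs.map C ++ [g]) ?_ ?_ ?_
    · intro r hr
      rcases List.mem_append.mp hr with hr | hr
      · exact hrs' r hr
      · rw [List.mem_singleton] at hr; rwa [hr]
    · refine locReg_append _ _ _ _ hreg' ⟨?_, trivial⟩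
      rw [bot_sup_eq, ← Ideal.map_ofList]
      intro q hq
      obtain ⟨N, hN⟩ := lead_cancel _ g _ q (Nat.lt_succ_self _) hq
      exact ⟨_, fun h => hu (hP.mem_of_pow_mem _ h), hN⟩
    · intro Q hQ hle hall h hh
      have h1 := hQp Q hQ hle (fun r hr => hall r (List.mem_append_left _ hr))
      have h2 : g ∈ Q := hall g (by simp)
      obtain ⟨N, hN⟩ := hred _ h hh (Nat.lt_succ_self _)
      have h3 : p.map C ⊔ Ideal.span {g} ≤ Q :=
        sup_le (Ideal.map_le_iff_le_comap.mpr h1) ((Ideal.span_singleton_le_iff_mem _).mpr h2)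
      refine (hQ.mem_or_mem (h3 hN)).resolve_left (fun h => hu ?_)
      exact hle (hQ.mem_of_pow_mem _ h)

end MR

end Part3

section Part4
open RingTheory.Sequence IsLocalRing Polynomial

namespace MR

lemma locReg_mono {R : Type*} [CommRing R] (P Q : Ideal R) (h : Q ≤ P) (rs : List R) : ∀ 𝔞 : Ideal R,
    LocReg P 𝔞 rs → LocReg Q 𝔞 rs := by
  induction rs with
  | nil => intros; trivial
  | cons r rs ih =>
    intro 𝔞 hl
    refine ⟨fun x hx => ?_, ih _ hl.2⟩
    obtain ⟨s, hs, h'⟩ := hl.1 x hx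
    exact ⟨s, fun hq => hs (h hq), h'⟩

lemma locReg_height {R : Type*} [CommRing R] [IsNoetherianRing R] (P : Ideal R) [P.IsPrime]
    (rs : List R) (hrs : ∀ r ∈ rs, r ∈ P) (hreg : LocReg P ⊥ rs) : (rs.length : ℕ∞) ≤ P.height := by
  have hmem : ∀ r ∈ rs.map (algebraMap R (Localization.AtPrime P)), r ∈ maximalIdeal
      (Localization.AtPrime P) := by
    intro r hr
    obtain ⟨r, hr', rfl⟩ := List.mem_map.mp hr
    rw [IsLocalization.AtPrime.to_map_mem_maximal_iff _ P]
    exact hrs r hr'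
  have hR : RingTheory.Sequence.IsRegular (Localization.AtPrime P)
      (rs.map (algebraMap R (Localization.AtPrime P))) :=
    .of_isWeaklyRegular_of_mem_maximalIdeal _ hmem ((locReg_iff_weak P rs).mp hreg)
  have h1 := ringKrullDim_add_length_eq_ringKrullDim_of_isRegular _ hR
  have h2 := IsLocalization.AtPrime.ringKrullDim_eq_height P (Localization.AtPrime P)
  have h3 : (0 : WithBot ℕ∞) ≤ ringKrullDim (Localization.AtPrime P ⧸
      Ideal.ofList (rs.map (algebraMap R (Localization.AtPrime P)))) := by
    have : Nontrivial (Localization.AtPrime P ⧸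
      Ideal.ofList (rs.map (algebraMap R (Localization.AtPrime P)))) := by
      rw [Ideal.Quotient.nontrivial_iff]
      intro h
      have : Ideal.ofList (rs.map (algebraMap R (Localization.AtPrime P))) ≤ maximalIdeal _ :=
        Ideal.span_le.mpr hmem
      rw [h] at this
      exact (maximalIdeal.isMaximal _).ne_top (top_le_iff.mp this)
    exact ringKrullDim_nonneg_of_nontrivial
  have h4 : (rs.length : WithBot ℕ∞) ≤ P.height := by
    rw [← h2, ← h1, List.length_map]; exact le_add_of_nonneg_left h3
  exact_mod_cast h4

lemma locReg_min {R : Type*} [CommRing R] [IsNoetherianRing R] (P : Ideal R) [P.IsPrime]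
    (rs : List R) (hreg : LocReg P ⊥ rs) (hht : P.height ≤ rs.length)
    (Q : Ideal R) (hQ : Q.IsPrime) (hQP : Q ≤ P) (hrs : ∀ r ∈ rs, r ∈ Q) : P ≤ Q := by
  have h1 := locReg_height Q rs hrs (locReg_mono P Q hQP rs _ hreg)
  by_contra hne
  have h2 := Ideal.height_add_one_le_of_lt_of_isPrime (I := Q) (J := P)
    (lt_of_le_of_ne hQP (fun h => hne h.ge))
  have h3 := h2.trans hht
  have h4 := (add_le_add_left h1 1).trans h3
  exact absurd h4 (by norm_cast; simp)

/-- In a normal noetherian local domain of dimension at least two, depth at least two. -/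
lemma normal_depth_local {R : Type*} [CommRing R] [IsDomain R] [IsNoetherianRing R] [IsLocalRing R]
    [IsIntegrallyClosed R] (hdim : 2 ≤ (maximalIdeal R).height) (γ : R) (hγ : γ ≠ 0) :
    ∃ z ∈ maximalIdeal R, ∀ u, z * u ∈ Ideal.span {γ} → u ∈ Ideal.span {γ} := by
  have := regular_or_socle (R := R) (N := R ⧸ Ideal.span {γ}) ?_
  · obtain ⟨z, hz, hreg⟩ := this
    refine ⟨z, hz, fun u hu => ?_⟩
    rw [← Ideal.Quotient.eq_zero_iff_mem] at hu ⊢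
    refine hreg.right_eq_zero_of_smul ?_
    rw [← hu]; rfl
  · intro u
    obtain ⟨u, rfl⟩ := Ideal.Quotient.mk_surjective u
    intro hu
    have hu' : ∀ t ∈ maximalIdeal R, ∃ y, t * u = γ * y := by
      intro t ht
      have := hu t ht
      rw [show t • (Ideal.Quotient.mk (Ideal.span {γ}) u) = Ideal.Quotient.mk (Ideal.span {γ}) (t * u) from rfl,
        Ideal.Quotient.eq_zero_iff_mem, Ideal.mem_span_singleton'] at this
      obtain ⟨y, hy⟩ := this
      exact ⟨y, by rw [← hy, mul_comm]⟩
    rw [Ideal.Quotient.eq_zero_iff_mem]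
    let K := FractionRing R
    have hinj : Function.Injective (algebraMap R K) := IsFractionRing.injective R K
    have hγK : algebraMap R K γ ≠ 0 := by simpa using hγ
    by_cases hcase : ∀ t ∈ maximalIdeal R, ∀ y, t * u = γ * y → y ∈ maximalIdeal R
    · set w : K := algebraMap R K u / algebraMap R K γ with hw
      have hinteg : IsIntegral R w := by
        refine isIntegral_of_smul_mem_submodule (M := K) (N := Submodule.map (Algebra.linearMap R K) (maximalIdeal R)) ?_ ?_ w ?_
        · have hm : maximalIdeal R ≠ ⊥ := by
            intro h; rw [h, Ideal.height_bot] at hdim; simp at hdim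
          intro h
          refine hm (Submodule.map_injective_of_injective (f := Algebra.linearMap R K) hinj ?_)
          rw [h, Submodule.map_bot]
        · exact (IsNoetherian.noetherian (maximalIdeal R)).map _
        · rintro n ⟨t, ht, rfl⟩
          obtain ⟨y, hy⟩ := hu' t ht
          refine ⟨y, hcase t ht y hy, ?_⟩
          simp only [Algebra.linearMap_apply, smul_eq_mul, hw]
          rw [div_mul_eq_mul_div, eq_div_iff hγK, ← map_mul, ← map_mul, mul_comm u, hy, mul_comm]
      obtain ⟨y, hy⟩ := IsIntegrallyClosed.algebraMap_eq_of_integral hinteg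
      rw [hw, eq_div_iff hγK, ← map_mul] at hy
      rw [Ideal.mem_span_singleton']
      exact ⟨y, hinj hy⟩
    · exfalso
      push Not at hcase
      obtain ⟨t, ht, y, hy, hyu⟩ := hcase
      have hunit : IsUnit y := by simpa using hyu
      have hmt : maximalIdeal R ≤ Ideal.span {t} := by
        intro s hs
        obtain ⟨y', hy'⟩ := hu' s hs
        have : γ * (s * y) = γ * (t * y') := by
          linear_combination t * hy' - s * hy
        have h2 := mul_left_cancel₀ hγ this
        obtain ⟨v, rfl⟩ := hunit
        rw [Ideal.mem_span_singleton]
        refine ⟨y' * ↑v⁻¹, ?_⟩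
        calc s = s * v * ↑v⁻¹ := by simp
          _ = _ := by rw [h2]; ring
      have hle := Ideal.height_le_card_of_mem_minimalPrimes_span_finset (p := maximalIdeal R) (s := {t}) ?_
      · have := hdim.trans hle
        simp at this
      · refine ⟨⟨inferInstance, ?_⟩, ?_⟩
        · simpa [Ideal.span_le] using ht
        · rintro Q ⟨hQ, hs⟩ hle
          exact hmt.trans (by simpa using hs)

lemma normal_depth {S : Type*} [CommRing S] [IsDomain S] [IsNoetherianRing S]
    [IsIntegrallyClosed S] (q : Ideal S) [hq : q.IsPrime] (hdim : 2 ≤ q.height) (γ : S) (hγ : γ ≠ 0) :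
    ∃ v ∈ q, LocReg q ⊥ [γ, v] := by
  have hM : q.primeCompl ≤ nonZeroDivisors S := q.primeCompl_le_nonZeroDivisors
  have : IsIntegrallyClosed (Localization.AtPrime q) :=
    isIntegrallyClosed_of_isLocalization _ q.primeCompl hM
  have hinj : Function.Injective (algebraMap S (Localization.AtPrime q)) :=
    IsLocalization.injective _ hM
  obtain ⟨z, hz, hreg⟩ := normal_depth_local (R := Localization.AtPrime q) (by
    have h1 := IsLocalization.AtPrime.ringKrullDim_eq_height q (Localization.AtPrime q)
    rw [← IsLocalRing.maximalIdeal_height_eq_ringKrullDim] at h1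
    have : (maximalIdeal (Localization.AtPrime q)).height = q.height := by exact_mod_cast h1
    rwa [this]) (algebraMap _ _ γ) (by simpa using hγ)
  obtain ⟨v, t, rfl⟩ := IsLocalization.exists_mk'_eq q.primeCompl z
  refine ⟨v, (IsLocalization.AtPrime.mk'_mem_maximal_iff (Localization.AtPrime q) q v t).mp hz,
    fun x hx => ⟨1, fun h => hq.ne_top ((Ideal.eq_top_iff_one _).mpr h), ?_⟩, fun x hx => ?_, trivial⟩
  · simpa [hγ] using hx
  · rw [bot_sup_eq] at hx ⊢
    have h1 : algebraMap S (Localization.AtPrime q) x ∈ Ideal.span {algebraMap S (Localization.AtPrime q) γ} := by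
      apply hreg
      have h2 : algebraMap S (Localization.AtPrime q) (v * x) ∈
          Ideal.span {algebraMap S (Localization.AtPrime q) γ} := by
        have := Ideal.mem_map_of_mem (algebraMap S (Localization.AtPrime q)) hx
        rwa [Ideal.map_span, Set.image_singleton] at this
      have h3 := Ideal.mul_mem_left _ (IsLocalization.mk' (Localization.AtPrime q) (1:S) t) h2
      convert h3 using 1
      rw [IsLocalization.mk'_eq_mul_mk'_one v t, map_mul]; ring
    rw [← Set.image_singleton, ← Ideal.map_span, IsLocalization.algebraMap_mem_map_algebraMap_iff q.primeCompl] at h1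
    exact h1

lemma normal_cm_prime {S : Type*} [CommRing S] [IsDomain S] [IsNoetherianRing S]
    [IsIntegrallyClosed S] (P : Ideal S) [hP : P.IsPrime] (hdim : P.height ≤ 2) :
    IsCohenMacaulayLocalRing (Localization.AtPrime P) := by
  by_cases h0 : P = ⊥
  · exact cm_crit P [] (by simp) trivial (by rw [h0, Ideal.height_bot]; simp)
  obtain ⟨γ, hγ, hγ0⟩ := Submodule.exists_mem_ne_zero_of_ne_bot h0
  by_cases h2 : 2 ≤ P.height
  · obtain ⟨v, hv, hreg⟩ := normal_depth P h2 γ hγ0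
    exact cm_crit P [γ, v] (by simp [hγ, hv]) hreg (by simpa using hdim)
  · refine cm_crit P [γ] (by simp [hγ]) ⟨fun x hx => ⟨1, fun h => hP.ne_top ((Ideal.eq_top_iff_one _).mpr h), ?_⟩, trivial⟩ ?_
    · simpa [hγ0] using hx
    · simp only [List.length_singleton, Nat.cast_one]
      push Not at h2
      exact Order.le_of_lt_succ (a := P.height) (b := (1:ℕ∞)) (by simpa [Order.succ_eq_add_one, one_add_one_eq_two] using h2)

lemma normal_cm {S : Type*} [CommRing S] [IsDomain S] [IsNoetherianRing S]
    [IsIntegrallyClosed S] (hdim : ringKrullDim S ≤ 2) : IsCohenMacaulayRing S := by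
  refine ⟨inferInstance, fun P hP => ?_⟩
  have := hP
  refine normal_cm_prime P ?_
  have h : ((P.height : ℕ∞) : WithBot ℕ∞) ≤ ((2 : ℕ∞) : WithBot ℕ∞) :=
    (Ideal.height_le_ringKrullDim_of_isPrime (I := P)).trans hdim
  exact WithBot.coe_le_coe.mp h

end MR

end Part4

section Part5
open RingTheory.Sequence IsLocalRing Polynomial

namespace MR

section LemmaD
variable {S L : Type*} [CommRing S] [IsNoetherianRing S] [Field L] [Algebra S L]

lemma noeth_of_fg (T : Subalgebra S L) (hT : T.FG) : IsNoetherianRing T := by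
  have : Algebra.FiniteType S T := T.fg_iff_finiteType.mp hT
  exact Algebra.FiniteType.isNoetherianRing S T

lemma dim_adjoin [IsDomain S] [IsFractionRing S L] (s : Finset L) :
    ringKrullDim (Algebra.adjoin S (s : Set L)) ≤ ringKrullDim S := by
  classical
  induction s using Finset.induction_on with
  | empty =>
    rw [show Algebra.adjoin S ((∅ : Finset L) : Set L) = ⊥ by simp]
    exact (ringKrullDim_eq_of_ringEquiv (Algebra.botEquivOfInjective
      (IsFractionRing.injective S L)).toRingEquiv).le
  | insert w s hw ih =>
    refine le_trans ?_ ih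
    set T := Algebra.adjoin S (s : Set L) with hT
    set T' := Algebra.adjoin S ((insert w s : Finset L) : Set L) with hT'
    have hle : T ≤ T' := Algebra.adjoin_mono (by simp)
    have hwT : w ∈ T' := Algebra.subset_adjoin (by simp)
    have : IsNoetherianRing T := noeth_of_fg T ⟨s, rfl⟩
    let g : T[X] →+* L := (aeval w : T[X] →ₐ[T] L).toRingHom
    have hg : ∀ p, g p ∈ T' := by
      intro p
      change aeval w p ∈ T'
      rw [aeval_eq_sum_range]
      refine sum_mem fun i _ => ?_
      rw [Algebra.smul_def]
      exact mul_mem (hle (p.coeff i).2) (pow_mem hwT i)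
    have hgX : g X = w := aeval_X w
    have hgC : ∀ t : T, g (C t) = t := fun t => aeval_C w t
    let f : T[X] →+* T' := g.codRestrict T' hg
    have hf : ∀ p, ((f p : T') : L) = g p := fun p => rfl
    clear_value f g
    have hsurj0 : ∀ y ∈ T', ∃ p, g p = y := by
      intro y hy
      induction hy using Algebra.adjoin_induction with
      | mem x hx =>
        rw [Finset.coe_insert, Set.mem_insert_iff] at hx
        rcases hx with rfl | hx
        · exact ⟨X, hgX⟩
        · exact ⟨C ⟨x, Algebra.subset_adjoin hx⟩, hgC _⟩
      | algebraMap r => exact ⟨C (algebraMap S T r), hgC _⟩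
      | add x y hx hy h1 h2 =>
        obtain ⟨p, hp⟩ := h1
        obtain ⟨q, hq⟩ := h2
        exact ⟨p + q, by rw [map_add, hp, hq]⟩
      | mul x y hx hy h1 h2 =>
        obtain ⟨p, hp⟩ := h1
        obtain ⟨q, hq⟩ := h2
        exact ⟨p * q, by rw [map_mul, hp, hq]⟩
    have hsurj : Function.Surjective f := by
      intro y
      obtain ⟨p, hp⟩ := hsurj0 y.1 y.2
      exact ⟨p, Subtype.ext (by rw [hf, hp])⟩
    obtain ⟨x, y, hy, hxy⟩ := IsFractionRing.div_surjective (A := S) w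
    have hy0 : y ≠ 0 := nonZeroDivisors.ne_zero hy
    have hyL : algebraMap S L y ≠ 0 := by simpa using hy0
    have hk : f (C (algebraMap S T y) * X - C (algebraMap S T x)) = 0 := by
      apply Subtype.ext
      rw [hf, map_sub, map_mul, hgX, hgC, hgC, Subalgebra.coe_algebraMap, Subalgebra.coe_algebraMap,
        ← hxy, mul_div_cancel₀ _ hyL, sub_self]
      rfl
    have hinjT : Function.Injective (algebraMap S T) := by
      intro a b h
      exact IsFractionRing.injective S L (congrArg Subtype.val h)
    have hnz : (C (algebraMap S T y) * X - C (algebraMap S T x) : T[X]) ∈ nonZeroDivisors T[X] := by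
      rw [mem_nonZeroDivisors_iff_ne_zero]
      intro h
      have := congrArg (fun p => Polynomial.coeff p 1) h
      simp only [coeff_sub, coeff_C_mul, coeff_X_one, mul_one, coeff_C, one_ne_zero, if_false,
        sub_zero, coeff_zero] at this
      exact hy0 (hinjT (by rw [this, map_zero]))
    have h1 := ringKrullDim_succ_le_of_surjective f hsurj hnz hk
    rw [Polynomial.ringKrullDim_of_isNoetherianRing] at h1
    exact ENat.WithBot.add_le_add_one_right_iff.mp h1

lemma dim_fg [IsDomain S] [IsFractionRing S L] (T : Subalgebra S L) (hT : T.FG) : ringKrullDim T ≤ ringKrullDim S := by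
  obtain ⟨s, rfl⟩ := hT
  exact dim_adjoin s

end LemmaD

section Int
variable {R : Type*} [CommRing R]

lemma int_of_poly [Nontrivial R] (𝔞 : Ideal R) (x : R) (p : R[X]) (hp : p.Monic)
    (hc : ∀ i ≤ p.natDegree, p.coeff i ∈ 𝔞 ^ (p.natDegree - i)) (he : p.eval x = 0) :
    IsIntegralOverIdeal 𝔞 x := by
  refine ⟨p.natDegree, ?_, fun i => p.coeff (p.natDegree - i), ?_, ?_⟩
  · rw [Nat.pos_iff_ne_zero]
    intro h
    rw [hp.natDegree_eq_zero] at h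
    rw [h] at he; simp at he
  · intro i h1 h2
    have := hc (p.natDegree - i) (Nat.sub_le _ _)
    rwa [Nat.sub_sub_self h2] at this
  · rw [eval_eq_sum_range, Finset.sum_range_succ, hp.coeff_natDegree, one_mul, add_comm] at he
    rw [← he]
    congr 1
    refine Finset.sum_nbij' (fun i => p.natDegree - i) (fun i => p.natDegree - i) ?_ ?_ ?_ ?_ ?_
    · intro i; simp; omega
    · intro i; simp; omega
    · intro i; simp; omega
    · intro i; simp; omega
    · intro i _; rfl

lemma poly_of_int (𝔞 : Ideal R) (x : R) (h : IsIntegralOverIdeal 𝔞 x) :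
    ∃ n : ℕ, 0 < n ∧ ∃ c : ℕ → R, (∀ i, c i ∈ 𝔞 ^ i) ∧
      x ^ n + ∑ i ∈ Finset.Icc 1 n, c i * x ^ (n - i) = 0 := by
  obtain ⟨n, hn, c, hc, he⟩ := h
  refine ⟨n, hn, fun i => if 1 ≤ i ∧ i ≤ n then c i else 0, ?_, ?_⟩
  · intro i; dsimp only; split_ifs with h
    · exact hc i h.1 h.2
    · exact Ideal.zero_mem _
  · rw [← he]; congr 1
    refine Finset.sum_congr rfl fun i hi => ?_
    rw [Finset.mem_Icc] at hi; simp [hi]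

lemma int_mul (𝔟 𝔠 : Ideal R) (x y : R) (hx : IsIntegralOverIdeal 𝔟 x) (hy : y ∈ 𝔠) :
    IsIntegralOverIdeal (𝔟 * 𝔠) (x * y) := by
  obtain ⟨n, hn, c, hc, he⟩ := hx
  refine ⟨n, hn, fun i => c i * y ^ i, fun i h1 h2 => ?_, ?_⟩
  · rw [mul_pow]; exact Ideal.mul_mem_mul (hc i h1 h2) (Ideal.pow_mem_pow hy i)
  · have := congrArg (· * y ^ n) he
    simp only [zero_mul, add_mul, Finset.sum_mul] at this
    rw [← this, mul_pow]; congr 1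
    refine Finset.sum_congr rfl fun i hi => ?_
    rw [Finset.mem_Icc] at hi
    have : y ^ n = y ^ i * y ^ (n - i) := by rw [← pow_add]; congr 1; omega
    rw [this, mul_pow]; ring

lemma int_mono (𝔟 𝔠 : Ideal R) (h : 𝔟 ≤ 𝔠) (x : R) (hx : IsIntegralOverIdeal 𝔟 x) :
    IsIntegralOverIdeal 𝔠 x := by
  obtain ⟨n, hn, c, hc, he⟩ := hx
  exact ⟨n, hn, c, fun i h1 h2 => Ideal.pow_right_mono h i (hc i h1 h2), he⟩

/-- almost integral implies integral. -/
lemma almost_int [IsDomain R] [IsNoetherianRing R] (𝔞 : Ideal R) (f x : R) (hf : f ≠ 0)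
    (h : ∀ n, f * x ^ n ∈ 𝔞 ^ n) : IsIntegralOverIdeal 𝔞 x := by
  have h1 : IsAlmostIntegral (reesAlgebra 𝔞) (monomial 1 x : R[X]) := by
    refine ⟨⟨C f, ?_⟩, ?_, ?_⟩
    · rw [mem_reesAlgebra_iff]
      intro i; rw [coeff_C]; split_ifs with hi
      · subst hi; simp
      · exact Ideal.zero_mem _
    · rw [mem_nonZeroDivisors_iff_ne_zero]
      intro h
      have := congrArg Subtype.val h
      simp at this
      exact hf this
    · intro n
      refine ⟨⟨monomial n (f * x ^ n), reesAlgebra.monomial_mem.mpr (h n)⟩, ?_⟩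
      change monomial n (f * x ^ n) = C f * (monomial 1 x) ^ n
      rw [monomial_pow, C_mul_monomial, one_mul]
  obtain ⟨q, hq, hqe⟩ := h1.isIntegral
  set n := q.natDegree with hn
  let p : R[X] := ∑ i ∈ Finset.range (n + 1), monomial i ((q.coeff i : R[X]).coeff (n - i))
  have hpc : ∀ i, p.coeff i = if i ≤ n then (q.coeff i : R[X]).coeff (n - i) else 0 := by
    intro i
    simp only [p, finsetSum_coeff, coeff_monomial]
    rw [Finset.sum_ite_eq']
    simp
  have hcn : p.coeff n = 1 := by
    rw [hpc]; simp only [le_refl, if_true, Nat.sub_self]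
    rw [hn, hq.coeff_natDegree]; simp
  have hpd : p.natDegree = n := by
    apply natDegree_eq_of_le_of_coeff_ne_zero
    · rw [natDegree_le_iff_coeff_eq_zero]
      intro N hN
      rw [hpc, if_neg (by omega)]
    · rw [hcn]; exact one_ne_zero
  have hpm : p.Monic := by rw [Monic, leadingCoeff, hpd, hcn]
  refine int_of_poly 𝔞 x p hpm ?_ ?_
  · intro i hi
    rw [hpd] at hi ⊢
    rw [hpc, if_pos hi]
    exact (q.coeff i).2 _
  · have := congrArg (fun r => Polynomial.coeff r n) hqe
    simp only [eval₂_eq_sum_range, finsetSum_coeff, coeff_zero] at this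
    rw [← this]
    simp only [p, eval_finsetSum, eval_monomial]
    refine Finset.sum_congr rfl fun i hi => ?_
    have hi' : i ≤ n := by rw [Finset.mem_range] at hi; omega
    rw [monomial_pow, one_mul]
    conv_rhs => rw [show n = (n - i) + i by omega, coeff_mul_monomial]
    rfl

/-- determinant trick. -/
lemma int_of_mul [IsDomain R] [IsNoetherianRing R] (𝔞 N : Ideal R) (hN : N ≠ ⊥) (x : R)
    (h : ∀ y ∈ N, x * y ∈ 𝔞 * N) : IsIntegralOverIdeal 𝔞 x := by
  obtain ⟨f, hf, hf0⟩ := Submodule.exists_mem_ne_zero_of_ne_bot hN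
  have key : ∀ (y : R) (𝔟 : Ideal R), y ∈ 𝔟 * N → x * y ∈ 𝔞 * 𝔟 * N := by
    intro y 𝔟 hy
    refine Submodule.mul_induction_on hy ?_ ?_
    · intro b hb z hz
      have := Ideal.mul_mem_mul hb (h z hz)
      rw [← mul_assoc, mul_comm 𝔟] at this
      convert this using 1; ring
    · intro u v hu hv
      rw [mul_add]; exact Ideal.add_mem _ hu hv
  have h2 : ∀ n, x ^ n * f ∈ 𝔞 ^ n * N := by
    intro n
    induction n with
    | zero => simpa using hf
    | succ n ih =>
      have h5 := key (x ^ n * f) (𝔞 ^ n) ih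
      rwa [← mul_assoc, ← pow_succ', ← pow_succ'] at h5
  refine almost_int 𝔞 f x hf0 (fun n => ?_)
  have h3 : 𝔞 ^ n * N ≤ 𝔞 ^ n := Ideal.mul_le_left
  have h4 := h3 (h2 n)
  rwa [mul_comm] at h4

lemma normal_iff [IsDomain R] : IsIntegrallyClosed R ↔
    ∀ u w : R, w ≠ 0 → IsIntegralOverIdeal (Ideal.span {w}) u → w ∣ u := by
  constructor
  · intro hR u w hw ⟨n, hn, c, hc, he⟩
    have : ∀ i, ∃ d, (1 ≤ i → i ≤ n → c i = w ^ i * d) := by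
      intro i
      by_cases hi : 1 ≤ i ∧ i ≤ n
      · have := hc i hi.1 hi.2
        rw [Ideal.span_singleton_pow, Ideal.mem_span_singleton] at this
        obtain ⟨d, hd⟩ := this
        exact ⟨d, fun _ _ => hd⟩
      · exact ⟨0, fun h1 h2 => absurd ⟨h1, h2⟩ hi⟩
    choose d hd using this
    let K := FractionRing R
    have hwK : algebraMap R K w ≠ 0 := by simpa using hw
    have hinteg : IsIntegral R (algebraMap R K u / algebraMap R K w) := by
      refine ⟨X ^ n + ∑ i ∈ Finset.Icc 1 n, C (d i) * X ^ (n - i), ?_, ?_⟩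
      · refine monic_X_pow_add ?_
        refine (degree_sum_le _ _).trans_lt ?_
        rw [Finset.sup_lt_iff (by exact WithBot.bot_lt_coe n)]
        intro i hi
        rw [Finset.mem_Icc] at hi
        refine (degree_C_mul_X_pow_le _ _).trans_lt ?_
        exact_mod_cast (by omega : n - i < n)
      · have h1 := congrArg (algebraMap R K) he
        rw [map_zero, map_add, map_sum] at h1
        simp only [eval₂_add, eval₂_finsetSum, eval₂_mul, eval₂_C, eval₂_pow, eval₂_X]
        have h2 : (algebraMap R K w) ^ n ≠ 0 := pow_ne_zero _ hwK
        apply mul_left_cancel₀ h2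
        rw [mul_zero, ← h1, mul_add, Finset.mul_sum]
        congr 1
        · rw [← mul_pow, mul_div_cancel₀ _ hwK, map_pow]
        · refine Finset.sum_congr rfl fun i hi => ?_
          rw [Finset.mem_Icc] at hi
          rw [hd i hi.1 hi.2, map_mul, map_mul, map_pow, map_pow]
          have : algebraMap R K w ^ n = algebraMap R K w ^ i * algebraMap R K w ^ (n - i) := by
            rw [← pow_add]; congr 1; omega
          rw [this, div_pow]
          have h3 : algebraMap R K w ^ (n - i) ≠ 0 := pow_ne_zero _ hwK
          rw [mul_assoc, mul_left_comm (algebraMap R K w ^ (n - i)), mul_div_cancel₀ _ h3]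
          ring
    obtain ⟨y, hy⟩ := IsIntegrallyClosed.algebraMap_eq_of_integral hinteg
    rw [eq_div_iff hwK, ← map_mul] at hy
    exact ⟨y, by rw [← IsFractionRing.injective R K hy, mul_comm]⟩
  · intro h
    rw [isIntegrallyClosed_iff (FractionRing R)]
    intro x hx
    obtain ⟨u, w, hw, rfl⟩ := IsFractionRing.div_surjective (A := R) x
    have hw0 : w ≠ 0 := nonZeroDivisors.ne_zero hw
    have hwK : algebraMap R (FractionRing R) w ≠ 0 := by simpa using hw0
    obtain ⟨p, hp, hpe⟩ := hx
    have hi : IsIntegralOverIdeal (Ideal.span {w}) u := by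
      refine int_of_poly _ u (p.scaleRoots w) ?_ ?_ ?_
      · exact (monic_scaleRoots_iff w).mpr hp
      · intro i hi
        rw [natDegree_scaleRoots, coeff_scaleRoots, Ideal.span_singleton_pow, Ideal.mem_span_singleton]
        exact Dvd.intro_left _ rfl
      · have := scaleRoots_eval₂_mul (p := p) (algebraMap R (FractionRing R))
          (algebraMap R (FractionRing R) u / algebraMap R (FractionRing R) w) w
        rw [hpe, mul_zero, mul_div_cancel₀ _ hwK, eval₂_at_apply] at this
        exact (map_eq_zero_iff _ (IsFractionRing.injective R (FractionRing R))).mp this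
    obtain ⟨y, rfl⟩ := h u w hw0 hi
    exact ⟨y, by rw [map_mul, mul_div_cancel_left₀ _ hwK]⟩

end Int

end MR

end Part5

section Part6
open RingTheory.Sequence IsLocalRing Polynomial

namespace MR

theorem chart_normal {R B : Type*} [CommRing R] [CommRing B] [IsDomain R] [IsDomain B]
    (hR : IsIntegrallyClosed R)
    (j : R →+* B[X]) (hj : Function.Injective j) (f : R) (hjf : j f = X)
    (hf : ∀ y, ∃ (n : ℕ) (r : R), j f ^ n * y = j r) : IsIntegrallyClosed B := by
  rw [normal_iff] at hR ⊢
  intro u w hw ⟨n, hn, c, hc, he⟩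
  have : ∀ i, ∃ d, (1 ≤ i → i ≤ n → c i = w ^ i * d) := by
    intro i
    by_cases hi : 1 ≤ i ∧ i ≤ n
    · have := hc i hi.1 hi.2
      rw [Ideal.span_singleton_pow, Ideal.mem_span_singleton] at this
      obtain ⟨d, hd⟩ := this
      exact ⟨d, fun _ _ => hd⟩
    · exact ⟨0, fun h1 h2 => absurd ⟨h1, h2⟩ hi⟩
  choose d hd using this
  choose e r hr using fun i => hf (C (d i))
  simp only [hjf] at hr hf
  obtain ⟨Nu, u', hu'⟩ := hf (C u)
  obtain ⟨Nw, w', hw'⟩ := hf (C w)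
  let M := ∑ i ∈ Finset.Icc 1 n, e i
  have hM : ∀ i, 1 ≤ i → i ≤ n → e i ≤ M * i := by
    intro i h1 h2
    have : e i ≤ M := Finset.single_le_sum (f := e) (fun _ _ => Nat.zero_le _)
      (Finset.mem_Icc.mpr ⟨h1, h2⟩)
    exact this.trans (Nat.le_mul_of_pos_right _ h1)
  have jU : j (f ^ (M + Nw) * u') = X ^ (M + (Nu + Nw)) * C u := by
    rw [map_mul, map_pow, hjf, ← hu']; ring
  have jW : j (f ^ Nu * w') = X ^ (Nu + Nw) * C w := by
    rw [map_mul, map_pow, hjf, ← hw']; ring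
  set U := f ^ (M + Nw) * u'
  set W := f ^ Nu * w'
  have hW0 : W ≠ 0 := by
    intro h
    rw [h, map_zero] at jW
    have := mul_ne_zero (pow_ne_zero (Nu + Nw) (X_ne_zero (R := B))) (C_ne_zero.mpr hw)
    exact this jW.symm
  have hdvd : IsIntegralOverIdeal (Ideal.span {W}) U → W ∣ U := hR U W hW0
  suffices hinteg : IsIntegralOverIdeal (Ideal.span {W}) U by
    obtain ⟨ρ, hρ⟩ := hdvd hinteg
    have h1 := congrArg j hρ
    rw [jU, map_mul, jW, pow_add, mul_comm (X ^ M), mul_assoc, mul_assoc] at h1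
    have h2 := mul_left_cancel₀ (pow_ne_zero (Nu + Nw) (X_ne_zero (R := B))) h1
    have h3 := congrArg (fun p => Polynomial.coeff p M) h2
    simp only [coeff_C_mul, coeff_mul_C, coeff_X_pow, if_true, one_mul] at h3
    exact ⟨_, h3⟩
  refine ⟨n, hn, fun i => W ^ i * (f ^ (M * i - e i) * r i), ?_, ?_⟩
  · intro i _ _
    rw [Ideal.span_singleton_pow, Ideal.mem_span_singleton]; exact Dvd.intro _ rfl
  · apply hj
    have h1 := congrArg (fun y => X ^ ((M + (Nu + Nw)) * n) * C y) he
    simp only [C_0, mul_zero] at h1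
    rw [map_zero, ← h1, map_add, map_sum, C_add, map_sum, mul_add, Finset.mul_sum]
    congr 1
    · rw [map_pow, jU, C_pow, mul_pow, pow_mul]
    · refine Finset.sum_congr rfl fun i hi => ?_
      rw [Finset.mem_Icc] at hi
      rw [map_mul, map_mul, map_mul, map_pow, map_pow, map_pow, jU, jW, hjf,
        hd i hi.1 hi.2]
      have h4 : (X : B[X]) ^ (M * i - e i) * j (r i) = X ^ (M * i) * C (d i) := by
        rw [← hr, ← mul_assoc, ← pow_add, Nat.sub_add_cancel (hM i hi.1 hi.2)]
      rw [h4]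
      obtain ⟨k, rfl⟩ : ∃ k, n = i + k := ⟨n - i, by omega⟩
      simp only [Nat.add_sub_cancel_left, C_mul, C_pow]
      ring

lemma exists_lift {R B Ω : Type*} [CommRing R] [CommRing B] [CommRing Ω] (φ : R →+* Ω) (i : B →+* Ω)
    (hi : Function.Injective i) (h : ∀ r, ∃ b, i b = φ r) : ∃ j : R →+* B, ∀ r, i (j r) = φ r := by
  choose j hj using h
  have h1 : j 1 = 1 := hi (by rw [hj, map_one, map_one])
  have h2 : ∀ x y, j (x * y) = j x * j y := fun x y => hi (by simp only [map_mul, hj])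
  have h3 : j 0 = 0 := hi (by rw [hj, map_zero, map_zero])
  have h4 : ∀ x y, j (x + y) = j x + j y := fun x y => hi (by simp only [map_add, hj])
  exact ⟨RingHom.mk ⟨⟨j, h1⟩, h2⟩ h3 h4, hj⟩

/-- generic chart -/
theorem chart_generic {R D Ω B : Type*} [CommRing R] [CommRing D] [CommRing Ω] [CommRing B]
    (ι : D →+* Ω) (hι : Function.Injective ι) (κ : B →+* Ω) (hκ : Function.Injective κ)
    (ρ : R →+* D[X]) (hρ : Function.Injective ρ) (F : ℕ → Set D)
    (hR : ∀ p, (∃ r, ρ r = p) ↔ ∀ n, p.coeff n ∈ F n)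
    (hz : ∀ n, 0 ∈ F n)
    (β : D) (β' : Ω) (hβ : ι β * β' = 1) (f : R) (hfβ : ρ f = C β * X)
    (h1 : ∀ n, ∀ x ∈ F n, ∃ y, κ y = ι x * β' ^ n)
    (h2 : ∀ y, ∃ n, ∃ x ∈ F n, κ y = ι x * β' ^ n) :
    ∃ j : R →+* B[X], Function.Injective j ∧ j f = X ∧
      (∀ y, ∃ (n : ℕ) (r : R), j f ^ n * y = j r) ∧
      (∀ r n, κ ((j r).coeff n) = ι ((ρ r).coeff n) * β' ^ n) := by
  let φ : R →+* Polynomial Ω := (Polynomial.compRingHom (C β' * X)).comp ((mapRingHom ι).comp ρ)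
  have hφ : ∀ r n, (φ r).coeff n = ι ((ρ r).coeff n) * β' ^ n := by
    intro r n
    change (((ρ r).map ι).comp (C β' * X)).coeff n = _
    rw [comp_C_mul_X_coeff, coeff_map]
  have hκ' : Function.Injective (mapRingHom κ) := map_injective κ hκ
  obtain ⟨j, hj⟩ := exists_lift φ (mapRingHom κ) hκ' (by
    intro r
    have : φ r ∈ lifts κ := by
      rw [lifts_iff_coeff_lifts]
      intro n
      obtain ⟨y, hy⟩ := h1 n _ ((hR (ρ r)).mp ⟨r, rfl⟩ n)
      rw [hφ]
      exact ⟨y, hy⟩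
    exact (mem_lifts _).mp this)
  have hjc : ∀ r n, κ ((j r).coeff n) = ι ((ρ r).coeff n) * β' ^ n := by
    intro r n
    rw [← hφ, ← hj, coe_mapRingHom, coeff_map]
  have hu : ∀ n (x y : D), ι x * β' ^ n = ι y * β' ^ n → x = y := by
    intro n x y h
    apply hι
    have := congrArg (· * ι β ^ n) h
    simp only [mul_assoc, ← mul_pow, mul_comm β', hβ, one_pow, mul_one] at this
    exact this
  have hjX : j f = X := by
    ext n
    apply hκ
    rw [hjc, hfβ, coeff_C_mul, coeff_X, coeff_X]
    split_ifs with hn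
    · rw [← hn]; simp [hβ]
    · simp
  refine ⟨j, ?_, hjX, ?_, hjc⟩
  · intro r s h
    apply hρ
    ext n
    apply hu n
    rw [← hjc, ← hjc, h]
  · rw [hjX]
    intro y
    induction y using Polynomial.induction_on' with
    | add p q hp hq =>
      obtain ⟨n, r, hr⟩ := hp
      obtain ⟨m, s, hs⟩ := hq
      refine ⟨n + m, f ^ m * r + f ^ n * s, ?_⟩
      rw [map_add, map_mul, map_mul, map_pow, map_pow, hjX, ← hr, ← hs]; ring
    | monomial i b =>
      obtain ⟨n, x, hx, hb⟩ := h2 b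
      obtain ⟨r, hr⟩ := (hR (monomial n x)).mpr (by
        intro m; rw [coeff_monomial]; split_ifs with h
        · rw [← h]; exact hx
        · exact hz m)
      refine ⟨n, f ^ i * r, ?_⟩
      have : j r = monomial n b := by
        ext m
        apply hκ
        rw [hjc, hr, coeff_monomial, coeff_monomial]
        split_ifs with h
        · rw [hb, ← h]
        · simp
      rw [map_mul, map_pow, hjX, this, X_pow_mul_monomial, X_pow_mul_monomial, add_comm]

/-- graded pieces of a normal graded ring are integrally closed -/
theorem piece_closed {R A Ω : Type*} [CommRing R] [IsDomain R] [CommRing A] [IsDomain A] [CommRing Ω] [IsDomain Ω]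
    (hR : IsIntegrallyClosed R)
    (ρ : R →+* Ω) (hρ : Function.Injective ρ) (α : A →+* Ω) (hα : Function.Injective α) (T : Ω)
    (𝔟 : Ideal A) (h𝔟 : 𝔟 ≠ ⊥) (h : ∀ i, ∀ c ∈ 𝔟 ^ i, ∃ r, ρ r = α c * T ^ i) (x : A)
    (hx : IsIntegralOverIdeal 𝔟 x) : ∃ r, ρ r = α x * T := by
  obtain ⟨y, hy, hy0⟩ := Submodule.exists_mem_ne_zero_of_ne_bot h𝔟
  obtain ⟨n, hn, c, hc, he⟩ := poly_of_int _ _ hx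
  choose c' hc' using fun i => h i (c i) (hc i)
  obtain ⟨y', hy'⟩ := h 0 y (by simp)
  obtain ⟨u, hu⟩ := h 1 (x * y) (by simpa using 𝔟.mul_mem_left _ hy)
  simp only [pow_zero, pow_one, mul_one] at hy' hu
  have hy'0 : y' ≠ 0 := by
    intro h0; rw [h0, map_zero] at hy'; exact hy0 ((map_eq_zero_iff _ hα).mp hy'.symm)
  suffices hinteg : IsIntegralOverIdeal (Ideal.span {y'}) u by
    obtain ⟨r, hr⟩ := normal_iff.mp hR u y' hy'0 hinteg
    refine ⟨r, ?_⟩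
    have h1 := congrArg ρ hr
    rw [map_mul, hu, hy', map_mul, mul_comm (α x), mul_assoc] at h1
    exact (mul_left_cancel₀ (by simpa [map_eq_zero_iff _ hα] using hy0) h1).symm
  refine ⟨n, hn, fun i => y' ^ i * c' i, ?_, ?_⟩
  · intro i _ _
    rw [Ideal.span_singleton_pow, Ideal.mem_span_singleton]; exact Dvd.intro _ rfl
  · apply hρ
    have h1 := congrArg (fun z => (α y * T) ^ n * α z) he
    simp only [map_zero, mul_zero] at h1
    rw [map_zero, ← h1, map_add, map_sum, map_add, map_sum, mul_add, Finset.mul_sum]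
    congr 1
    · rw [map_pow, hu, map_mul, map_pow]; ring
    · refine Finset.sum_congr rfl fun i hi => ?_
      rw [Finset.mem_Icc] at hi
      obtain ⟨k, rfl⟩ : ∃ k, n = i + k := ⟨n - i, by omega⟩
      simp only [map_mul, map_pow, hu, hy', hc', Nat.add_sub_cancel_left]
      ring

/-- leading-term induction. -/
theorem ac_generic {D : Type*} [CommRing D] [IsDomain D] (G : ℕ → ℕ → AddSubgroup D)
    (hmul : ∀ i k i' k' x y, x ∈ G i k → y ∈ G i' k' → x * y ∈ G (i + i') (k + k'))
    (hanti : ∀ i i' k, i ≤ i' → G i' k ≤ G i k) (hone : 1 ∈ G 0 0)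
    (hac : ∀ i x f, f ≠ 0 → (∀ k, f * x ^ k ∈ G (i * k) k) → x ∈ G i 1) (N : ℕ) :
    ∀ (p f : D[X]), p.natDegree < N → f ≠ 0 → (∀ k i, (f * p ^ k).coeff i ∈ G i k) →
      ∀ i, p.coeff i ∈ G i 1 := by
  induction N with
  | zero => intro p f h; omega
  | succ N ih =>
    intro p f hN hf h
    have hpm : ∀ (q r : D[X]) (k l : ℕ), (∀ i, q.coeff i ∈ G i k) → (∀ i, r.coeff i ∈ G i l) →
        ∀ i, (q * r).coeff i ∈ G i (k + l) := by
      intro q r k l hq hr i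
      rw [coeff_mul]
      refine sum_mem fun x hx => ?_
      rw [Finset.HasAntidiagonal.mem_antidiagonal] at hx
      rw [← hx]
      exact hmul _ _ _ _ _ _ (hq _) (hr _)
    have hlc : p.leadingCoeff ∈ G p.natDegree 1 := by
      refine hac _ _ f.leadingCoeff (leadingCoeff_ne_zero.mpr hf) (fun k => ?_)
      have := h k (f * p ^ k).natDegree
      rw [coeff_natDegree, leadingCoeff_mul, leadingCoeff_pow] at this
      by_cases hp : p = 0
      · rw [hp, leadingCoeff_zero] at this ⊢
        rcases Nat.eq_zero_or_pos k with rfl | hk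
        · exact hanti _ _ _ (by simp) this
        · rw [zero_pow hk.ne', mul_zero]; exact zero_mem _
      · refine hanti _ _ _ ?_ this
        rw [natDegree_mul hf (pow_ne_zero _ hp), natDegree_pow, mul_comm]; omega
    have hmono : ∀ i, (monomial p.natDegree p.leadingCoeff).coeff i ∈ G i 1 := by
      intro i; rw [coeff_monomial]; split_ifs with hi
      · rw [← hi]; exact hlc
      · exact zero_mem _
    by_cases hd : p.natDegree = 0
    · intro i
      by_cases hi : i = p.natDegree
      · rw [hi]; exact hlc
      · rw [coeff_eq_zero_of_natDegree_lt (by omega)]; exact zero_mem _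
    · have hdeg : p.eraseLead.natDegree < N := by
        have := eraseLead_natDegree_lt_or_eraseLead_eq_zero p
        rcases this with h | h
        · omega
        · rw [h, natDegree_zero]; omega
      have key : ∀ k i, (f * p.eraseLead ^ k).coeff i ∈ G i k := by
        intro k
        have he : p.eraseLead = p + (- monomial p.natDegree p.leadingCoeff) := by
          have := p.eraseLead_add_monomial_natDegree_leadingCoeff
          linear_combination this
        rw [he, add_pow, Finset.mul_sum]
        intro i
        rw [finsetSum_coeff]
        refine sum_mem fun l hl => ?_
        have hl' : l ≤ k := by rw [Finset.mem_range] at hl; omega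
        have hq : ∀ m i, ((- monomial p.natDegree p.leadingCoeff : D[X]) ^ m).coeff i ∈ G i m := by
          intro m
          induction m with
          | zero =>
            intro i; rw [pow_zero, coeff_one]; split_ifs with hi
            · rw [hi]; exact hone
            · exact zero_mem _
          | succ m ihm =>
            rw [pow_succ]
            exact hpm _ _ _ _ ihm (fun i => by rw [coeff_neg]; exact neg_mem (hmono i))
        have := hpm _ _ _ _ (h l) (hq (k - l)) i
        rw [Nat.add_sub_cancel' hl'] at this
        have h3 := nsmul_mem this (k.choose l)
        convert h3 using 1
        rw [← coeff_smul, nsmul_eq_mul]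
        congr 1; ring
      have := ih p.eraseLead f hdeg hf key
      intro i
      have h1 := add_mem (this i) (hmono i)
      rwa [← coeff_add, eraseLead_add_monomial_natDegree_leadingCoeff] at h1

/-- normality from closedness under almost integral elements. -/
theorem normal_of_ac {R Ω : Type*} [CommRing R] [IsDomain R] [CommRing Ω] [IsDomain Ω] [hΩ : IsIntegrallyClosed Ω]
    (ρ : R →+* Ω) (hρ : Function.Injective ρ)
    (h : ∀ p f, f ≠ 0 → (∀ k : ℕ, ∃ r, ρ r = f * p ^ k) → ∃ r, ρ r = p) : IsIntegrallyClosed R := by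
  rw [normal_iff] at hΩ ⊢
  intro u w hw ⟨n, hn, c, hc, he⟩
  have hw' : ρ w ≠ 0 := by rwa [Ne, map_eq_zero_iff _ hρ]
  have : ∀ i, ∃ d, (1 ≤ i → i ≤ n → c i = w ^ i * d) := by
    intro i
    by_cases hi : 1 ≤ i ∧ i ≤ n
    · have := hc i hi.1 hi.2
      rw [Ideal.span_singleton_pow, Ideal.mem_span_singleton] at this
      obtain ⟨d, hd⟩ := this
      exact ⟨d, fun _ _ => hd⟩
    · exact ⟨0, fun h1 h2 => absurd ⟨h1, h2⟩ hi⟩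
  choose d hd using this
  obtain ⟨p, hp⟩ := hΩ (ρ u) (ρ w) hw' ⟨n, hn, fun i => ρ (c i), fun i h1 h2 => by
    dsimp only
    rw [hd i h1 h2, map_mul, map_pow, Ideal.span_singleton_pow, Ideal.mem_span_singleton]
    exact Dvd.intro _ rfl, by
    have := congrArg ρ he
    simpa using this⟩
  have hpe : p ^ n + ∑ i ∈ Finset.Icc 1 n, ρ (d i) * p ^ (n - i) = 0 := by
    have h1 := congrArg ρ he
    apply mul_left_cancel₀ (pow_ne_zero n hw')
    rw [mul_zero, ← map_zero ρ, ← h1, map_add, map_sum, mul_add, Finset.mul_sum]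
    congr 1
    · rw [map_pow, hp, mul_pow]
    · refine Finset.sum_congr rfl fun i hi => ?_
      rw [Finset.mem_Icc] at hi
      obtain ⟨k, rfl⟩ : ∃ k, n = i + k := ⟨n - i, by omega⟩
      rw [hd i hi.1 hi.2]
      simp only [map_mul, map_pow, hp, Nat.add_sub_cancel_left]
      ring
  have hall : ∀ k : ℕ, ∃ r, ρ r = ρ w ^ n * p ^ k := by
    intro k
    induction k using Nat.strong_induction_on with
    | _ k ih =>
      by_cases hk : k < n
      · refine ⟨w ^ (n - k) * u ^ k, ?_⟩
        obtain ⟨l, rfl⟩ : ∃ l, n = k + l := ⟨n - k, by omega⟩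
        simp only [map_mul, map_pow, hp, Nat.add_sub_cancel_left]; ring
      · obtain ⟨l, rfl⟩ : ∃ l, k = n + l := ⟨k - n, by omega⟩
        have h1 : ∀ i, ∃ r, (1 ≤ i → i ≤ n → ρ r = ρ w ^ n * p ^ (n - i + l)) := by
          intro i
          by_cases hi : 1 ≤ i ∧ i ≤ n
          · obtain ⟨r, hr⟩ := ih (n - i + l) (by omega)
            exact ⟨r, fun _ _ => hr⟩
          · exact ⟨0, fun h1 h2 => absurd ⟨h1, h2⟩ hi⟩
        choose r hr using h1
        refine ⟨- ∑ i ∈ Finset.Icc 1 n, d i * r i, ?_⟩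
        rw [map_neg, map_sum, pow_add, eq_neg_of_add_eq_zero_left hpe, neg_mul, mul_neg, Finset.sum_mul,
          Finset.mul_sum]
        congr 1
        refine Finset.sum_congr rfl fun i hi => ?_
        rw [Finset.mem_Icc] at hi
        rw [map_mul, hr i hi.1 hi.2, pow_add]; ring
  obtain ⟨r, hr⟩ := h p (ρ w ^ n) (pow_ne_zero _ hw') hall
  refine ⟨r, hρ ?_⟩
  rw [hp, map_mul, hr]

end MR

end Part6

section Part7
open RingTheory.Sequence IsLocalRing Polynomial

namespace MR

section Ch
variable {S L : Type*} [CommRing S] [Field L] [Algebra S L]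

/-- the chart `S[I/a]`. -/
noncomputable def ch (L : Type*) [Field L] [Algebra S L] (I : Ideal S) (a : S) : Subalgebra S L :=
  Algebra.adjoin S ((fun x => algebraMap S L x * (algebraMap S L a)⁻¹) '' (I : Set S))

lemma ch_mem (I : Ideal S) (a : S) (n : ℕ) : ∀ z ∈ I ^ n,
    algebraMap S L z * (algebraMap S L a)⁻¹ ^ n ∈ ch L I a := by
  induction n with
  | zero => intro z _; simp
  | succ n ih =>
    intro z hz
    rw [pow_succ] at hz
    refine Submodule.mul_induction_on hz ?_ ?_
    · intro x hx y hy
      have h1 := mul_mem (ih x hx) (Algebra.subset_adjoin (R := S) ⟨y, hy, rfl⟩ :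
        algebraMap S L y * (algebraMap S L a)⁻¹ ∈ ch L I a)
      convert h1 using 1
      rw [map_mul]; ring
    · intro x y hx hy
      rw [map_add, add_mul]; exact add_mem hx hy

lemma ch_exists [FaithfulSMul S L] (I : Ideal S) (a : S) (ha : a ∈ I) (ha0 : a ≠ 0) (y : L) (hy : y ∈ ch L I a) :
    ∃ n, ∃ z ∈ I ^ n, y = algebraMap S L z * (algebraMap S L a)⁻¹ ^ n := by
  have haL : algebraMap S L a ≠ 0 := by simpa using ha0
  induction hy using Algebra.adjoin_induction with
  | mem x hx =>
    obtain ⟨z, hz, rfl⟩ := hx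
    exact ⟨1, z, by simpa using hz, by simp⟩
  | algebraMap r => exact ⟨0, r, by simp, by simp⟩
  | add x y hx hy h1 h2 =>
    obtain ⟨n, z, hz, rfl⟩ := h1
    obtain ⟨m, w, hw, rfl⟩ := h2
    refine ⟨n + m, z * a ^ m + a ^ n * w, ?_, ?_⟩
    · rw [pow_add]
      exact add_mem (Ideal.mul_mem_mul hz (Ideal.pow_mem_pow ha m)) (Ideal.mul_mem_mul (Ideal.pow_mem_pow ha n) hw)
    · simp only [map_add, map_mul, map_pow]
      have e : ∀ k : ℕ, algebraMap S L a ^ k * (algebraMap S L a)⁻¹ ^ k = 1 := fun k => by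
        rw [← mul_pow, mul_inv_cancel₀ haL, one_pow]
      rw [pow_add]
      linear_combination (-(algebraMap S L z * (algebraMap S L a)⁻¹ ^ n)) * e m - (algebraMap S L w * (algebraMap S L a)⁻¹ ^ m) * e n
  | mul x y hx hy h1 h2 =>
    obtain ⟨n, z, hz, rfl⟩ := h1
    obtain ⟨m, w, hw, rfl⟩ := h2
    refine ⟨n + m, z * w, ?_, ?_⟩
    · rw [pow_add]; exact Ideal.mul_mem_mul hz hw
    · rw [map_mul]; ring

lemma ch_fg [IsNoetherianRing S] (I : Ideal S) (a : S) : (ch L I a).FG := by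
  classical
  obtain ⟨s, hs⟩ := IsNoetherian.noetherian I
  refine ⟨s.image (fun x => algebraMap S L x * (algebraMap S L a)⁻¹), le_antisymm ?_ ?_⟩
  · refine Algebra.adjoin_mono ?_
    intro y hy
    simp only [Finset.coe_image, Set.mem_image] at hy
    obtain ⟨x, hx, rfl⟩ := hy
    exact ⟨x, hs ▸ Ideal.subset_span hx, rfl⟩
  · refine Algebra.adjoin_le ?_
    rintro _ ⟨x, hx, rfl⟩
    rw [← hs] at hx
    refine Submodule.span_induction ?_ ?_ ?_ ?_ hx
    · intro x hx
      exact Algebra.subset_adjoin (Finset.mem_coe.mpr (Finset.mem_image_of_mem _ hx))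
    · simp only [map_zero, zero_mul]; exact zero_mem _
    · intro x y _ _ hx hy
      simp only [map_add, add_mul]; exact add_mem hx hy
    · intro r x _ hx
      simp only [smul_eq_mul, map_mul, mul_assoc]
      exact mul_mem (Subalgebra.algebraMap_mem _ r) hx

end Ch

section Rees
variable {S : Type*} [CommRing S] {I : Ideal S}

/-- monomial in the Rees algebra -/
noncomputable def rm (I : Ideal S) (n : ℕ) (x : S) (hx : x ∈ I ^ n) : reesAlgebra I :=
  ⟨monomial n x, reesAlgebra.monomial_mem.mpr hx⟩

/-- coefficient -/
noncomputable def rc (x : reesAlgebra I) (n : ℕ) : S := (x : S[X]).coeff n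

lemma rc_mem (x : reesAlgebra I) (n : ℕ) : rc x n ∈ I ^ n := x.2 n

lemma rc_ext {x y : reesAlgebra I} (h : ∀ n, rc x n = rc y n) : x = y :=
  Subtype.ext (Polynomial.ext h)

lemma rc_add (x y : reesAlgebra I) (n) : rc (x + y) n = rc x n + rc y n := coeff_add _ _ _
lemma rc_sub (x y : reesAlgebra I) (n) : rc (x - y) n = rc x n - rc y n := coeff_sub _ _ _
lemma rc_zero (n) : rc (0 : reesAlgebra I) n = 0 := coeff_zero _
lemma rc_rm (m n : ℕ) (x : S) (hx) : rc (rm I m x hx) n = if m = n then x else 0 := coeff_monomial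
lemma rc_rm_mul (m n : ℕ) (x : S) (hx) (y) : rc (rm I m x hx * y) (n + m) = x * rc y n :=
  coeff_monomial_mul _ _ _ _
lemma rc_rm_mul_lt (m n : ℕ) (x : S) (hx) (y) (h : n < m) : rc (rm I m x hx * y) n = 0 := by
  change ((monomial m x : S[X]) * y).coeff n = 0
  rw [← C_mul_X_pow_eq_monomial, mul_assoc, coeff_C_mul, X_pow_mul, coeff_mul_X_pow', if_neg (by omega), mul_zero]
lemma rc_mul_zero (x y : reesAlgebra I) : rc (x * y) 0 = rc x 0 * rc y 0 := mul_coeff_zero _ _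
lemma rc_rm0_mul (n : ℕ) (x : S) (hx) (y) : rc (rm I 0 x hx * y) n = x * rc y n :=
  rc_rm_mul 0 n x hx y
lemma rc_rm1_mul (n : ℕ) (x : S) (hx) (y) : rc (rm I 1 x hx * y) (n + 1) = x * rc y n :=
  rc_rm_mul 1 n x hx y
lemma rc_rm1_mul0 (x : S) (hx) (y) : rc (rm I 1 x hx * y) 0 = 0 :=
  rc_rm_mul_lt 1 0 x hx y (by omega)

lemma rm_mul (m n k : ℕ) (x y z : S) (hx hy hz) (hk : m + n = k) (h : x * y = z) :
    rm I m x hx * rm I n y hy = rm I k z hz := by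
  subst hk h
  exact Subtype.ext (monomial_mul_monomial _ _ _ _)

lemma rm_add (n : ℕ) (x y z : S) (hx hy hz) (h : x + y = z) :
    rm I n x hx + rm I n y hy = rm I n z hz := by
  subst h
  exact Subtype.ext ((monomial n).map_add _ _).symm

lemma rees_mem (N : Ideal (reesAlgebra I)) (x : reesAlgebra I)
    (h : ∀ n, rm I n (rc x n) (rc_mem x n) ∈ N) : x ∈ N := by
  have : x = ∑ n ∈ Finset.range ((x : S[X]).natDegree + 1), rm I n (rc x n) (rc_mem x n) := by
    apply Subtype.ext
    rw [AddSubmonoidClass.coe_finsetSum]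
    exact (x : S[X]).as_sum_range
  rw [this]
  exact sum_mem fun n _ => h n

lemma rm_mem_of_one (N : Ideal (reesAlgebra I)) (h : ∀ x (hx : x ∈ I ^ 1), rm I 1 x hx ∈ N) (n : ℕ) :
    ∀ x (hx : x ∈ I ^ (n + 1)), rm I (n + 1) x hx ∈ N := by
  intro x hx
  have : ∀ (hx' : x ∈ I ^ n * I), ∃ h', rm I (n + 1) x h' ∈ N := by
    intro hx'
    refine Submodule.mul_induction_on hx' ?_ ?_
    · intro u hu w hw
      refine ⟨by rw [pow_succ]; exact Ideal.mul_mem_mul hu hw, ?_⟩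
      rw [← rm_mul n 1 (n + 1) u w (u * w) hu (by simpa using hw) _ rfl rfl]
      exact N.mul_mem_left _ (h w _)
    · rintro u w ⟨h1, h2⟩ ⟨h3, h4⟩
      refine ⟨add_mem h1 h3, ?_⟩
      rw [← rm_add (n + 1) u w (u + w) h1 h3 _ rfl]
      exact N.add_mem h2 h4
  exact (this (by rwa [pow_succ] at hx)).2

/-- the Rees chart -/
theorem rees_chart {L : Type*} [Field L] [Algebra S L] [FaithfulSMul S L] [IsDomain S]
    (a : S) (ha : a ∈ I) (ha0 : a ≠ 0) :
    ∃ j : reesAlgebra I →+* (ch L I a)[X], Function.Injective j ∧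
      j (rm I 1 a (by simpa using ha)) = X ∧
      (∀ y, ∃ (n : ℕ) (r : reesAlgebra I), j (rm I 1 a (by simpa using ha)) ^ n * y = j r) := by
  have haL : algebraMap S L a ≠ 0 := by simpa using ha0
  obtain ⟨j, h1, h2, h3, -⟩ := chart_generic (R := reesAlgebra I) (algebraMap S L)
    (FaithfulSMul.algebraMap_injective S L) (algebraMap (ch L I a) L)
    Subtype.val_injective (reesAlgebra I).val.toRingHom Subtype.val_injective (fun n => (I ^ n : Ideal S))
    (fun p => ⟨by rintro ⟨r, rfl⟩; exact r.2, fun h => ⟨⟨p, h⟩, rfl⟩⟩) (fun n => zero_mem _)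
    a (algebraMap S L a)⁻¹ (mul_inv_cancel₀ haL) (rm I 1 a (by simpa using ha))
    (by rw [C_mul_X_eq_monomial]; rfl)
    (fun n x hx => ⟨⟨_, ch_mem I a n x hx⟩, rfl⟩)
    (fun y => ch_exists I a ha ha0 y.1 y.2)
  exact ⟨j, h1, h2, h3⟩

lemma normal_retract {R : Type*} [CommRing R] [IsDomain R] [IsDomain S] (hR : IsIntegrallyClosed R)
    (i : S →+* R) (π : R →+* S) (h : ∀ s, π (i s) = s) : IsIntegrallyClosed S := by
  rw [normal_iff] at hR ⊢
  intro u w hw ⟨n, hn, c, hc, he⟩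
  have hinj : Function.Injective i := fun x y hxy => by rw [← h x, hxy, h]
  obtain ⟨r, hr⟩ := hR (i u) (i w) (by rwa [Ne, map_eq_zero_iff _ hinj]) ⟨n, hn, fun m => i (c m), fun m h1 h2 => by
    have := Ideal.mem_map_of_mem i (hc m h1 h2)
    rwa [Ideal.map_pow, Ideal.map_span, Set.image_singleton] at this, by
    have := congrArg i he
    simpa using this⟩
  exact ⟨π r, by rw [← h u, hr, map_mul, h]⟩

/-- degree zero projection -/
noncomputable def rpi (I : Ideal S) : reesAlgebra I →+* S :=
  (Polynomial.constantCoeff).comp (reesAlgebra I).val.toRingHom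

lemma rpi_apply (x : reesAlgebra I) : rpi I x = rc x 0 := rfl

/-- inclusion of degree zero -/
noncomputable def rin (I : Ideal S) : S →+* reesAlgebra I := algebraMap S (reesAlgebra I)

lemma rin_eq (x : S) : rin I x = rm I 0 x (by simp) := by
  apply Subtype.ext
  change algebraMap S S[X] x = monomial 0 x
  rw [Polynomial.algebraMap_apply]; simp

lemma rees_base_normal [IsDomain S] (hR : IsIntegrallyClosed (reesAlgebra I)) :
    IsIntegrallyClosed S :=
  normal_retract hR (rin I) (rpi I) (fun s => by rw [rpi_apply, rin_eq, rc_rm]; simp)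

lemma rees_pow_closed [IsDomain S] (hI : I ≠ ⊥) (hR : IsIntegrallyClosed (reesAlgebra I)) (n : ℕ) :
    IdealIsIntegrallyClosed (I ^ n) := by
  intro x hx
  obtain ⟨r, hr⟩ := piece_closed hR (reesAlgebra I).val.toRingHom Subtype.val_injective (C : S →+* S[X]) C_injective
    (X ^ n) (I ^ n) (pow_ne_zero n hI) (fun i c hc => by
      rw [← pow_mul] at hc
      refine ⟨rm I (n * i) c hc, ?_⟩
      change monomial (n * i) c = _
      rw [← pow_mul, C_mul_X_pow_eq_monomial]) x hx
  have := rc_mem r n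
  rw [show rc r n = x by
    change ((reesAlgebra I).val.toRingHom r).coeff n = x
    rw [hr, coeff_C_mul, coeff_X_pow_self, mul_one]] at this
  exact this

/-- R(I) is normal if all powers are integrally closed -/
lemma rees_normal [IsDomain S] [IsNoetherianRing S] [IsIntegrallyClosed S]
    (h : ∀ n, IdealIsIntegrallyClosed (I ^ n)) : IsIntegrallyClosed (reesAlgebra I) := by
  refine normal_of_ac (Ω := S[X]) (reesAlgebra I).val.toRingHom Subtype.val_injective ?_
  intro p f hf hall
  refine ⟨⟨p, ?_⟩, rfl⟩
  refine ac_generic (fun i _ => (I ^ i : Ideal S).toAddSubgroup) ?_ ?_ ?_ ?_ (p.natDegree + 1) p f (by omega) hf ?_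
  · intro i k i' k' x y hx hy
    change x * y ∈ I ^ (i + i')
    rw [pow_add]; exact Ideal.mul_mem_mul hx hy
  · intro i i' k hi x hx
    exact Ideal.pow_le_pow_right hi hx
  · change (1 : S) ∈ I ^ 0; simp
  · intro i x f hf hk
    exact h i x (almost_int (I ^ i) f x hf (fun k => by rw [← pow_mul]; exact hk k))
  · intro k i
    obtain ⟨r, hr⟩ := hall k
    rw [← hr]
    exact r.2 i

/-- colon lemma -/
lemma colon [IsDomain S] [IsNoetherianRing S] [hS : IsIntegrallyClosed S] (𝔟 N : Ideal S) (hN : N ≠ ⊥)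
    (h𝔟 : IdealIsIntegrallyClosed 𝔟) (a x : S) (ha : a ≠ 0)
    (h : ∀ y ∈ N, ∃ z ∈ 𝔟 * N, x * y = a * z) : ∃ w ∈ 𝔟, x = a * w := by
  have h1 : IsIntegralOverIdeal (Ideal.span {a}) x := by
    refine int_of_mul _ N hN x fun y hy => ?_
    obtain ⟨z, hz, e⟩ := h y hy
    rw [e]
    exact Ideal.mul_mem_mul (Ideal.mem_span_singleton_self a) ((Ideal.mul_le_right : 𝔟 * N ≤ N) hz)
  obtain ⟨w, rfl⟩ := normal_iff.mp hS x a ha h1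
  refine ⟨w, h𝔟 w (int_of_mul 𝔟 N hN w fun y hy => ?_), rfl⟩
  obtain ⟨z, hz, e⟩ := h y hy
  rw [mul_assoc] at e
  rw [mul_left_cancel₀ ha e]; exact hz

end Rees

end MR

end Part7

section Part8
open RingTheory.Sequence IsLocalRing Polynomial

namespace MR

section T
variable {S : Type*} [CommRing S] [IsDomain S] [IsNoetherianRing S] {I : Ideal S}

lemma red_pow (a a' : S) (h2 : ∀ x ∈ I ^ 2, ∃ y ∈ I, ∃ z ∈ I, x = a * y + a' * z) (n : ℕ) :
    ∀ x ∈ I ^ (n + 2), ∃ y ∈ I ^ (n + 1), ∃ z ∈ I ^ (n + 1), x = a * y + a' * z := by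
  intro x hx
  rw [pow_add] at hx
  refine Submodule.mul_induction_on hx ?_ ?_
  · intro u hu w hw
    obtain ⟨y, hy, z, hz, rfl⟩ := h2 w hw
    refine ⟨u * y, ?_, u * z, ?_, by ring⟩
    · rw [pow_succ]; exact Ideal.mul_mem_mul hu hy
    · rw [pow_succ]; exact Ideal.mul_mem_mul hu hz
  · rintro x y ⟨y1, h1, z1, h3, rfl⟩ ⟨y2, h4, z2, h5, rfl⟩
    exact ⟨y1 + y2, add_mem h1 h4, z1 + z2, add_mem h3 h5, by ring⟩

lemma T_step2 [IsIntegrallyClosed S] (hcl : ∀ n, IdealIsIntegrallyClosed (I ^ n))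
    (a a' : S) (ha : a ∈ I ^ 1) (ha' : a' ∈ I ^ 1) (ha0 : a ≠ 0)
    (h2 : ∀ x ∈ I ^ 2, ∃ y ∈ I, ∃ z ∈ I, x = a * y + a' * z)
    (x : reesAlgebra I)
    (hx : (rm I 1 a' ha' + rm I 0 a (by simp)) * x ∈ (⊥ : Ideal (reesAlgebra I)) ⊔ Ideal.span {rm I 1 a ha}) :
    x ∈ (⊥ : Ideal (reesAlgebra I)) ⊔ Ideal.span {rm I 1 a ha} := by
  have haI : a ∈ I := by simpa using ha
  rw [bot_sup_eq] at hx ⊢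
  obtain ⟨y, hy⟩ := Ideal.mem_span_singleton'.mp hx
  rw [mul_comm] at hy
  have e : ∀ n, a' * rc x n = a * (rc y n - rc x (n + 1)) := by
    intro n
    have := congrArg (fun z => rc z (n + 1)) hy
    simp only [add_mul, rc_add, rc_rm1_mul, rc_rm0_mul] at this
    linear_combination -this
  have e0 : rc x 0 = 0 := by
    have := congrArg (fun z => rc z 0) hy
    simp only [add_mul, rc_add, rc_rm1_mul0, rc_rm0_mul] at this
    have : a * rc x 0 = 0 := by linear_combination -this
    exact (mul_eq_zero.mp this).resolve_left ha0
  refine rees_mem _ x fun n => ?_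
  cases n with
  | zero =>
    have : rm I 0 (rc x 0) (rc_mem x 0) = 0 := rc_ext fun n => by rw [rc_rm, e0, rc_zero]; simp
    rw [this]; exact zero_mem _
  | succ n =>
    obtain ⟨w, hw, e1⟩ := colon (I ^ n) (I ^ 2) (by
        intro h
        have : a ^ 2 ∈ I ^ 2 := Ideal.pow_mem_pow haI 2
        rw [h] at this
        exact ha0 (pow_eq_zero_iff (two_ne_zero) |>.mp this)) (hcl n) a (rc x (n + 1)) ha0 (by
      intro u hu
      obtain ⟨g, hg, h, hh, rfl⟩ := h2 u hu
      refine ⟨rc x (n + 1) * g + (rc y (n + 1) - rc x (n + 2)) * h, ?_, ?_⟩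
      · rw [← pow_add, show n + 2 = (n + 1) + 1 by ring, pow_succ]
        refine add_mem (Ideal.mul_mem_mul (rc_mem _ _) hg) (Ideal.mul_mem_mul (sub_mem (rc_mem _ _) ?_) hh)
        exact Ideal.pow_le_pow_right (by omega) (rc_mem x (n + 2))
      · linear_combination h * e (n + 1))
    rw [← rm_mul 1 n (n + 1) a w _ ha hw (rc_mem x (n+1)) (by ring) e1.symm]
    exact Ideal.mul_mem_right _ _ (Ideal.mem_span_singleton_self _)

lemma T_step3 (q : Ideal S) [q.IsPrime] (a a' v : S) (ha : a ∈ I ^ 1) (ha' : a' ∈ I ^ 1) (ha0 : a ≠ 0)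
    (h2 : ∀ x ∈ I ^ 2, ∃ y ∈ I, ∃ z ∈ I, x = a * y + a' * z)
    (hreg : LocReg q ⊥ [a, v])
    (x : reesAlgebra I)
    (hx : rm I 0 v (by simp) * x ∈ (⊥ : Ideal (reesAlgebra I)) ⊔ Ideal.span {rm I 1 a ha} ⊔ 
       Ideal.span {rm I 1 a' ha' + rm I 0 a (by simp)}) :
    ∃ s, s ∉ q ∧ rm I 0 s (by simp) * x ∈ (⊥ : Ideal (reesAlgebra I)) ⊔ Ideal.span {rm I 1 a ha} ⊔ 
       Ideal.span {rm I 1 a' ha' + rm I 0 a (by simp)} := by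
  have haI : a ∈ I := by simpa using ha
  have hva : ∀ u z, v * u = a * z → ∃ s, s ∉ q ∧ ∃ g, s * u = a * g := by
    intro u z h
    obtain ⟨s, hs, h⟩ := hreg.2.1 u (by
      rw [bot_sup_eq, h]; exact Ideal.mul_mem_right _ _ (Ideal.mem_span_singleton_self _))
    rw [bot_sup_eq] at h
    obtain ⟨g, hg⟩ := Ideal.mem_span_singleton'.mp h
    exact ⟨s, hs, g, by rw [← hg, mul_comm]⟩
  simp only [bot_sup_eq] at hx ⊢
  set A1 := rm I 1 a ha with hA1
  set A2 := rm I 1 a' ha' + rm I 0 a (by simp) with hA2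
  obtain ⟨y', hy', z', hz', e⟩ := Submodule.mem_sup.mp hx
  obtain ⟨y, rfl⟩ := Ideal.mem_span_singleton'.mp hy'
  obtain ⟨z, rfl⟩ := Ideal.mem_span_singleton'.mp hz'
  rw [mul_comm y, mul_comm z] at e
  have e0 : v * rc x 0 = a * rc z 0 := by
    have := congrArg (fun z => rc z 0) e
    simp only [hA1, hA2, add_mul, rc_add, rc_rm1_mul0, rc_rm0_mul] at this
    linear_combination -this
  have e1 : v * rc x 1 = a * rc y 0 + a' * rc z 0 + a * rc z 1 := by
    have := congrArg (fun z => rc z (0+1)) e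
    simp only [hA1, hA2, add_mul, rc_add, rc_rm1_mul, rc_rm0_mul] at this
    linear_combination -this
  obtain ⟨s, hs, p, hp⟩ := hva _ _ e0
  have hvp : v * p = s * rc z 0 := by
    apply mul_left_cancel₀ ha0
    linear_combination s * e0 - v * hp
  obtain ⟨s', hs', g, hg⟩ := hva (s * rc x 1 - a' * p) (s * (rc y 0 + rc z 1)) (by
    linear_combination s * e1 - a' * hvp)
  refine ⟨s' * s, fun h => ((Ideal.IsPrime.mem_or_mem inferInstance h).elim hs' hs), ?_⟩
  set x' := rm I 0 (s' * s) (by simp) * x - A2 * rm I 0 (s' * p) (by simp) - A1 * rm I 0 g (by simp) with hx'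
  have hA1m : A1 ∈ Ideal.span {A1} ⊔ Ideal.span {A2} := (le_sup_left : _ ≤ Ideal.span {A1} ⊔ Ideal.span {A2}) (Ideal.mem_span_singleton_self _)
  have hA2m : A2 ∈ Ideal.span {A1} ⊔ Ideal.span {A2} := (le_sup_right : _ ≤ Ideal.span {A1} ⊔ Ideal.span {A2}) (Ideal.mem_span_singleton_self _)
  suffices hs : x' ∈ Ideal.span {A1} ⊔ Ideal.span {A2} by
    have := add_mem (add_mem hs (Ideal.mul_mem_right (rm I 0 (s' * p) (by simp)) _ hA2m)) (Ideal.mul_mem_right (rm I 0 g (by simp)) _ hA1m)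
    rw [hx'] at this
    convert this using 1; ring
  refine rees_mem _ _ fun n => ?_
  rcases n with _ | _ | n
  · have h0 : rc x' 0 = 0 := by
      simp only [hx', hA1, hA2, add_mul, rc_sub, rc_add, rc_rm1_mul0, rc_rm0_mul, rc_rm, if_true]
      linear_combination s' * hp
    have : rm I 0 (rc x' 0) (rc_mem x' 0) = 0 := rc_ext fun n => by rw [rc_rm, h0, rc_zero]; simp
    rw [this]; exact zero_mem _
  · have h0 : rc x' (0+1) = 0 := by
      simp only [hx', hA1, hA2, add_mul, rc_sub, rc_add, rc_rm1_mul, rc_rm0_mul, rc_rm, if_true]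
      simp
      linear_combination hg
    have : rm I (0+1) (rc x' (0+1)) (rc_mem x' (0+1)) = 0 := rc_ext fun n => by rw [rc_rm, h0, rc_zero]; simp
    rw [this]; exact zero_mem _
  · obtain ⟨y, hy, z, hz, e⟩ := red_pow a a' h2 n _ (rc_mem x' (n + 2))
    have : rm I (n + 2) (rc x' (n + 2)) (rc_mem x' (n + 2)) = A1 * rm I (n + 1) y hy + A2 * rm I (n + 1) z hz
        - A1 * rm I n z (Ideal.pow_le_pow_right (by omega) hz) := by
      rw [hA2, add_mul, hA1, rm_mul 1 (n+1) (n+2) a y _ ha hy (by rw [pow_succ']; exact Ideal.mul_mem_mul haI hy) (by ring) rfl,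
       rm_mul 1 (n+1) (n+2) a' z _ ha' hz (by rw [pow_succ']; exact Ideal.mul_mem_mul (by simpa using ha') hz) (by ring) rfl,
       rm_mul 1 n (n+1) a z _ ha (Ideal.pow_le_pow_right (by omega) hz) (Ideal.mul_mem_left _ _ hz) (by ring) rfl,
       rm_mul 0 (n+1) (n+1) a z _ (by simp) hz (Ideal.mul_mem_left _ _ hz) (by ring) rfl, ← add_assoc, add_sub_cancel_right]
      exact (rm_add _ _ _ _ _ _ _ e.symm).symm
    rw [this]
    exact sub_mem (add_mem (Ideal.mul_mem_right _ _ hA1m) (Ideal.mul_mem_right _ _ hA2m)) (Ideal.mul_mem_right _ _ hA1m)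

instance rees_noeth : IsNoetherianRing (reesAlgebra I) := by
  have : Algebra.FiniteType S (reesAlgebra I) := (reesAlgebra I).fg_iff_finiteType.mp (reesAlgebra.fg (IsNoetherian.noetherian I))
  exact Algebra.FiniteType.isNoetherianRing S _

lemma It_mem (Q : Ideal (reesAlgebra I)) [Q.IsPrime] (a a' : S) (ha : a ∈ I ^ 1) (ha' : a' ∈ I ^ 1)
    (h2 : ∀ x ∈ I ^ 2, ∃ y ∈ I, ∃ z ∈ I, x = a * y + a' * z)
    (h1 : rm I 1 a ha ∈ Q) (h1' : rm I 1 a' ha' ∈ Q) : ∀ x (hx : x ∈ I ^ 1), rm I 1 x hx ∈ Q := by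
  intro x hx
  have hxI : x ∈ I := by simpa using hx
  obtain ⟨y, hy, z, hz, e⟩ := h2 (x * x) (by rw [pow_two]; exact Ideal.mul_mem_mul hxI hxI)
  have : rm I 1 x hx * rm I 1 x hx ∈ Q := by
    have hy' : y ∈ I ^ 1 := by simpa using hy
    have hz' : z ∈ I ^ 1 := by simpa using hz
    have h3 : ∀ u w, u ∈ I ^ 1 → w ∈ I ^ 1 → u * w ∈ I ^ 2 := fun u w hu hw => by
      have := Ideal.mul_mem_mul hu hw
      rwa [← pow_add] at this
    rw [rm_mul 1 1 2 x x (x * x) hx hx (h3 _ _ hx hx) rfl rfl,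
      ← rm_add 2 (a * y) (a' * z) (x * x) (h3 _ _ ha hy') (h3 _ _ ha' hz') (h3 _ _ hx hx) e.symm,
      ← rm_mul 1 1 2 a y _ ha hy' _ rfl rfl, ← rm_mul 1 1 2 a' z _ ha' hz' _ rfl rfl]
    exact add_mem (Q.mul_mem_right _ h1) (Q.mul_mem_right _ h1')
  exact (Ideal.IsPrime.mem_or_mem inferInstance this).elim id id

lemma le_of_It (P Q : Ideal (reesAlgebra I)) (hQ : ∀ x (hx : x ∈ I ^ 1), rm I 1 x hx ∈ Q) (hP : ∀ x (hx : x ∈ I ^ 1), rm I 1 x hx ∈ P)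
    (h : ∀ s, rm I 0 s (by simp) ∈ P → rm I 0 s (by simp) ∈ Q) : P ≤ Q := by
  intro x hx
  have key : ∀ N : Ideal (reesAlgebra I), (∀ x (hx : x ∈ I ^ 1), rm I 1 x hx ∈ N) → x - rm I 0 (rc x 0) (by simp) ∈ N := by
    intro N hN
    refine rees_mem _ _ fun n => ?_
    cases n with
    | zero =>
      have h0 : rc (x - rm I 0 (rc x 0) (by simp)) 0 = 0 := by simp [rc_sub, rc_rm]
      have : ∀ h, rm I 0 (rc (x - rm I 0 (rc x 0) (by simp)) 0) h = 0 := fun h => rc_ext fun n => by rw [rc_rm, h0, rc_zero]; simp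
      rw [this]; exact zero_mem _
    | succ n => exact rm_mem_of_one N hN n _ _
  have h1 := h (rc x 0) (by
    have := sub_mem hx (key P hP)
    rwa [sub_sub_cancel] at this)
  have := add_mem (key Q hQ) h1
  rwa [sub_add_cancel] at this

end T
end MR

end Part8

section Part9
open RingTheory.Sequence IsLocalRing Polynomial

namespace MR

section T
variable {S : Type*} [CommRing S] [IsDomain S] [IsNoetherianRing S] {I : Ideal S}

lemma ch_normal {L : Type*} [Field L] [Algebra S L] [FaithfulSMul S L]
    (hR : IsIntegrallyClosed (reesAlgebra I)) (a : S) (ha : a ∈ I) (ha0 : a ≠ 0) :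
    IsIntegrallyClosed (ch L I a) := by
  obtain ⟨j, h1, h2, h3⟩ := rees_chart (L := L) (I := I) a ha ha0
  exact chart_normal hR j h1 _ h2 h3

lemma ch_cm {L : Type*} [Field L] [Algebra S L] [IsFractionRing S L] (hdim : ringKrullDim S ≤ 2)
    (hR : IsIntegrallyClosed (reesAlgebra I)) (a : S) (ha : a ∈ I) (ha0 : a ≠ 0) :
    IsCohenMacaulayRing (ch L I a) := by
  have := ch_normal (L := L) hR a ha ha0
  have := noeth_of_fg (ch L I a) (ch_fg I a)
  exact normal_cm ((dim_fg (ch L I a) (ch_fg I a)).trans hdim)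

lemma T_chart1 (hdim : ringKrullDim S ≤ 2)
    (hR : IsIntegrallyClosed (reesAlgebra I)) (a : S) (ha : a ∈ I ^ 1) (ha0 : a ≠ 0)
    (P : Ideal (reesAlgebra I)) [P.IsPrime] (hP : rm I 1 a ha ∉ P) :
    IsCohenMacaulayLocalRing (Localization.AtPrime P) := by
  obtain ⟨j, h1, h2, h3⟩ := rees_chart (L := FractionRing S) (I := I) a (by simpa using ha) ha0
  exact cm_chart j h1 _ h3 (cm_poly (ch_cm hdim hR a (by simpa using ha) ha0)) P hP

lemma T_chart0 (hdim : ringKrullDim S ≤ 2)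
    (hR : IsIntegrallyClosed (reesAlgebra I)) (a : S) (ha : a ∈ I)
    (P : Ideal (reesAlgebra I)) [P.IsPrime] (hP : rm I 0 a (by simp) ∉ P) :
    IsCohenMacaulayLocalRing (Localization.AtPrime P) := by
  have := rees_base_normal hR
  refine cm_chart (reesAlgebra I).val.toRingHom Subtype.val_injective (rm I 0 a (by simp)) ?_
    (cm_poly (normal_cm hdim)) P hP
  intro y
  refine ⟨y.natDegree, ⟨C a ^ y.natDegree * y, fun i => ?_⟩, by
    change (monomial 0 a) ^ _ * y = C a ^ _ * y
    rw [monomial_zero_left]⟩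
  rw [← C_pow, coeff_C_mul]
  by_cases h : i ≤ y.natDegree
  · exact Ideal.mul_mem_right _ _ (Ideal.pow_le_pow_right h (Ideal.pow_mem_pow ha _))
  · rw [coeff_eq_zero_of_natDegree_lt (by omega), mul_zero]; exact zero_mem _

theorem T_main (hdim : ringKrullDim S ≤ 2)
    (hR : IsIntegrallyClosed (reesAlgebra I)) (a a' : S) (haI : a ∈ I) (haI' : a' ∈ I)
    (ha0 : a ≠ 0) (ha0' : a' ≠ 0)
    (h2 : ∀ x ∈ I ^ 2, ∃ y ∈ I, ∃ z ∈ I, x = a * y + a' * z) :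
    IsCohenMacaulayRing (reesAlgebra I) := by
  refine ⟨inferInstance, fun P hP => ?_⟩
  have := hP
  have := rees_base_normal hR
  have ha : a ∈ I ^ 1 := by simpa using haI
  have ha' : a' ∈ I ^ 1 := by simpa using haI'
  by_cases hP1 : rm I 1 a ha ∈ P
  swap
  · exact T_chart1 hdim hR a ha ha0 P hP1
  by_cases hP2 : rm I 1 a' ha' ∈ P
  swap
  · exact T_chart1 hdim hR a' ha' ha0' P hP2
  by_cases hP3 : rm I 0 a (by simp) ∈ P
  swap
  · exact T_chart0 hdim hR a haI P hP3
  have hIP := It_mem P a a' ha ha' h2 hP1 hP2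
  have hI : I ≠ ⊥ := by
    rintro rfl; exact ha0 haI
  have hcl := rees_pow_closed hI hR
  set q := P.comap (rin I) with hq
  have hq' : ∀ s, s ∈ q ↔ rm I 0 s (by simp) ∈ P := fun s => by rw [hq, Ideal.mem_comap, rin_eq]
  have haq : a ∈ q := (hq' a).mpr hP3
  have hmin0 : ∀ Q : Ideal (reesAlgebra I), Q.IsPrime → rm I 1 a ha ∈ Q →
      rm I 1 a' ha' + rm I 0 a (by simp) ∈ Q → rm I 0 a (by simp) ∈ Q ∧ (∀ x (hx : x ∈ I ^ 1), rm I 1 x hx ∈ Q) := by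
    intro Q hQ h3 h4
    have h5 : rm I 0 a (by simp) * rm I 1 a' ha' ∈ Q := by
      have : rm I 0 a (by simp) * rm I 1 a' ha' = rm I 0 a' (by simp) * rm I 1 a ha := by
        rw [rm_mul 0 1 1 a a' (a * a') _ ha' (Ideal.mul_mem_left _ _ ha') rfl rfl,
          rm_mul 0 1 1 a' a (a * a') _ ha (Ideal.mul_mem_left _ _ ha') rfl (by ring)]
      rw [this]; exact Q.mul_mem_left _ h3
    have h6 : rm I 0 a (by simp) ∈ Q ∧ rm I 1 a' ha' ∈ Q := by
      rcases hQ.mem_or_mem h5 with h | h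
      · exact ⟨h, by have := sub_mem h4 h; rwa [add_sub_cancel_right] at this⟩
      · exact ⟨by have := sub_mem h4 h; rwa [add_sub_cancel_left] at this, h⟩
    exact ⟨h6.1, It_mem Q a a' ha ha' h2 h3 h6.2⟩
  have hqQ : ∀ Q : Ideal (reesAlgebra I), Q ≤ P → Q.comap (rin I) ≤ q := fun Q h => Ideal.comap_mono h
  have hrin : ∀ (Q : Ideal (reesAlgebra I)) s, s ∈ Q.comap (rin I) ↔ rm I 0 s (by simp) ∈ Q :=
    fun Q s => by rw [Ideal.mem_comap, rin_eq]
  by_cases hht : 2 ≤ q.height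
  swap
  · refine normal_cm_prime P (height_le_of_min P [rm I 1 a ha, rm I 1 a' ha' + rm I 0 a (by simp)] ?_ ?_)
    · simp only [List.mem_cons, List.not_mem_nil, or_false, forall_eq_or_imp, forall_eq]
      exact ⟨hP1, add_mem hP2 hP3⟩
    · intro Q hQ hQP hm
      simp only [List.mem_cons, List.not_mem_nil, or_false, forall_eq_or_imp, forall_eq] at hm
      obtain ⟨h3, h4⟩ := hmin0 Q hQ hm.1 hm.2
      refine le_of_It P Q h4 hIP fun s hs => ?_
      rw [← hrin]
      by_contra hsq
      have hlt : Q.comap (rin I) < q := lt_of_le_of_ne (hqQ Q hQP) (fun h => hsq (by rw [h, hq']; exact hs))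
      have hlt0 : (⊥ : Ideal S) < Q.comap (rin I) := by
        rw [bot_lt_iff_ne_bot]
        intro h
        have : a ∈ Q.comap (rin I) := (hrin Q a).mpr h3
        rw [h] at this; exact ha0 this
      have := hQ
      have e1 := Ideal.height_add_one_le_of_lt_of_isPrime hlt
      have e2 := Ideal.height_add_one_le_of_lt_of_isPrime hlt0
      rw [Ideal.height_bot, zero_add] at e2
      apply hht
      calc (2 : ℕ∞) = 1 + 1 := by norm_num
        _ ≤ (Q.comap (rin I)).height + 1 := by gcongr
        _ ≤ q.height := e1
  obtain ⟨v, hv, hreg⟩ := normal_depth q hht a ha0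
  have hht2 : q.height ≤ 2 := by
    have h : ((q.height : ℕ∞) : WithBot ℕ∞) ≤ ((2 : ℕ∞) : WithBot ℕ∞) :=
      (Ideal.height_le_ringKrullDim_of_isPrime (I := q)).trans hdim
    exact_mod_cast h
  refine cm_crit' P [rm I 1 a ha, rm I 1 a' ha' + rm I 0 a (by simp), rm I 0 v (by simp)] ?_ ?_ ?_
  · simp only [List.mem_cons, List.not_mem_nil, or_false, forall_eq_or_imp, forall_eq]
    exact ⟨hP1, add_mem hP2 hP3, (hq' v).mp hv⟩
  · refine ⟨fun x hx => ⟨1, fun h => hP.ne_top ((Ideal.eq_top_iff_one P).mpr h), ?_⟩,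
      fun x hx => ⟨1, fun h => hP.ne_top ((Ideal.eq_top_iff_one P).mpr h), ?_⟩, fun x hx => ?_, trivial⟩
    · rw [one_mul]
      rcases mul_eq_zero.mp ((Submodule.mem_bot _).mp hx) with h | h
      · exfalso
        have := congrArg (fun z => rc z 1) h
        simp only [rc_rm, rc_zero, if_true] at this
        exact ha0 this
      · exact h
    · rw [one_mul]
      exact T_step2 hcl a a' ha ha' ha0 h2 x hx
    · obtain ⟨s, hs, h⟩ := T_step3 q a a' v ha ha' ha0 h2 hreg x hx
      exact ⟨_, fun h' => hs ((hq' s).mpr h'), h⟩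
  · intro Q hQ hQP hm
    simp only [List.mem_cons, List.not_mem_nil, or_false, forall_eq_or_imp, forall_eq] at hm
    obtain ⟨h3, h4⟩ := hmin0 Q hQ hm.1 hm.2.1
    refine le_of_It P Q h4 hIP fun s hs => ?_
    rw [← hrin]
    have := locReg_min q [a, v] hreg (by simpa using hht2) (Q.comap (rin I)) inferInstance (hqQ Q hQP) (by
      simp only [List.mem_cons, List.not_mem_nil, or_false, forall_eq_or_imp, forall_eq]
      exact ⟨(hrin Q a).mpr h3, (hrin Q v).mpr hm.2.2⟩)
    exact this ((hq' s).mpr hs)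

end T
end MR

end Part9

section Part10
open RingTheory.Sequence IsLocalRing Polynomial

namespace MR

section BB
variable {A : Type*} [CommRing A]

lemma IJ_mul (I J : Ideal A) (i j m n : ℕ) (x y : A) (hx : x ∈ I ^ i * J ^ j) (hy : y ∈ I ^ m * J ^ n) :
    x * y ∈ I ^ (i + m) * J ^ (j + n) := by
  have := Ideal.mul_mem_mul hx hy
  rwa [show I ^ i * J ^ j * (I ^ m * J ^ n) = I ^ (i + m) * J ^ (j + n) by rw [pow_add, pow_add]; ring] at this

lemma IJ_anti (I J : Ideal A) (i j m n : ℕ) (h : m ≤ i) (h' : n ≤ j) : I ^ i * J ^ j ≤ I ^ m * J ^ n :=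
  Ideal.mul_mono (Ideal.pow_le_pow_right h) (Ideal.pow_le_pow_right h')

/-- The bigraded model of the multi-Rees algebra. The outer variable is `t₁`. -/
noncomputable def RR (I J : Ideal A) : Subalgebra A (Polynomial A[X]) where
  carrier := {p | ∀ i j, (p.coeff i).coeff j ∈ I ^ i * J ^ j}
  mul_mem' := by
    intro p q hp hq i j
    rw [coeff_mul, finsetSum_coeff]
    refine sum_mem fun x hx => ?_
    rw [coeff_mul]
    refine sum_mem fun y hy => ?_
    rw [Finset.HasAntidiagonal.mem_antidiagonal] at hx hy
    rw [← hx, ← hy]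
    exact IJ_mul I J _ _ _ _ _ _ (hp _ _) (hq _ _)
  add_mem' := by
    intro p q hp hq i j
    rw [coeff_add, coeff_add]; exact add_mem (hp i j) (hq i j)
  algebraMap_mem' := by
    intro r i j
    rw [Polynomial.algebraMap_apply, Polynomial.algebraMap_apply, coeff_C]
    split_ifs with h
    · subst h
      rw [coeff_C]
      split_ifs with h
      · subst h; simp
      · exact zero_mem _
    · rw [coeff_zero]; exact zero_mem _

noncomputable instance RR_cr (I J : Ideal A) : CommRing (RR I J) := (RR I J).toCommRing

variable {I J : Ideal A}

/-- monomial -/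
noncomputable def bm (I J : Ideal A) (i j : ℕ) (x : A) (hx : x ∈ I ^ i * J ^ j) : RR I J :=
  ⟨monomial i (monomial j x), by
    intro m n
    rw [coeff_monomial]
    split_ifs with h
    · subst h
      rw [coeff_monomial]
      split_ifs with h
      · subst h; exact hx
      · exact zero_mem _
    · rw [coeff_zero]; exact zero_mem _⟩

/-- coefficient -/
noncomputable def bc (x : RR I J) (i j : ℕ) : A := ((x : Polynomial A[X]).coeff i).coeff j

lemma bc_mem (x : RR I J) (i j : ℕ) : bc x i j ∈ I ^ i * J ^ j := x.2 i j

lemma bc_ext {x y : RR I J} (h : ∀ i j, bc x i j = bc y i j) : x = y :=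
  Subtype.ext (Polynomial.ext fun i => Polynomial.ext fun j => h i j)

lemma bc_add (x y : RR I J) (i j) : bc (x + y) i j = bc x i j + bc y i j := by
  change ((x + y : Polynomial A[X]).coeff i).coeff j = _
  rw [coeff_add, coeff_add]; rfl
lemma bc_sub (x y : RR I J) (i j) : bc (x - y) i j = bc x i j - bc y i j := by
  change ((x - y : Polynomial A[X]).coeff i).coeff j = _
  rw [coeff_sub, coeff_sub]; rfl
lemma bc_zero (i j) : bc (0 : RR I J) i j = 0 := by
  change ((0 : Polynomial A[X]).coeff i).coeff j = _
  rw [coeff_zero, coeff_zero]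
lemma bc_bm (m n i j : ℕ) (x : A) (hx) : bc (bm I J m n x hx) i j = if m = i ∧ n = j then x else 0 := by
  change ((monomial m (monomial n x) : Polynomial A[X]).coeff i).coeff j = _
  rw [coeff_monomial]
  by_cases h : m = i
  · rw [if_pos h, coeff_monomial]; simp [h]
  · rw [if_neg h, coeff_zero]; simp [h]
lemma bc_bm_mul (m n i j : ℕ) (x : A) (hx) (y) : bc (bm I J m n x hx * y) (i + m) (j + n) = x * bc y i j := by
  change (((monomial m (monomial n x) : Polynomial A[X]) * y).coeff (i + m)).coeff (j + n) = _
  rw [coeff_monomial_mul, coeff_monomial_mul]; rfl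

lemma monomial_mul_coeff_lt {R : Type*} [CommRing R] (m n : ℕ) (x : R) (p : R[X]) (h : n < m) :
    (monomial m x * p).coeff n = 0 := by
  rw [← C_mul_X_pow_eq_monomial, mul_assoc, coeff_C_mul, X_pow_mul, coeff_mul_X_pow', if_neg (by omega), mul_zero]

lemma bc_bm_mul_lt1 (m n i j : ℕ) (x : A) (hx) (y) (h : i < m) : bc (bm I J m n x hx * y) i j = 0 := by
  change (((monomial m (monomial n x) : Polynomial A[X]) * y).coeff i).coeff j = _
  rw [monomial_mul_coeff_lt _ _ _ _ h, coeff_zero]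

lemma bc_bm_mul_lt2 (m n i j : ℕ) (x : A) (hx) (y) (h : j < n) : bc (bm I J m n x hx * y) i j = 0 := by
  by_cases h' : i < m
  · exact bc_bm_mul_lt1 _ _ _ _ _ _ _ h'
  obtain ⟨k, rfl⟩ : ∃ k, i = k + m := ⟨i - m, by omega⟩
  change (((monomial m (monomial n x) : Polynomial A[X]) * y).coeff (k + m)).coeff j = _
  rw [coeff_monomial_mul, monomial_mul_coeff_lt _ _ _ _ h]

lemma bc_mul_zero (x y : RR I J) : bc (x * y) 0 0 = bc x 0 0 * bc y 0 0 := by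
  change ((x * y : Polynomial A[X]).coeff 0).coeff 0 = _
  rw [mul_coeff_zero, mul_coeff_zero]; rfl

lemma bc_00 (i j : ℕ) (x : A) (hx) (y) : bc (bm I J 0 0 x hx * y) i j = x * bc y i j := bc_bm_mul 0 0 i j x hx y
lemma bc_10 (i j : ℕ) (x : A) (hx) (y) : bc (bm I J 1 0 x hx * y) (i + 1) j = x * bc y i j := bc_bm_mul 1 0 i j x hx y
lemma bc_01 (i j : ℕ) (x : A) (hx) (y) : bc (bm I J 0 1 x hx * y) i (j + 1) = x * bc y i j := bc_bm_mul 0 1 i j x hx y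
lemma bc_10z (j : ℕ) (x : A) (hx) (y) : bc (bm I J 1 0 x hx * y) 0 j = 0 := bc_bm_mul_lt1 1 0 0 j x hx y (by omega)
lemma bc_01z (i : ℕ) (x : A) (hx) (y) : bc (bm I J 0 1 x hx * y) i 0 = 0 := bc_bm_mul_lt2 0 1 i 0 x hx y (by omega)

lemma bm_mul (i j i' j' m n : ℕ) (x y z : A) (hx hy hz) (hm : i + i' = m) (hn : j + j' = n) (h : x * y = z) :
    bm I J i j x hx * bm I J i' j' y hy = bm I J m n z hz := by
  subst hm hn h
  apply Subtype.ext
  change (monomial i (monomial j x) : Polynomial A[X]) * monomial i' (monomial j' y) = monomial _ (monomial _ _)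
  rw [monomial_mul_monomial, monomial_mul_monomial]

lemma bm_add (i j : ℕ) (x y z : A) (hx hy hz) (h : x + y = z) :
    bm I J i j x hx + bm I J i j y hy = bm I J i j z hz := by
  subst h
  apply Subtype.ext
  change (monomial i (monomial j x) : Polynomial A[X]) + monomial i (monomial j y) = monomial _ (monomial _ _)
  rw [map_add, map_add]

lemma bm_zero (i j : ℕ) (x : A) (hx) (h : x = 0) : bm I J i j x hx = 0 := by
  subst h
  apply Subtype.ext
  change (monomial i (monomial j 0) : Polynomial A[X]) = 0
  rw [map_zero, map_zero]

lemma bc_sum_eq (x : RR I J) : x = ∑ i ∈ Finset.range ((x : Polynomial A[X]).natDegree + 1),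
    ∑ j ∈ Finset.range (((x : Polynomial A[X]).coeff i).natDegree + 1), bm I J i j (bc x i j) (bc_mem x i j) := by
  apply Subtype.ext
  rw [AddSubmonoidClass.coe_finsetSum]
  conv_lhs => rw [(x : Polynomial A[X]).as_sum_range]
  refine Finset.sum_congr rfl fun i _ => ?_
  rw [AddSubmonoidClass.coe_finsetSum]
  conv_lhs => rw [((x : Polynomial A[X]).coeff i).as_sum_range, map_sum]
  rfl

lemma RR_mem (N : Ideal (RR I J)) (x : RR I J)
    (h : ∀ i j, bm I J i j (bc x i j) (bc_mem x i j) ∈ N) : x ∈ N := by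
  rw [bc_sum_eq x]
  exact sum_mem fun i _ => sum_mem fun j _ => h i j

/-- generation -/
lemma RR_le (s s' : Set A) (hs : Ideal.span s = I) (hs' : Ideal.span s' = J) (T : Subalgebra A (Polynomial A[X]))
    (h1 : ∀ a ∈ s, C (C a) * X ∈ T) (h2 : ∀ b ∈ s', C (C b * X) ∈ T) : RR I J ≤ T := by
  have hC : ∀ a : A, (C (C a) : Polynomial A[X]) ∈ T := fun a => T.algebraMap_mem a
  have h1' : ∀ a ∈ I, C (C a) * X ∈ T := by
    intro a ha
    rw [← hs] at ha
    refine Submodule.span_induction h1 ?_ ?_ ?_ ha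
    · simp
    · intro x y _ _ hx hy
      rw [C_add, C_add, add_mul]; exact add_mem hx hy
    · intro r x _ hx
      rw [smul_eq_mul, C_mul, C_mul, mul_assoc]; exact mul_mem (hC r) hx
  have h2' : ∀ a ∈ J, C (C a * X) ∈ T := by
    intro a ha
    rw [← hs'] at ha
    refine Submodule.span_induction h2 ?_ ?_ ?_ ha
    · simp
    · intro x y _ _ hx hy
      rw [C_add, add_mul, C_add]; exact add_mem hx hy
    · intro r x _ hx
      have := mul_mem (hC r) hx
      rwa [← C_mul, ← mul_assoc, ← C_mul] at this
  have g1 : ∀ n, ∀ a ∈ I ^ n, C (C a) * X ^ n ∈ T := by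
    intro n
    induction n with
    | zero => intro a _; simpa using hC a
    | succ n ih =>
      intro a ha
      rw [pow_succ] at ha
      refine Submodule.mul_induction_on ha ?_ ?_
      · intro x hx y hy
        have := mul_mem (ih x hx) (h1' y hy)
        convert this using 1
        rw [C_mul, C_mul]; ring
      · intro x y hx hy
        rw [C_add, C_add, add_mul]; exact add_mem hx hy
  have g2 : ∀ n, ∀ a ∈ J ^ n, C (C a * X ^ n) ∈ T := by
    intro n
    induction n with
    | zero => intro a _; simpa using hC a
    | succ n ih =>
      intro a ha
      rw [pow_succ] at ha
      refine Submodule.mul_induction_on ha ?_ ?_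
      · intro x hx y hy
        have := mul_mem (ih x hx) (h2' y hy)
        convert this using 1
        simp only [C_mul, C_pow, pow_succ]; ring
      · intro x y hx hy
        rw [C_add, add_mul, C_add]; exact add_mem hx hy
  intro p hp
  have e := congrArg Subtype.val (bc_sum_eq (⟨p, hp⟩ : RR I J))
  rw [AddSubmonoidClass.coe_finsetSum] at e
  change p = _ at e
  rw [e]
  refine sum_mem fun i _ => ?_
  rw [AddSubmonoidClass.coe_finsetSum]
  refine sum_mem fun j _ => ?_
  change (monomial i (monomial j _) : Polynomial A[X]) ∈ T
  have hb := bc_mem (⟨p, hp⟩ : RR I J) i j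
  refine Submodule.mul_induction_on (C := fun y => (monomial i (monomial j y) : Polynomial A[X]) ∈ T) hb ?_ ?_
  · intro x hx y hy
    have := mul_mem (g1 i x hx) (g2 j y hy)
    convert this using 1
    rw [← C_mul_X_pow_eq_monomial, ← C_mul_X_pow_eq_monomial]
    simp only [C_mul]; ring
  · intro x y hx hy
    rw [map_add, map_add]; exact add_mem hx hy

lemma RR_fg [IsNoetherianRing A] : (RR I J).FG := by
  classical
  obtain ⟨s, hs⟩ := IsNoetherian.noetherian I
  obtain ⟨s', hs'⟩ := IsNoetherian.noetherian J
  refine ⟨s.image (fun a => C (C a) * X) ∪ s'.image (fun a => C (C a * X)), le_antisymm ?_ ?_⟩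
  · refine Algebra.adjoin_le ?_
    intro y hy
    simp only [Finset.coe_union, Finset.coe_image, Set.mem_union, Set.mem_image] at hy
    rcases hy with ⟨a, ha, rfl⟩ | ⟨a, ha, rfl⟩
    · have haI : a ∈ I := hs ▸ Ideal.subset_span ha
      have := (bm I J 1 0 a (by simpa using haI)).2
      change (monomial 1 (monomial 0 a) : Polynomial A[X]) ∈ _ at this
      rwa [← C_mul_X_eq_monomial, monomial_zero_left] at this
    · have haI : a ∈ J := hs' ▸ Ideal.subset_span ha
      have := (bm I J 0 1 a (by simpa using haI)).2
      change (monomial 0 (monomial 1 a) : Polynomial A[X]) ∈ _ at this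
      rwa [monomial_zero_left, ← C_mul_X_eq_monomial] at this
  · refine RR_le (s : Set A) (s' : Set A) hs hs' _ ?_ ?_
    · intro a ha
      exact Algebra.subset_adjoin (Finset.mem_coe.mpr (Finset.mem_union_left _ (Finset.mem_image_of_mem _ ha)))
    · intro a ha
      exact Algebra.subset_adjoin (Finset.mem_coe.mpr (Finset.mem_union_right _ (Finset.mem_image_of_mem _ ha)))

instance RR_noeth [IsNoetherianRing A] : IsNoetherianRing (RR I J) := by
  have : Algebra.FiniteType A (RR I J) := (RR I J).fg_iff_finiteType.mp RR_fg
  exact Algebra.FiniteType.isNoetherianRing A (RR I J)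

theorem multi_equiv (I J : Ideal A) : Nonempty (multiReesAlgebra ![I, J] ≃+* RR I J) := by
  let e : MvPolynomial (Fin 2) A ≃ₐ[A] Polynomial A[X] :=
    (MvPolynomial.finSuccEquiv A 1).trans (Polynomial.mapAlgEquiv (MvPolynomial.uniqueAlgEquiv A (Fin 1)))
  have e0 : e (MvPolynomial.X 0) = X := by
    simp [e, MvPolynomial.finSuccEquiv_X_zero]
  have e1 : e (MvPolynomial.X 1) = C X := by
    have : (1 : Fin 2) = Fin.succ 0 := rfl
    simp only [e, AlgEquiv.trans_apply, this, MvPolynomial.finSuccEquiv_X_succ]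
    simp
  have eC : ∀ a, e (MvPolynomial.C a) = C (C a) := fun a => e.commutes a
  have hmap : (multiReesAlgebra ![I, J]).map e.toAlgHom = RR I J := by
    rw [multiReesAlgebra, AlgHom.map_adjoin]
    refine le_antisymm ?_ ?_
    · refine Algebra.adjoin_le ?_
      rintro _ ⟨x, hx, rfl⟩
      obtain ⟨i, hi⟩ := Set.mem_iUnion.mp hx
      obtain ⟨a, ha, rfl⟩ := hi
      change e (MvPolynomial.C a * MvPolynomial.X i) ∈ _
      rw [map_mul, eC]
      fin_cases i
      · change a ∈ I at ha
        change C (C a) * e (MvPolynomial.X 0) ∈ _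
        rw [e0]
        have := (bm I J 1 0 a (by simpa using ha)).2
        change (monomial 1 (monomial 0 a) : Polynomial A[X]) ∈ _ at this
        rwa [← C_mul_X_eq_monomial, monomial_zero_left] at this
      · change a ∈ J at ha
        change C (C a) * e (MvPolynomial.X 1) ∈ _
        rw [e1]
        have := (bm I J 0 1 a (by simpa using ha)).2
        change (monomial 0 (monomial 1 a) : Polynomial A[X]) ∈ _ at this
        rwa [monomial_zero_left, ← C_mul_X_eq_monomial, C_mul] at this
    · refine RR_le (I : Set A) (J : Set A) (Ideal.span_eq _) (Ideal.span_eq _) _ ?_ ?_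
      · intro a ha
        refine Algebra.subset_adjoin ⟨_, Set.mem_iUnion.mpr ⟨0, a, ha, rfl⟩, ?_⟩
        change e (MvPolynomial.C a * MvPolynomial.X 0) = _
        rw [map_mul, eC, e0]
      · intro a ha
        refine Algebra.subset_adjoin ⟨_, Set.mem_iUnion.mpr ⟨1, a, ha, rfl⟩, ?_⟩
        change e (MvPolynomial.C a * MvPolynomial.X 1) = _
        rw [map_mul, eC, e1, C_mul]
  rw [← hmap]
  exact ⟨((multiReesAlgebra ![I, J]).equivMapOfInjective e.toAlgHom e.injective).toRingEquiv⟩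

end BB
end MR

end Part10

section Part11
open RingTheory.Sequence IsLocalRing Polynomial

namespace MR

section Norm
variable {A : Type*} [CommRing A] [IsDomain A] {I J : Ideal A}

lemma RR_normal [IsNoetherianRing A] [IsIntegrallyClosed A]
    (h : ∀ i j, IdealIsIntegrallyClosed (I ^ i * J ^ j)) : IsIntegrallyClosed (RR I J) := by
  refine normal_of_ac (Ω := Polynomial A[X]) (RR I J).val.toRingHom Subtype.val_injective ?_
  intro p f hf hall
  refine ⟨⟨p, ?_⟩, rfl⟩
  refine ac_generic (D := A[X]) (fun i _ => 
    { carrier := {q : A[X] | ∀ j, q.coeff j ∈ I ^ i * J ^ j}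
      add_mem' := fun {q r} hq hr j => by rw [coeff_add]; exact add_mem (hq j) (hr j)
      zero_mem' := fun j => by rw [coeff_zero]; exact zero_mem _
      neg_mem' := fun {q} hq j => by rw [coeff_neg]; exact neg_mem (hq j) }) ?_ ?_ ?_ ?_ (p.natDegree + 1) p f (by omega) hf ?_
  · intro i k i' k' x y hx hy j
    rw [coeff_mul]
    refine sum_mem fun z hz => ?_
    rw [Finset.HasAntidiagonal.mem_antidiagonal] at hz
    rw [← hz]
    exact IJ_mul I J _ _ _ _ _ _ (hx _) (hy _)
  · intro i i' k hi x hx j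
    exact IJ_anti I J _ _ _ _ hi le_rfl (hx j)
  · intro j
    rw [coeff_one]
    split_ifs with h
    · subst h; simp
    · exact zero_mem _
  · intro i x f hf hk j
    have := ac_generic (D := A) (fun j k => (I ^ (i * k) * J ^ j : Ideal A).toAddSubgroup) ?_ ?_ ?_ ?_
      (x.natDegree + 1) x f (by omega) hf (fun k j => hk k j) j
    · have h1 : x.coeff j ∈ I ^ (i * 1) * J ^ j := this
      rwa [mul_one] at h1
    · intro j k j' k' x y hx hy
      change x * y ∈ I ^ (i * (k + k')) * J ^ (j + j')
      rw [mul_add]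
      exact IJ_mul I J _ _ _ _ _ _ hx hy
    · intro j j' k hj x hx
      exact IJ_anti I J _ _ _ _ le_rfl hj hx
    · change (1 : A) ∈ I ^ (i * 0) * J ^ 0; simp
    · intro j x f hf hk
      change x ∈ I ^ (i * 1) * J ^ j
      rw [mul_one]
      refine h i j x (almost_int (I ^ i * J ^ j) f x hf (fun k => ?_))
      rw [mul_pow, ← pow_mul, ← pow_mul]; exact hk k
  · intro k i
    obtain ⟨r, hr⟩ := hall k
    rw [← hr]
    exact r.2 i

lemma RR_piece (hR : IsIntegrallyClosed (RR I J)) (hI : I ≠ ⊥) (hJ : J ≠ ⊥) (i j : ℕ) :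
    IdealIsIntegrallyClosed (I ^ i * J ^ j) := by
  intro x hx
  obtain ⟨r, hr⟩ := piece_closed hR (RR I J).val.toRingHom Subtype.val_injective
    ((C : A[X] →+* Polynomial A[X]).comp (C : A →+* A[X])) (C_injective.comp C_injective)
    (monomial i (monomial j 1)) (I ^ i * J ^ j) (mul_ne_zero (pow_ne_zero i hI) (pow_ne_zero j hJ)) (fun k c hc => by
      rw [mul_pow, ← pow_mul, ← pow_mul] at hc
      refine ⟨bm I J (i * k) (j * k) c hc, ?_⟩
      change (monomial (i * k) (monomial (j * k) c) : Polynomial A[X]) = C (C c) * _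
      rw [monomial_pow, monomial_pow, C_mul_monomial, C_mul_monomial, one_pow, mul_one]) x hx
  have := bc_mem r i j
  rw [show bc r i j = x by
    change (((RR I J).val.toRingHom r).coeff i).coeff j = x
    rw [hr]
    change ((C (C x) * monomial i (monomial j (1:A)) : Polynomial A[X]).coeff i).coeff j = x
    rw [C_mul_monomial, C_mul_monomial, coeff_monomial, if_pos rfl, coeff_monomial, if_pos rfl, mul_one]] at this
  exact this

end Norm

section Swap
variable {A : Type*} [CommRing A]

lemma RR_ev (I J : Ideal A) (R : Type*) [CommRing R] (φ ψ : RR I J →+* R)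
    (h : ∀ i j x hx, φ (bm I J i j x hx) = ψ (bm I J i j x hx)) : φ = ψ := by
  ext x
  rw [bc_sum_eq x]
  simp only [map_sum, h]

theorem RR_swap (I J : Ideal A) : ∃ e : RR I J ≃+* RR J I, ∀ i j x hx, e (bm I J i j x hx) = bm J I j i x (by rwa [mul_comm]) := by
  have hs : ∀ (i j : ℕ) (x : A), Bivariate.swap (R := A) (monomial i (monomial j x)) = monomial j (monomial i x) := by
    intro i j x
    exact Bivariate.swap_monomial_monomial i j x
  have hm : ∀ (I J : Ideal A) (r : RR I J), (Bivariate.swap (R := A) (r : Polynomial A[X])) ∈ RR J I := by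
    intro I J r
    rw [bc_sum_eq r, AddSubmonoidClass.coe_finsetSum, map_sum]
    refine sum_mem fun i _ => ?_
    rw [AddSubmonoidClass.coe_finsetSum, map_sum]
    refine sum_mem fun j _ => ?_
    change Bivariate.swap (R := A) (monomial i (monomial j _)) ∈ _
    rw [hs]
    exact (bm J I j i _ (by rw [mul_comm]; exact bc_mem r i j)).2
  obtain ⟨φ, hφ⟩ : ∃ φ : RR I J →+* RR J I, ∀ r, (φ r : Polynomial A[X]) = Bivariate.swap (R := A) (r : Polynomial A[X]) :=

    exists_lift (R := RR I J) (B := RR J I) (Ω := Polynomial A[X]) ((Bivariate.swap (R := A)).toAlgHom.toRingHom.comp (RR I J).val.toRingHom) (RR J I).val.toRingHom Subtype.val_injective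
    (fun r => ⟨⟨_, hm I J r⟩, rfl⟩)
  obtain ⟨ψ, hψ⟩ : ∃ φ : RR J I →+* RR I J, ∀ r, (φ r : Polynomial A[X]) = Bivariate.swap (R := A) (r : Polynomial A[X]) :=

    exists_lift (R := RR J I) (B := RR I J) (Ω := Polynomial A[X]) ((Bivariate.swap (R := A)).toAlgHom.toRingHom.comp (RR J I).val.toRingHom) (RR I J).val.toRingHom Subtype.val_injective
    (fun r => ⟨⟨_, hm J I r⟩, rfl⟩)
  have h1 : ∀ i j x hx, φ (bm I J i j x hx) = bm J I j i x (by rwa [mul_comm]) := by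
    intro i j x hx
    apply Subtype.ext
    rw [hφ]
    exact hs i j x
  refine ⟨RingEquiv.ofRingHom φ ψ ?_ ?_, h1⟩
  · exact RingHom.ext fun r => Subtype.ext (by
      rw [RingHom.comp_apply, hφ, hψ, Bivariate.swap_swap_apply]; rfl)
  · exact RingHom.ext fun r => Subtype.ext (by
      rw [RingHom.comp_apply, hψ, hφ, Bivariate.swap_swap_apply]; rfl)

end Swap

end MR

end Part11

section Part12
open RingTheory.Sequence IsLocalRing Polynomial

namespace MR

section Charts
universe u
variable {A : Type u} [CommRing A] [IsDomain A] {I J : Ideal A}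

lemma map_ch_exists {L : Type*} [Field L] [Algebra A L] [FaithfulSMul A L] (a : A) (ha : a ∈ I) (ha0 : a ≠ 0) (j : ℕ)
    (w : ch L I a) (hw : w ∈ (J.map (algebraMap A (ch L I a))) ^ j) :
    ∃ n, ∃ z ∈ I ^ n * J ^ j, (w : L) = algebraMap A L z * (algebraMap A L a)⁻¹ ^ n := by
  have haL : algebraMap A L a ≠ 0 := by simpa using ha0
  rw [← Ideal.map_pow] at hw
  refine Submodule.span_induction ?_ ?_ ?_ ?_ hw
  · rintro _ ⟨y, hy, rfl⟩
    refine ⟨0, y, by simpa using hy, ?_⟩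
    rw [pow_zero, mul_one]; rfl
  · exact ⟨0, 0, zero_mem _, by simp⟩
  · rintro x y _ _ ⟨n, z, hz, e⟩ ⟨m, w, hw, e'⟩
    refine ⟨n + m, z * a ^ m + a ^ n * w, ?_, ?_⟩
    · refine add_mem ?_ ?_
      · have := IJ_mul I J n j m 0 z (a ^ m) hz (by simpa using Ideal.pow_mem_pow ha m)
        simpa using this
      · have := IJ_mul I J n 0 m j (a ^ n) w (by simpa using Ideal.pow_mem_pow ha n) hw
        simpa using this
    · change (x : L) + y = _
      rw [e, e']
      simp only [map_add, map_mul, map_pow]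
      have e : ∀ k : ℕ, algebraMap A L a ^ k * (algebraMap A L a)⁻¹ ^ k = 1 := fun k => by
        rw [← mul_pow, mul_inv_cancel₀ haL, one_pow]
      rw [pow_add]
      linear_combination (-(algebraMap A L z * (algebraMap A L a)⁻¹ ^ n)) * e m - (algebraMap A L w * (algebraMap A L a)⁻¹ ^ m) * e n
  · rintro s x _ ⟨n, z, hz, e⟩
    obtain ⟨m, w, hw, e'⟩ := ch_exists I a ha ha0 s.1 s.2
    refine ⟨m + n, w * z, ?_, ?_⟩
    · have := IJ_mul I J m 0 n j w z (by simpa using hw) hz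
      simpa using this
    · change (s : L) * x = _
      rw [e, e', map_mul]; ring

lemma map_ch_mem {L : Type*} [Field L] [Algebra A L] (a : A) (n j : ℕ)
    (z : A) (hz : z ∈ I ^ n * J ^ j) :
    ∃ w ∈ (J.map (algebraMap A (ch L I a))) ^ j, (w : L) = algebraMap A L z * (algebraMap A L a)⁻¹ ^ n := by
  refine Submodule.mul_induction_on hz ?_ ?_
  · intro x hx y hy
    refine ⟨⟨_, ch_mem I a n x hx⟩ * algebraMap A _ y, ?_, ?_⟩
    · rw [← Ideal.map_pow]
      exact Ideal.mul_mem_left _ _ (Ideal.mem_map_of_mem _ hy)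
    · change (algebraMap A L x * (algebraMap A L a)⁻¹ ^ n) * algebraMap A L y = _
      rw [map_mul]; ring
  · rintro x y ⟨w, hw, e⟩ ⟨w', hw', e'⟩
    refine ⟨w + w', add_mem hw hw', ?_⟩
    change (w : L) + w' = _
    rw [e, e', map_add, add_mul]

theorem RR_chart {L : Type u} [Field L] [Algebra A L] [FaithfulSMul A L] (a : A) (ha : a ∈ I ^ 1 * J ^ 0) (ha0 : a ≠ 0) :
    ∃ j : RR I J →+* Polynomial (reesAlgebra (J.map (algebraMap A (ch L I a)))), Function.Injective j ∧
      j (bm I J 1 0 a ha) = X ∧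
      (∀ y, ∃ (n : ℕ) (r : RR I J), j (bm I J 1 0 a ha) ^ n * y = j r) := by
  have haL : algebraMap A L a ≠ 0 := by simpa using ha0
  have haI : a ∈ I := by simpa using ha
  set S := ch L I a with hS
  have hSL : Function.Injective (algebraMap S L) := Subtype.val_injective
  have H1 : ∀ n, ∀ q : A[X], (∀ j, q.coeff j ∈ I ^ n * J ^ j) → ∃ y : reesAlgebra (J.map (algebraMap A S)),
      (y : S[X]).map (algebraMap S L) = q.map (algebraMap A L) * C (algebraMap A L a)⁻¹ ^ n := by
    intro n q hq
    choose w hw e using fun j => map_ch_mem (L := L) (I := I) (J := J) a n j (q.coeff j) (hq j)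
    refine ⟨⟨∑ j ∈ Finset.range (q.natDegree + 1), monomial j (w j), sum_mem fun j _ => reesAlgebra.monomial_mem.mpr (hw j)⟩, ?_⟩
    change (∑ j ∈ Finset.range (q.natDegree + 1), monomial j (w j)).map (algebraMap S L) = q.map (algebraMap A L) * _
    rw [← C_pow, Polynomial.map_sum]
    conv_rhs => rw [q.as_sum_range, Polynomial.map_sum, Finset.sum_mul]
    refine Finset.sum_congr rfl fun j _ => ?_
    rw [map_monomial, map_monomial, monomial_mul_C]
    congr 1
    exact e j
  have H2 : ∀ y : reesAlgebra (J.map (algebraMap A S)), ∃ n, ∃ q : A[X], (∀ j, q.coeff j ∈ I ^ n * J ^ j) ∧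
      (y : S[X]).map (algebraMap S L) = q.map (algebraMap A L) * C (algebraMap A L a)⁻¹ ^ n := by
    intro y
    have hy := y.2
    rw [mem_reesAlgebra_iff] at hy
    generalize (y : S[X]) = y at hy ⊢
    rw [y.as_sum_range]
    refine Finset.sum_induction _ (fun y : S[X] => ∃ n, ∃ q : A[X], (∀ j, q.coeff j ∈ I ^ n * J ^ j) ∧ y.map (algebraMap S L) = q.map (algebraMap A L) * C (algebraMap A L a)⁻¹ ^ n) ?_ ?_ ?_
    · rintro x y ⟨n, z, hz, e⟩ ⟨m, w, hw, e'⟩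
      refine ⟨n + m, z * C (a ^ m) + C (a ^ n) * w, ?_, ?_⟩
      · intro j
        rw [coeff_add, coeff_mul_C, coeff_C_mul]
        refine add_mem ?_ ?_
        · have := IJ_mul I J n j m 0 (z.coeff j) (a ^ m) (hz j) (by simpa using Ideal.pow_mem_pow haI m)
          simpa using this
        · have := IJ_mul I J n 0 m j (a ^ n) (w.coeff j) (by simpa using Ideal.pow_mem_pow haI n) (hw j)
          simpa using this
      · rw [Polynomial.map_add, e, e']
        simp only [Polynomial.map_add, Polynomial.map_mul, C_pow, Polynomial.map_pow, map_C]
        have e : ∀ k : ℕ, C (algebraMap A L a) ^ k * C (algebraMap A L a)⁻¹ ^ k = 1 := fun k => by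
          rw [← mul_pow, ← C_mul, mul_inv_cancel₀ haL, C_1, one_pow]
        rw [pow_add]
        linear_combination (-(z.map (algebraMap A L) * C (algebraMap A L a)⁻¹ ^ n)) * e m - (w.map (algebraMap A L) * C (algebraMap A L a)⁻¹ ^ m) * e n
    · exact ⟨0, 0, fun j => by simp, by simp⟩
    · intro j _
      obtain ⟨n, z, hz, e⟩ := map_ch_exists (L := L) (I := I) (J := J) a haI ha0 j (y.coeff j) (hy j)
      refine ⟨n, monomial j z, fun k => ?_, ?_⟩
      · rw [coeff_monomial]
        split_ifs with h
        · subst h; exact hz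
        · exact zero_mem _
      · rw [map_monomial, map_monomial, ← C_pow, monomial_mul_C]
        congr 1
  obtain ⟨j, h1, h2, h3, -⟩ := chart_generic (R := RR I J) (D := A[X]) (Ω := L[X]) (B := reesAlgebra (J.map (algebraMap A S)))
    (mapRingHom (algebraMap A L)) (map_injective _ (FaithfulSMul.algebraMap_injective A L))
    ((mapRingHom (algebraMap S L)).comp (reesAlgebra (J.map (algebraMap A S))).val.toRingHom)
    ((map_injective _ hSL).comp Subtype.val_injective)
    (RR I J).val.toRingHom Subtype.val_injective (fun n => {q | ∀ j, q.coeff j ∈ I ^ n * J ^ j})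
    (fun p => ⟨by rintro ⟨r, rfl⟩; exact r.2, fun h => ⟨⟨p, h⟩, rfl⟩⟩) (fun n j => by rw [coeff_zero]; exact zero_mem _)
    (C a) (C (algebraMap A L a)⁻¹) (by
      rw [coe_mapRingHom, map_C, ← C_mul, mul_inv_cancel₀ haL, C_1]) (bm I J 1 0 a ha)
    (by rw [C_mul_X_eq_monomial, ← monomial_zero_left]; rfl) H1 H2
  exact ⟨j, h1, h2, h3⟩

lemma ext_cm {S : Type*} [CommRing S] [IsDomain S] [IsNoetherianRing S] [Algebra A S] (hinj : Function.Injective (algebraMap A S))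
    (hdim : ringKrullDim S ≤ 2)
    (hR : IsIntegrallyClosed (reesAlgebra (J.map (algebraMap A S))))
    (b b' : A) (hb : b ∈ J) (hb' : b' ∈ J) (hb0 : b ≠ 0) (hb0' : b' ≠ 0)
    (h2 : ∀ x ∈ J ^ 2, ∃ y ∈ J, ∃ z ∈ J, x = b * y + b' * z) :
    IsCohenMacaulayRing (reesAlgebra (J.map (algebraMap A S))) := by
  refine T_main hdim hR (algebraMap A S b) (algebraMap A S b')
    (Ideal.mem_map_of_mem _ hb) (Ideal.mem_map_of_mem _ hb') (by rwa [Ne, map_eq_zero_iff _ hinj])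
    (by rwa [Ne, map_eq_zero_iff _ hinj]) ?_
  intro x hx
  rw [← Ideal.map_pow] at hx
  refine Submodule.span_induction ?_ ?_ ?_ ?_ hx
  · rintro _ ⟨y, hy, rfl⟩
    obtain ⟨z, hz, w, hw, rfl⟩ := h2 y hy
    exact ⟨_, Ideal.mem_map_of_mem _ hz, _, Ideal.mem_map_of_mem _ hw, by simp⟩
  · exact ⟨0, zero_mem _, 0, zero_mem _, by simp⟩
  · rintro _ _ _ _ ⟨y1, h1, z1, h3, rfl⟩ ⟨y2, h4, z2, h5, rfl⟩
    exact ⟨y1 + y2, add_mem h1 h4, z1 + z2, add_mem h3 h5, by ring⟩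
  · rintro s _ _ ⟨y1, h1, z1, h3, rfl⟩
    exact ⟨s * y1, Ideal.mul_mem_left _ _ h1, s * z1, Ideal.mul_mem_left _ _ h3, by rw [smul_eq_mul]; ring⟩

/-- the target of the first chart is CM -/
theorem RR_chart_cm [IsNoetherianRing A] (hdim : ringKrullDim A ≤ 2) (hR : IsIntegrallyClosed (RR I J))
    (a : A) (ha : a ∈ I ^ 1 * J ^ 0) (ha0 : a ≠ 0) (b b' : A) (hb : b ∈ J) (hb' : b' ∈ J) (hb0 : b ≠ 0) (hb0' : b' ≠ 0)
    (h2 : ∀ x ∈ J ^ 2, ∃ y ∈ J, ∃ z ∈ J, x = b * y + b' * z) :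
    ∃ (B : Type u) (_ : CommRing B) (j : RR I J →+* B), IsCohenMacaulayRing B ∧ Function.Injective j ∧
      (∀ y, ∃ (n : ℕ) (r : RR I J), j (bm I J 1 0 a ha) ^ n * y = j r) := by
  obtain ⟨j, h1, hX, h3⟩ := RR_chart (L := FractionRing A) (J := J) a ha ha0
  have := noeth_of_fg (ch (FractionRing A) I a) (ch_fg I a)
  have hinj : Function.Injective (algebraMap A (ch (FractionRing A) I a)) := FaithfulSMul.algebraMap_injective A _
  have hd := (dim_fg (ch (FractionRing A) I a) (ch_fg I a)).trans hdim
  have hn := chart_normal hR j h1 _ hX h3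
  have hc := cm_poly (ext_cm hinj hd hn b b' hb hb' hb0 hb0' h2)
  exact ⟨Polynomial (reesAlgebra (J.map (algebraMap A (ch (FractionRing A) I a)))), inferInstance, j, hc, h1, h3⟩

theorem RR_cm10 [IsNoetherianRing A] (hdim : ringKrullDim A ≤ 2) (hR : IsIntegrallyClosed (RR I J))
    (a : A) (ha : a ∈ I ^ 1 * J ^ 0) (ha0 : a ≠ 0) (b b' : A) (hb : b ∈ J) (hb' : b' ∈ J) (hb0 : b ≠ 0) (hb0' : b' ≠ 0)
    (h2 : ∀ x ∈ J ^ 2, ∃ y ∈ J, ∃ z ∈ J, x = b * y + b' * z)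
    (P : Ideal (RR I J)) [P.IsPrime] (hP : bm I J 1 0 a ha ∉ P) :
    IsCohenMacaulayLocalRing (Localization.AtPrime P) := by
  obtain ⟨B, _, j, h1, h3, h4⟩ := RR_chart_cm hdim hR a ha ha0 b b' hb hb' hb0 hb0' h2
  exact cm_chart j h3 _ h4 h1 P hP

lemma normal_equiv {R S : Type*} [CommRing R] [CommRing S] [IsDomain R] [IsDomain S] (e : R ≃+* S) (h : IsIntegrallyClosed R) :
    IsIntegrallyClosed S :=
  normal_retract h e.symm.toRingHom e.toRingHom (fun s => e.apply_symm_apply s)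

theorem RR_cm01 [IsNoetherianRing A] (hdim : ringKrullDim A ≤ 2) (hR : IsIntegrallyClosed (RR I J))
    (a : A) (ha : a ∈ I ^ 0 * J ^ 1) (ha0 : a ≠ 0) (b b' : A) (hb : b ∈ I) (hb' : b' ∈ I) (hb0 : b ≠ 0) (hb0' : b' ≠ 0)
    (h2 : ∀ x ∈ I ^ 2, ∃ y ∈ I, ∃ z ∈ I, x = b * y + b' * z)
    (P : Ideal (RR I J)) [P.IsPrime] (hP : bm I J 0 1 a ha ∉ P) :
    IsCohenMacaulayLocalRing (Localization.AtPrime P) := by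
  obtain ⟨e, he⟩ := RR_swap I J
  obtain ⟨B, _, j, h1, h3, h4⟩ := RR_chart_cm (I := J) (J := I) hdim (normal_equiv e hR) a (by rwa [mul_comm]) ha0 b b' hb hb' hb0 hb0' h2
  refine cm_chart (j.comp e.toRingHom) (h3.comp e.injective) _ ?_ h1 P hP
  intro y
  obtain ⟨n, r, h⟩ := h4 y
  refine ⟨n, e.symm r, ?_⟩
  change j (e _) ^ n * y = j (e (e.symm r))
  rw [he, h, e.apply_symm_apply]

theorem RR_cm00 [IsNoetherianRing A] [IsIntegrallyClosed A] (hdim : ringKrullDim A ≤ 2)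
    (f : A) (hf : f ∈ I) (hf' : f ∈ J) 
    (P : Ideal (RR I J)) [P.IsPrime] (hP : bm I J 0 0 f (by simp) ∉ P) :
    IsCohenMacaulayLocalRing (Localization.AtPrime P) := by
  refine cm_chart (RR I J).val.toRingHom Subtype.val_injective (bm I J 0 0 f (by simp)) ?_
    (cm_poly (cm_poly (normal_cm hdim))) P hP
  intro y
  suffices h : ∃ n : ℕ, ∀ i j, (((C (C f) : Polynomial A[X]) ^ n * y).coeff i).coeff j ∈ I ^ i * J ^ j by
    obtain ⟨n, h⟩ := h
    refine ⟨n, ⟨_, h⟩, ?_⟩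
    change (monomial 0 (monomial 0 f) : Polynomial A[X]) ^ n * y = _
    rw [monomial_zero_left, monomial_zero_left]; rfl
  have e : ∀ n (y : Polynomial A[X]) i j, (((C (C f) : Polynomial A[X]) ^ n * y).coeff i).coeff j = f ^ n * (y.coeff i).coeff j := by
    intro n y i j
    rw [← C_pow, ← C_pow, coeff_C_mul, coeff_C_mul]
  simp only [e]
  rw [y.as_sum_range]
  refine Finset.sum_induction _ (fun y : Polynomial A[X] => ∃ n : ℕ, ∀ i j, f ^ n * (y.coeff i).coeff j ∈ I ^ i * J ^ j) ?_ ?_ ?_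
  · rintro x y ⟨n, h⟩ ⟨m, h'⟩
    refine ⟨n + m, fun i j => ?_⟩
    rw [coeff_add, coeff_add, mul_add, pow_add]
    refine add_mem ?_ ?_
    · rw [mul_comm (f ^ n), mul_assoc]; exact Ideal.mul_mem_left _ _ (h i j)
    · rw [mul_assoc]; exact Ideal.mul_mem_left _ _ (h' i j)
  · exact ⟨0, fun i j => by simp⟩
  · intro i _
    refine ⟨i + (y.coeff i).natDegree, fun i' j => ?_⟩
    rw [coeff_monomial]
    split_ifs with h
    · subst h
      by_cases hj : j ≤ (y.coeff i).natDegree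
      · refine Ideal.mul_mem_right _ _ ?_
        rw [pow_add]
        exact Ideal.mul_mem_mul (Ideal.pow_mem_pow hf i) (Ideal.pow_le_pow_right hj (Ideal.pow_mem_pow hf' _))
      · have h0 : (y.coeff i).coeff j = 0 := coeff_eq_zero_of_natDegree_lt (by omega)
        rw [h0, mul_zero]; exact zero_mem _
    · rw [coeff_zero, mul_zero]; exact zero_mem _

end Charts
end MR

end Part12

section Part13
open RingTheory.Sequence IsLocalRing Polynomial

namespace MR

section PC
variable {A : Type*} [CommRing A] {I J : Ideal A}

/-- graded piece of an ideal -/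
noncomputable def pc (Q : Ideal (RR I J)) (i j : ℕ) : Ideal A where
  carrier := {z | ∃ h : z ∈ I ^ i * J ^ j, bm I J i j z h ∈ Q}
  add_mem' := by
    rintro x y ⟨h, hx⟩ ⟨h', hy⟩
    refine ⟨add_mem h h', ?_⟩
    rw [← bm_add i j x y _ h h' (add_mem h h') rfl]; exact add_mem hx hy
  zero_mem' := ⟨zero_mem _, by rw [bm_zero i j 0 _ rfl]; exact zero_mem _⟩
  smul_mem' := by
    rintro c x ⟨h, hx⟩
    refine ⟨Ideal.mul_mem_left _ _ h, ?_⟩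
    have := Ideal.mul_mem_left Q (bm I J 0 0 c (by simp)) hx
    rwa [bm_mul 0 0 i j i j c x (c • x) _ _ (Ideal.mul_mem_left _ _ h) (by ring) (by ring) rfl] at this

variable (Q : Ideal (RR I J))

lemma pc_iff (i j : ℕ) (z : A) (h : z ∈ I ^ i * J ^ j) : z ∈ pc Q i j ↔ bm I J i j z h ∈ Q :=
  ⟨fun ⟨_, h⟩ => h, fun h' => ⟨h, h'⟩⟩

lemma pc_mul (i j i' j' m n : ℕ) (z w : A) (hz : z ∈ pc Q i j) (hw : w ∈ I ^ i' * J ^ j') (hm : i + i' = m) (hn : j + j' = n) :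
    z * w ∈ pc Q m n := by
  obtain ⟨h, hz⟩ := hz
  subst hm hn
  have h2 := IJ_mul I J _ _ _ _ _ _ h hw
  refine ⟨h2, ?_⟩
  have := Ideal.mul_mem_right (bm I J i' j' w hw) Q hz
  rwa [bm_mul i j i' j' _ _ z w _ h hw h2 rfl rfl rfl] at this

lemma pc_RR (x : RR I J) (h : ∀ i j, bc x i j ∈ pc Q i j) : x ∈ Q :=
  RR_mem Q x fun i j => (pc_iff Q i j _ _).mp (h i j)

lemma pc_mul_le (i j i' j' m n : ℕ) (𝔞 : Ideal A) (h : 𝔞 ≤ pc Q i j) (hm : i + i' = m) (hn : j + j' = n) :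
    𝔞 * (I ^ i' * J ^ j') ≤ pc Q m n := by
  rw [Ideal.mul_le]
  intro r hr s hs
  exact pc_mul Q i j i' j' m n r s (h hr) hs hm hn

lemma m10 {a : A} (h : a ∈ I) : a ∈ I ^ 1 * J ^ 0 := by simpa using h
lemma m01 {a : A} (h : a ∈ J) : a ∈ I ^ 0 * J ^ 1 := by simpa using h
lemma m00 {a : A} : a ∈ I ^ 0 * J ^ 0 := by simp

lemma pc_prime [hQ : Q.IsPrime] (i j i' j' m n : ℕ) (z w : A) (hz : z ∈ I ^ i * J ^ j) (hw : w ∈ I ^ i' * J ^ j')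
   (hm : i + i' = m) (hn : j + j' = n) (h : z * w ∈ pc Q m n) : z ∈ pc Q i j ∨ w ∈ pc Q i' j' := by
  obtain ⟨h1, h⟩ := h
  rw [← bm_mul i j i' j' m n z w _ hz hw h1 hm hn rfl] at h
  rcases hQ.mem_or_mem h with h | h
  · exact Or.inl ⟨_, h⟩
  · exact Or.inr ⟨_, h⟩

lemma pc_prime_pow [hQ : Q.IsPrime] (i j n : ℕ) (z : A) (hz : z ∈ I ^ i * J ^ j) 
   (h : z ^ n ∈ pc Q (n * i) (n * j)) : z ∈ pc Q i j := by
  induction n with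
  | zero =>
    exfalso
    simp only [zero_mul, pow_zero] at h
    obtain ⟨h1, h⟩ := h
    apply hQ.ne_top
    rw [Ideal.eq_top_iff_one]
    convert h using 1
    exact bc_ext fun i j => by
      rw [bc_bm]
      change ((1 : Polynomial A[X]).coeff i).coeff j = _
      rw [coeff_one]
      split_ifs with h1 h2 h2
      · simp [h2.2.symm]
      · rw [coeff_one, if_neg (by omega)]
      · omega
      · simp
  | succ n ih =>
    rw [pow_succ] at h
    rcases pc_prime Q (n * i) (n * j) i j _ _ (z ^ n) z (by
      have := Ideal.pow_mem_pow hz n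
      rwa [mul_pow, ← pow_mul, ← pow_mul, mul_comm i, mul_comm j] at this) hz (by ring) (by ring) h with h | h
    · exact ih h
    · exact h

lemma pc_int1 [hQ : Q.IsPrime] (a a' : A) (ha : a ∈ pc Q 1 0) (ha' : a' ∈ pc Q 1 0) (x : A) (hx : x ∈ I)
    (h : IsIntegralOverIdeal (Ideal.span {a, a'}) x) : x ∈ pc Q 1 0 := by
  obtain ⟨n, hn, c, hc, e⟩ := h
  refine pc_prime_pow Q 1 0 n x (m10 hx) ?_
  rw [mul_one, mul_zero, eq_neg_of_add_eq_zero_left e]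
  refine neg_mem (sum_mem fun i hi => ?_)
  rw [Finset.mem_Icc] at hi
  have h1 : Ideal.span {a, a'} ≤ pc Q 1 0 := by
    rw [Ideal.span_le]; rintro y (rfl | rfl); exacts [ha, ha']
  have h1' : Ideal.span {a, a'} ≤ I := fun y hy => by
    obtain ⟨h, -⟩ := h1 hy; simpa using h
  have h2 := pc_mul_le Q 1 0 (n - 1) 0 n 0 _ h1 (by omega) rfl
  refine h2 ?_
  have h3 : c i ∈ Ideal.span {a, a'} * I ^ (i - 1) := by
    have := hc i hi.1 hi.2
    obtain ⟨k, rfl⟩ : ∃ k, i = k + 1 := ⟨i - 1, by omega⟩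
    rw [pow_succ'] at this
    exact Ideal.mul_mono_right (Ideal.pow_right_mono h1' _) this
  have := Ideal.mul_mem_mul h3 (Ideal.pow_mem_pow hx (n - i))
  rw [mul_assoc, ← pow_add, show i - 1 + (n - i) = n - 1 by omega] at this
  simpa using this

lemma pc_int2 [hQ : Q.IsPrime] (a a' : A) (ha : a ∈ pc Q 0 1) (ha' : a' ∈ pc Q 0 1) (x : A) (hx : x ∈ J)
    (h : IsIntegralOverIdeal (Ideal.span {a, a'}) x) : x ∈ pc Q 0 1 := by
  obtain ⟨n, hn, c, hc, e⟩ := h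
  refine pc_prime_pow Q 0 1 n x (m01 hx) ?_
  rw [mul_one, mul_zero, eq_neg_of_add_eq_zero_left e]
  refine neg_mem (sum_mem fun i hi => ?_)
  rw [Finset.mem_Icc] at hi
  have h1 : Ideal.span {a, a'} ≤ pc Q 0 1 := by
    rw [Ideal.span_le]; rintro y (rfl | rfl); exacts [ha, ha']
  have h1' : Ideal.span {a, a'} ≤ J := fun y hy => by
    obtain ⟨h, -⟩ := h1 hy; simpa using h
  have h2 := pc_mul_le Q 0 1 0 (n - 1) 0 n _ h1 rfl (by omega)
  refine h2 ?_
  have h3 : c i ∈ Ideal.span {a, a'} * J ^ (i - 1) := by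
    have := hc i hi.1 hi.2
    obtain ⟨k, rfl⟩ : ∃ k, i = k + 1 := ⟨i - 1, by omega⟩
    rw [pow_succ'] at this
    exact Ideal.mul_mono_right (Ideal.pow_right_mono h1' _) this
  have := Ideal.mul_mem_mul h3 (Ideal.pow_mem_pow hx (n - i))
  rw [mul_assoc, ← pow_add, show i - 1 + (n - i) = n - 1 by omega] at this
  simpa using this

/-- the element `θ` -/
noncomputable def th (a' b γ : A) (ha' : a' ∈ I) (hb : b ∈ J) : RR I J :=
  bm I J 1 0 a' (m10 ha') + bm I J 0 1 b (m01 hb) + bm I J 0 0 γ m00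


lemma rad [hQ : Q.IsPrime] (a a' b b' β : A) (ha : a ∈ I) (ha' : a' ∈ I) (hb : b ∈ J) (hb' : b' ∈ J)
    (hI : ∀ x ∈ I, IsIntegralOverIdeal (Ideal.span {a, a'}) x)
    (hJ : ∀ x ∈ J, IsIntegralOverIdeal (Ideal.span {b', b}) x)
    (M : ℕ) (hM : ∀ x ∈ I ^ (M + 1) * J ^ (M + 1), ∃ y ∈ I ^ M * J ^ (M + 1), ∃ z ∈ I ^ (M + 1) * J ^ M, x = a * y + b' * z)
    (h1 : bm I J 1 0 a (m10 ha) ∈ Q) (h2 : bm I J 0 1 b' (m01 hb') ∈ Q)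
    (h3 : th a' b (a * b' * β) ha' hb ∈ Q) :
    I ≤ pc Q 1 0 ∧ J ≤ pc Q 0 1 ∧ a * b' * β ∈ pc Q 0 0 := by
  rw [← pc_iff] at h1 h2
  have hK : ∀ x ∈ I, ∀ y ∈ J, x ∈ pc Q 1 0 ∨ y ∈ pc Q 0 1 := by
    intro x hx y hy
    refine pc_prime Q 1 0 0 1 1 1 x y (m10 hx) (m01 hy) rfl rfl ?_
    refine pc_prime_pow Q 1 1 (M + 1) (x * y) (by simpa using Ideal.mul_mem_mul hx hy) ?_
    rw [mul_one]
    obtain ⟨u, hu, w, hw, e⟩ := hM ((x * y) ^ (M + 1)) (by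
      rw [mul_pow]; exact Ideal.mul_mem_mul (Ideal.pow_mem_pow hx _) (Ideal.pow_mem_pow hy _))
    rw [e]
    refine add_mem ?_ ?_
    · exact pc_mul Q 1 0 M (M + 1) _ _ a u h1 hu (by ring) (by ring)
    · exact pc_mul Q 0 1 (M + 1) M _ _ b' w h2 hw (by ring) (by ring)
  have hK' : I ≤ pc Q 1 0 ∨ J ≤ pc Q 0 1 := by
    by_contra h
    push Not at h
    obtain ⟨x, hx, hx'⟩ := SetLike.not_le_iff_exists.mp h.1
    obtain ⟨y, hy, hy'⟩ := SetLike.not_le_iff_exists.mp h.2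
    exact (hK x hx y hy).elim hx' hy'
  rcases hK' with h | h
  · have e1 : bm I J 0 1 b (m01 hb) + bm I J 0 0 (a * b' * β) m00 ∈ Q := by
      have := sub_mem h3 ((pc_iff Q 1 0 a' (m10 ha')).mp (h ha'))
      rw [th] at this
      convert this using 1; ring
    have e2 : a * b' * β ∈ pc Q 0 0 := by
      have e4 : b' * (a * b' * β) ∈ pc Q 0 0 := by
        rw [pc_iff Q 0 0 _ m00]
        have e5 := Ideal.mul_mem_left Q (bm I J 0 0 b' m00) e1
        rw [mul_add, bm_mul 0 0 0 1 0 1 b' b _ m00 (m01 hb) (m01 (Ideal.mul_mem_left _ _ hb)) rfl rfl rfl,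
          bm_mul 0 0 0 0 0 0 b' _ _ m00 m00 m00 rfl rfl rfl] at e5
        refine (Ideal.add_mem_iff_right _ ?_).mp e5
        rw [← pc_iff]
        exact Ideal.mul_mem_right _ _ h2
      rcases pc_prime Q 0 0 0 0 0 0 b' _ m00 m00 rfl rfl e4 with h | h
      · rw [show a * b' * β = a * β * b' by ring]; exact Ideal.mul_mem_left _ _ h
      · exact h
    have e3 : b ∈ pc Q 0 1 := by
      rw [pc_iff Q 0 1 _ (m01 hb)]
      exact (Ideal.add_mem_iff_left _ ((pc_iff Q 0 0 _ m00).mp e2)).mp e1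
    exact ⟨h, fun x hx => pc_int2 Q b' b h2 e3 x hx (hJ x hx), e2⟩
  · have e1 : bm I J 1 0 a' (m10 ha') + bm I J 0 0 (a * b' * β) m00 ∈ Q := by
      have := sub_mem h3 ((pc_iff Q 0 1 b (m01 hb)).mp (h hb))
      rw [th] at this
      convert this using 1; ring
    have e2 : a * b' * β ∈ pc Q 0 0 := by
      have e4 : a * (a * b' * β) ∈ pc Q 0 0 := by
        rw [pc_iff Q 0 0 _ m00]
        have e5 := Ideal.mul_mem_left Q (bm I J 0 0 a m00) e1
        rw [mul_add, bm_mul 0 0 1 0 1 0 a a' _ m00 (m10 ha') (m10 (Ideal.mul_mem_left _ _ ha')) rfl rfl rfl,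
          bm_mul 0 0 0 0 0 0 a _ _ m00 m00 m00 rfl rfl rfl] at e5
        refine (Ideal.add_mem_iff_right _ ?_).mp e5
        rw [← pc_iff]
        exact Ideal.mul_mem_right _ _ h1
      rcases pc_prime Q 0 0 0 0 0 0 a _ m00 m00 rfl rfl e4 with h | h
      · rw [show a * b' * β = b' * β * a by ring]; exact Ideal.mul_mem_left _ _ h
      · exact h
    have e3 : a' ∈ pc Q 1 0 := by
      rw [pc_iff Q 1 0 _ (m10 ha')]
      exact (Ideal.add_mem_iff_left _ ((pc_iff Q 0 0 _ m00).mp e2)).mp e1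
    exact ⟨fun x hx => pc_int1 Q a a' h1 e3 x hx (hI x hx), h, e2⟩

lemma pc_00_prime [hQ : Q.IsPrime] : (pc Q 0 0).IsPrime := by
  refine ⟨fun h => ?_, fun {x y} h => pc_prime Q 0 0 0 0 0 0 x y m00 m00 rfl rfl h⟩
  have h1 : (1 : A) ∈ pc Q 0 0 := by rw [h]; trivial
  have := pc_prime_pow Q 0 0 0 0 m00 (by simpa using h1)
  apply hQ.ne_top
  rw [Ideal.eq_top_iff_one]
  refine pc_RR Q 1 fun i j => ?_
  have h2 := pc_mul Q 0 0 i j i j 1 (bc (1 : RR I J) i j) h1 (bc_mem _ _ _) (by ring) (by ring)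
  rwa [one_mul] at h2

lemma mem_of_pc (hI : I ≤ pc Q 1 0) (hJ : J ≤ pc Q 0 1) (x : RR I J)
    (h0 : bc x 0 0 ∈ pc Q 0 0) : x ∈ Q := by
  refine pc_RR Q x fun i j => ?_
  rcases i with _ | i
  · rcases j with _ | j
    · exact h0
    · refine pc_mul_le Q 0 1 0 j 0 (j + 1) J hJ rfl (by ring) ?_
      have := bc_mem x 0 (j + 1)
      rwa [pow_succ', mul_left_comm] at this
  · refine pc_mul_le Q 1 0 i j (i + 1) j I hI (by ring) (by ring) ?_
    have := bc_mem x (i + 1) j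
    rwa [pow_succ', mul_assoc] at this

lemma le_of_pc (P : Ideal (RR I J)) (hI : I ≤ pc Q 1 0) (hJ : J ≤ pc Q 0 1)
    (h0 : ∀ x ∈ P, bc x 0 0 ∈ pc Q 0 0) : P ≤ Q := fun x hx => mem_of_pc Q hI hJ x (h0 x hx)

end PC
end MR

end Part13

section Part14
open RingTheory.Sequence IsLocalRing Polynomial

namespace MR

section De
variable {A : Type*} [CommRing A] [IsDomain A] [IsNoetherianRing A] [IsIntegrallyClosed A] {I J : Ideal A}

lemma mixed (a b' : A) (hK : ∀ x ∈ I * J, ∃ y ∈ J, ∃ z ∈ I, x = a * y + b' * z) (i j : ℕ) :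
    ∀ x ∈ I ^ (i + 1) * J ^ (j + 1), ∃ y ∈ I ^ i * J ^ (j + 1), ∃ z ∈ I ^ (i + 1) * J ^ j, x = a * y + b' * z := by
  intro x hx
  rw [show I ^ (i + 1) * J ^ (j + 1) = (I ^ i * J ^ j) * (I * J) by rw [pow_succ, pow_succ]; ring] at hx
  refine Submodule.mul_induction_on hx ?_ ?_
  · intro u hu w hw
    obtain ⟨y, hy, z, hz, rfl⟩ := hK w hw
    refine ⟨u * y, ?_, u * z, ?_, by ring⟩
    · have := Ideal.mul_mem_mul hu hy
      rwa [mul_assoc, ← pow_succ] at this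
    · have := Ideal.mul_mem_mul hu hz
      rwa [mul_right_comm, ← pow_succ] at this
  · rintro x y ⟨y1, h1, z1, h3, rfl⟩ ⟨y2, h4, z2, h5, rfl⟩
    exact ⟨y1 + y2, add_mem h1 h4, z1 + z2, add_mem h3 h5, by ring⟩

lemma mixed_pc (a b' : A) (hK : ∀ x ∈ I * J, ∃ y ∈ J, ∃ z ∈ I, x = a * y + b' * z) (i j : ℕ)
    (Q : Ideal (RR I J)) (ha : a ∈ pc Q 1 0) (hb' : b' ∈ pc Q 0 1) :
    I ^ (i + 1) * J ^ (j + 1) ≤ pc Q (i + 1) (j + 1) := by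
  intro x hx
  obtain ⟨y, hy, z, hz, rfl⟩ := mixed a b' hK i j x hx
  exact add_mem (pc_mul Q 1 0 i (j + 1) _ _ a y ha hy (by ring) (by ring))
    (pc_mul Q 0 1 (i + 1) j _ _ b' z hb' hz (by ring) (by ring))

lemma delta2 (hcl : ∀ i j, IdealIsIntegrallyClosed (I ^ i * J ^ j)) (a b' : A) (ha : a ∈ I) (hb' : b' ∈ J)
    (ha0 : a ≠ 0) (hb0' : b' ≠ 0)
    (hK : ∀ x ∈ I * J, ∃ y ∈ J, ∃ z ∈ I, x = a * y + b' * z) (x : RR I J)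
    (h : bm I J 0 1 b' (m01 hb') * x ∈ (⊥ : Ideal (RR I J)) ⊔ Ideal.span {bm I J 1 0 a (m10 ha)}) :
    x ∈ (⊥ : Ideal (RR I J)) ⊔ Ideal.span {bm I J 1 0 a (m10 ha)} := by
  rw [bot_sup_eq] at h ⊢
  obtain ⟨y, hy⟩ := Ideal.mem_span_singleton'.mp h
  rw [mul_comm] at hy
  refine pc_RR _ x fun i j => ?_
  cases i with
  | zero =>
    have := congrArg (fun z => bc z 0 (j + 1)) hy
    simp only [bc_10z, bc_01] at this
    rw [(mul_eq_zero.mp this.symm).resolve_left hb0']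
    exact zero_mem _
  | succ i =>
    have e := congrArg (fun z => bc z (i + 1) (j + 1)) hy
    simp only [bc_10, bc_01] at e
    obtain ⟨w, hw, e1⟩ := colon (I ^ i * J ^ j) (I * J) (by
        intro h
        have : a * b' ∈ I * J := Ideal.mul_mem_mul ha hb'
        rw [h] at this
        exact mul_ne_zero ha0 hb0' this) (hcl i j) a (bc x (i + 1) j) ha0 (by
      intro u hu
      obtain ⟨g, hg, f, hf, rfl⟩ := hK u hu
      have e2 : I ^ i * J ^ j * (I * J) = I ^ (i + 1) * J ^ (j + 1) := by rw [pow_succ, pow_succ]; ring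
      refine ⟨bc x (i + 1) j * g + bc y i (j + 1) * f, ?_, by linear_combination -f * e⟩
      rw [e2]
      refine add_mem ?_ ?_
      · have := Ideal.mul_mem_mul (bc_mem x (i + 1) j) hg
        rwa [mul_assoc, ← pow_succ] at this
      · have := Ideal.mul_mem_mul (bc_mem y i (j + 1)) hf
        rwa [mul_right_comm, ← pow_succ] at this)
    rw [e1]
    exact pc_mul _ 1 0 i j _ _ a w ((pc_iff _ 1 0 a (m10 ha)).mpr (Ideal.mem_span_singleton_self _)) hw (by ring) (by ring)

lemma delta3 (hcl : ∀ i j, IdealIsIntegrallyClosed (I ^ i * J ^ j)) (a a' b b' β : A)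
    (ha : a ∈ I) (ha' : a' ∈ I) (hb : b ∈ J) (hb' : b' ∈ J)
    (ha0 : a ≠ 0) (hb0' : b' ≠ 0) (hβ : β ≠ 0)
    (hK : ∀ x ∈ I * J, ∃ y ∈ J, ∃ z ∈ I, x = a * y + b' * z)
    (hI : ∀ x ∈ I ^ 2, ∃ y ∈ I, ∃ z ∈ I, x = a * y + a' * z)
    (hJ : ∀ x ∈ J ^ 2, ∃ y ∈ J, ∃ z ∈ J, x = b' * y + b * z) (x : RR I J)
    (h : th a' b (a * b' * β) ha' hb * x ∈ (⊥ : Ideal (RR I J)) ⊔ Ideal.span {bm I J 1 0 a (m10 ha)} ⊔ Ideal.span {bm I J 0 1 b' (m01 hb')}) :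
    x ∈ (⊥ : Ideal (RR I J)) ⊔ Ideal.span {bm I J 1 0 a (m10 ha)} ⊔ Ideal.span {bm I J 0 1 b' (m01 hb')} := by
  rw [bot_sup_eq] at h ⊢
  set Q := Ideal.span {bm I J 1 0 a (m10 ha)} ⊔ Ideal.span {bm I J 0 1 b' (m01 hb')} with hQ
  have haQ : a ∈ pc Q 1 0 := (pc_iff _ 1 0 a (m10 ha)).mpr ((le_sup_left : _ ≤ Q) (Ideal.mem_span_singleton_self _))
  have hbQ : b' ∈ pc Q 0 1 := (pc_iff _ 0 1 b' (m01 hb')).mpr ((le_sup_right : _ ≤ Q) (Ideal.mem_span_singleton_self _))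
  obtain ⟨y', hy', z', hz', e⟩ := Submodule.mem_sup.mp h
  obtain ⟨y, rfl⟩ := Ideal.mem_span_singleton'.mp hy'
  obtain ⟨z, rfl⟩ := Ideal.mem_span_singleton'.mp hz'
  rw [mul_comm y, mul_comm z, th, add_mul, add_mul] at e
  refine pc_RR _ x fun i j => ?_
  rcases i with _ | i
  · rcases j with _ | j
    · have := congrArg (fun z => bc z 0 0) e
      simp only [bc_add, bc_10z, bc_01z, bc_00, zero_add] at this
      rw [(mul_eq_zero.mp this.symm).resolve_left (mul_ne_zero (mul_ne_zero ha0 hb0') hβ)]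
      exact zero_mem _
    · have e := congrArg (fun z => bc z 0 (j + 1 + 1)) e
      simp only [bc_add, bc_10z, bc_01, bc_00, zero_add] at e
      obtain ⟨w, hw, e1⟩ := colon (I ^ 0 * J ^ j) (J ^ 2) (by
          intro h
          have : b' ^ 2 ∈ J ^ 2 := Ideal.pow_mem_pow hb' 2
          rw [h] at this
          exact pow_ne_zero 2 hb0' this) (hcl 0 j) b' (bc x 0 (j + 1)) hb0' (by
        intro u hu
        obtain ⟨g, hg, f, hf, rfl⟩ := hJ u hu
        have e2 : I ^ 0 * J ^ j * J ^ 2 = I ^ 0 * J ^ (j + 1) * J := by rw [pow_succ]; ring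
        refine ⟨bc x 0 (j + 1) * g + (bc z 0 (j + 1) - a * β * bc x 0 (j + 2)) * f, ?_, by linear_combination -f * e⟩
        rw [e2]
        refine add_mem (Ideal.mul_mem_mul (bc_mem x 0 (j + 1)) hg) (Ideal.mul_mem_mul (sub_mem (bc_mem z 0 (j + 1)) ?_) hf)
        exact Ideal.mul_mem_left _ _ (IJ_anti I J _ _ _ _ le_rfl (by omega) (bc_mem x 0 (j + 2))))
      rw [e1]
      exact pc_mul _ 0 1 0 j _ _ b' w hbQ hw (by ring) (by ring)
  · rcases j with _ | j
    · have e := congrArg (fun z => bc z (i + 1 + 1) 0) e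
      simp only [bc_add, bc_10, bc_01z, bc_00, add_zero] at e
      obtain ⟨w, hw, e1⟩ := colon (I ^ i * J ^ 0) (I ^ 2) (by
          intro h
          have : a ^ 2 ∈ I ^ 2 := Ideal.pow_mem_pow ha 2
          rw [h] at this
          exact pow_ne_zero 2 ha0 this) (hcl i 0) a (bc x (i + 1) 0) ha0 (by
        intro u hu
        obtain ⟨g, hg, f, hf, rfl⟩ := hI u hu
        have e2 : I ^ i * J ^ 0 * I ^ 2 = I ^ (i + 1) * J ^ 0 * I := by rw [pow_succ]; ring
        refine ⟨bc x (i + 1) 0 * g + (bc y (i + 1) 0 - b' * β * bc x (i + 2) 0) * f, ?_, by linear_combination -f * e⟩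
        rw [e2]
        refine add_mem (Ideal.mul_mem_mul (bc_mem x (i + 1) 0) hg) (Ideal.mul_mem_mul (sub_mem (bc_mem y (i + 1) 0) ?_) hf)
        exact Ideal.mul_mem_left _ _ (IJ_anti I J _ _ _ _ (by omega) le_rfl (bc_mem x (i + 2) 0)))
      rw [e1]
      exact pc_mul _ 1 0 i 0 _ _ a w haQ hw (by ring) (by ring)
    · exact mixed_pc a b' hK i j Q haQ hbQ (bc_mem x _ _)


lemma thp2 (a a' b b' β : A) (ha' : a' ∈ I) (hb : b ∈ J)
    (hK : ∀ x ∈ I * J, ∃ y ∈ J, ∃ z ∈ I, x = a * y + b' * z) (Q : Ideal (RR I J)) (haQ : a ∈ pc Q 1 0) (hbQ : b' ∈ pc Q 0 1)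
    (hθ : th a' b (a * b' * β) ha' hb ∈ Q) (j : ℕ) (s : A) (hs' : s ∈ I ^ 0 * J ^ (j + 1)) : b * s ∈ pc Q 0 (j + 2) := by
  have hs2 : s ∈ I ^ 0 * J ^ j := IJ_anti I J _ _ _ _ le_rfl (by omega) hs'
  have h2 := Ideal.mul_mem_right (bm I J 0 (j + 1) s hs') Q hθ
  have h5 : a' * s ∈ I ^ (0 + 1) * J ^ (j + 1) := by
    have := IJ_mul I J 1 0 0 (j + 1) a' s (m10 ha') hs'
    rwa [Nat.zero_add] at this
  have h3 : bm I J 1 0 a' (m10 ha') * bm I J 0 (j + 1) s hs' ∈ Q := by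
    rw [bm_mul 1 0 0 (j + 1) (0 + 1) (j + 1) a' s (a' * s) (m10 ha') hs' h5 rfl (by ring) rfl, ← pc_iff]
    exact mixed_pc a b' hK 0 j Q haQ hbQ h5
  have h4 : bm I J 0 0 (a * b' * β) m00 * bm I J 0 (j + 1) s hs' ∈ Q := by
    rw [bm_mul 0 0 0 (j + 1) 0 (j + 1) (a * b' * β) s (a * b' * β * s) m00 hs' (Ideal.mul_mem_left _ _ hs') rfl (by ring) rfl, ← pc_iff,
      show a * b' * β * s = b' * (a * β * s) by ring]
    exact pc_mul Q 0 1 0 j _ _ b' _ hbQ (Ideal.mul_mem_left _ _ hs2) rfl (by ring)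
  have h6 : b * s ∈ I ^ 0 * J ^ (j + 2) := by
    have := IJ_mul I J 0 1 0 (j + 1) b s (m01 hb) hs'
    rwa [show 1 + (j + 1) = j + 2 by ring] at this
  rw [pc_iff Q _ _ _ h6, ← bm_mul 0 1 0 (j + 1) 0 (j + 2) b s (b * s) (m01 hb) hs' h6 rfl (by ring) rfl]
  rw [th, add_mul, add_mul] at h2
  have := sub_mem (sub_mem h2 h3) h4
  convert this using 1; ring

lemma thp1 (a a' b b' β : A) (ha' : a' ∈ I) (hb : b ∈ J)
    (hK : ∀ x ∈ I * J, ∃ y ∈ J, ∃ z ∈ I, x = a * y + b' * z) (Q : Ideal (RR I J)) (haQ : a ∈ pc Q 1 0) (hbQ : b' ∈ pc Q 0 1)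
    (hθ : th a' b (a * b' * β) ha' hb ∈ Q) (j : ℕ) (s : A) (hs' : s ∈ I ^ (j + 1) * J ^ 0) : a' * s ∈ pc Q (j + 2) 0 := by
  have hs2 : s ∈ I ^ j * J ^ 0 := IJ_anti I J _ _ _ _ (by omega) le_rfl hs'
  have h2 := Ideal.mul_mem_right (bm I J (j + 1) 0 s hs') Q hθ
  have h5 : b * s ∈ I ^ (j + 1) * J ^ (0 + 1) := by
    have := IJ_mul I J 0 1 (j + 1) 0 b s (m01 hb) hs'
    rwa [Nat.zero_add] at this
  have h3 : bm I J 0 1 b (m01 hb) * bm I J (j + 1) 0 s hs' ∈ Q := by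
    rw [bm_mul 0 1 (j + 1) 0 (j + 1) (0 + 1) b s (b * s) (m01 hb) hs' h5 (by ring) rfl rfl, ← pc_iff]
    exact mixed_pc a b' hK j 0 Q haQ hbQ h5
  have h4 : bm I J 0 0 (a * b' * β) m00 * bm I J (j + 1) 0 s hs' ∈ Q := by
    rw [bm_mul 0 0 (j + 1) 0 (j + 1) 0 (a * b' * β) s (a * b' * β * s) m00 hs' (Ideal.mul_mem_left _ _ hs') (by ring) rfl rfl, ← pc_iff,
      show a * b' * β * s = a * (b' * β * s) by ring]
    exact pc_mul Q 1 0 j 0 _ _ a _ haQ (Ideal.mul_mem_left _ _ hs2) (by ring) rfl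
  have h6 : a' * s ∈ I ^ (j + 2) * J ^ 0 := by
    have := IJ_mul I J 1 0 (j + 1) 0 a' s (m10 ha') hs'
    rwa [show 1 + (j + 1) = j + 2 by ring] at this
  rw [pc_iff Q _ _ _ h6, ← bm_mul 1 0 (j + 1) 0 (j + 2) 0 a' s (a' * s) (m10 ha') hs' h6 (by ring) rfl rfl]
  rw [th, add_mul, add_mul] at h2
  have := sub_mem (sub_mem h2 h3) h4
  convert this using 1; ring

set_option maxHeartbeats 1000000 in
lemma delta4 (a a' b b' β v : A)
    (ha : a ∈ I) (ha' : a' ∈ I) (hb : b ∈ J) (hb' : b' ∈ J)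
    (ha0 : a ≠ 0) (hb0' : b' ≠ 0) (hβ : β ≠ 0)
    (hK : ∀ x ∈ I * J, ∃ y ∈ J, ∃ z ∈ I, x = a * y + b' * z)
    (hI : ∀ x ∈ I ^ 2, ∃ y ∈ I, ∃ z ∈ I, x = a * y + a' * z)
    (hJ : ∀ x ∈ J ^ 2, ∃ y ∈ J, ∃ z ∈ J, x = b' * y + b * z)
    (hv : ∀ u z, v * u = a * b' * β * z → ∃ g, u = a * b' * β * g) (x : RR I J)
    (h : bm I J 0 0 v m00 * x ∈ (⊥ : Ideal (RR I J)) ⊔ Ideal.span {bm I J 1 0 a (m10 ha)} ⊔ Ideal.span {bm I J 0 1 b' (m01 hb')} ⊔ Ideal.span {th a' b (a * b' * β) ha' hb}) :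
    x ∈ (⊥ : Ideal (RR I J)) ⊔ Ideal.span {bm I J 1 0 a (m10 ha)} ⊔ Ideal.span {bm I J 0 1 b' (m01 hb')} ⊔ Ideal.span {th a' b (a * b' * β) ha' hb} := by
  rw [bot_sup_eq] at h ⊢
  set Q := Ideal.span {bm I J 1 0 a (m10 ha)} ⊔ Ideal.span {bm I J 0 1 b' (m01 hb')} ⊔ Ideal.span {th a' b (a * b' * β) ha' hb} with hQ
  have haQ' : bm I J 1 0 a (m10 ha) ∈ Q := (le_sup_left.trans le_sup_left : _ ≤ Q) (Ideal.mem_span_singleton_self _)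
  have hbQ' : bm I J 0 1 b' (m01 hb') ∈ Q := (le_sup_right.trans le_sup_left : _ ≤ Q) (Ideal.mem_span_singleton_self _)
  have haQ : a ∈ pc Q 1 0 := (pc_iff _ 1 0 a (m10 ha)).mpr haQ'
  have hbQ : b' ∈ pc Q 0 1 := (pc_iff _ 0 1 b' (m01 hb')).mpr hbQ'
  have hθ : th a' b (a * b' * β) ha' hb ∈ Q := (le_sup_right : _ ≤ Q) (Ideal.mem_span_singleton_self _)
  obtain ⟨u', hu', w', hw', e⟩ := Submodule.mem_sup.mp h
  obtain ⟨y', hy', z', hz', rfl⟩ := Submodule.mem_sup.mp hu'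
  obtain ⟨y, rfl⟩ := Ideal.mem_span_singleton'.mp hy'
  obtain ⟨z, rfl⟩ := Ideal.mem_span_singleton'.mp hz'
  obtain ⟨w, rfl⟩ := Ideal.mem_span_singleton'.mp hw'
  rw [mul_comm y, mul_comm z, mul_comm w, th, add_mul, add_mul] at e
  have e00 := congrArg (fun z => bc z 0 0) e
  have e10 := congrArg (fun z => bc z (0 + 1) 0) e
  have e01 := congrArg (fun z => bc z 0 (0 + 1)) e
  simp only [bc_add, bc_10, bc_10z, bc_01, bc_01z, bc_00, add_zero, zero_add] at e00 
  simp only [bc_add, bc_10, bc_01z, bc_00, add_zero] at e10 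
  simp only [bc_add, bc_10z, bc_01, bc_00, zero_add] at e01
  obtain ⟨p, hp⟩ := hv _ _ e00.symm
  have hγ0 : a * b' * β ≠ 0 := mul_ne_zero (mul_ne_zero ha0 hb0') hβ
  have hvp : v * p = bc w 0 0 := by
    apply mul_left_cancel₀ hγ0
    linear_combination -e00 - v * hp
  obtain ⟨g, hg⟩ := hv (b' * β * (bc x (0+1) 0 - a' * p)) (bc y 0 0 + b' * β * bc w (0 + 1) 0) (by
    linear_combination -b' * β * e10 - b' * β * a' * hvp)
  replace hg : bc x (0+1) 0 - a' * p = a * g := by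
    apply mul_left_cancel₀ (mul_ne_zero hb0' hβ)
    linear_combination hg
  obtain ⟨g', hg'⟩ := hv (a * β * (bc x 0 (0+1) - b * p)) (bc z 0 0 + a * β * bc w 0 (0 + 1)) (by
    linear_combination -a * β * e01 - a * β * b * hvp)
  replace hg' : bc x 0 (0+1) - b * p = b' * g' := by
    apply mul_left_cancel₀ (mul_ne_zero ha0 hβ)
    linear_combination hg'
  set x' := x - th a' b (a * b' * β) ha' hb * bm I J 0 0 p m00 - bm I J 1 0 a (m10 ha) * bm I J 0 0 g m00
     - bm I J 0 1 b' (m01 hb') * bm I J 0 0 g' m00 with hx'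
  suffices hs : x' ∈ Q by
    have := add_mem (add_mem (add_mem hs (Ideal.mul_mem_right (bm I J 0 0 g' m00) _ hbQ')) (Ideal.mul_mem_right (bm I J 0 0 g m00) _ haQ'))
      (Ideal.mul_mem_right (bm I J 0 0 p m00) _ hθ)
    rw [hx'] at this
    convert this using 1; ring
  refine pc_RR _ x' fun i j => ?_
  rcases i with _ | i
  · rcases j with _ | _ | j
    · have : bc x' 0 0 = 0 := by
        simp only [hx', th, add_mul, bc_sub, bc_add, bc_10z, bc_01z, bc_00, bc_bm, and_self, if_true]
        linear_combination hp
      rw [this]; exact zero_mem _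
    · have : bc x' 0 (0 + 1) = 0 := by
        simp only [hx', th, add_mul, bc_sub, bc_add, bc_10z, bc_01, bc_00, bc_bm, and_self, if_true]
        simp
        linear_combination hg'
      rw [this]; exact zero_mem _
    · obtain ⟨r, hr, s, hs, e⟩ := red_pow b' b hJ j (bc x' 0 (j + 2)) (by simpa using bc_mem x' 0 (j + 2))
      have hr' : r ∈ I ^ 0 * J ^ (j + 1) := by simpa using hr
      have hs' : s ∈ I ^ 0 * J ^ (j + 1) := by simpa using hs
      rw [e]
      refine add_mem (pc_mul Q 0 1 0 (j + 1) _ _ b' r hbQ hr' rfl (by ring)) ?_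
      exact thp2 a a' b b' β ha' hb hK Q haQ hbQ hθ j s hs'
  · rcases j with _ | j
    · rcases i with _ | i
      · have : bc x' (0 + 1) 0 = 0 := by
          simp only [hx', th, add_mul, bc_sub, bc_add, bc_10, bc_01z, bc_00, bc_bm, and_self, if_true]
          simp
          linear_combination hg
        rw [this]; exact zero_mem _
      · obtain ⟨r, hr, s, hs, e⟩ := red_pow a a' hI i (bc x' (i + 2) 0) (by simpa using bc_mem x' (i + 2) 0)
        have hr' : r ∈ I ^ (i + 1) * J ^ 0 := by simpa using hr
        have hs' : s ∈ I ^ (i + 1) * J ^ 0 := by simpa using hs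
        rw [e]
        refine add_mem (pc_mul Q 1 0 (i + 1) 0 _ _ a r haQ hr' (by ring) rfl) ?_
        exact thp1 a a' b b' β ha' hb hK Q haQ hbQ hθ i s hs'
    · exact mixed_pc a b' hK i j Q haQ hbQ (bc_mem x' _ _)

end De
end MR

end Part14

section Part15
open RingTheory.Sequence IsLocalRing Polynomial

namespace MR

section De2
variable {A : Type*} [CommRing A] [IsDomain A] [IsNoetherianRing A] [IsLocalRing A] [IsIntegrallyClosed A] {I J : Ideal A}

lemma m_height (hdim : ringKrullDim A = 2) : (maximalIdeal A).height = 2 := by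
  have := IsLocalRing.maximalIdeal_height_eq_ringKrullDim (R := A)
  rw [hdim] at this
  exact WithBot.coe_injective this

lemma exists_beta (hdim : ringKrullDim A = 2) : ∃ β ∈ maximalIdeal A, β ≠ 0 := by
  apply Submodule.exists_mem_ne_zero_of_ne_bot
  intro h
  have h1 := m_height hdim
  rw [h, Ideal.height_bot] at h1
  exact absurd h1 (by decide)

/-- local version of `normal_depth` -/
lemma exists_v (hdim : ringKrullDim A = 2) (γ : A) (hγ : γ ≠ 0) (hγm : γ ∈ maximalIdeal A) :
    ∃ v ∈ maximalIdeal A, (∀ u z, v * u = γ * z → ∃ g, u = γ * g) ∧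
      (∀ q : Ideal A, q.IsPrime → γ ∈ q → v ∈ q → maximalIdeal A ≤ q) := by
  obtain ⟨v, hv, h⟩ := normal_depth (maximalIdeal A) (m_height hdim).ge γ hγ
  refine ⟨v, hv, ?_, ?_⟩
  · intro u z e
    obtain ⟨s, hs, h'⟩ := h.2.1 u (by
      rw [bot_sup_eq, e]; exact Ideal.mul_mem_right _ _ (Ideal.mem_span_singleton_self _))
    rw [bot_sup_eq, Ideal.mem_span_singleton] at h'
    have hs : IsUnit s := by
      by_contra h; exact hs ((mem_maximalIdeal s).mpr h)
    exact (hs.dvd_mul_left).mp h'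
  · intro q hq h1 h2
    refine locReg_min (maximalIdeal A) [γ, v] h (by rw [m_height hdim]; rfl) q hq (le_maximalIdeal hq.ne_top) ?_
    simp only [List.mem_cons, List.not_mem_nil, or_false, forall_eq_or_imp, forall_eq]
    exact ⟨h1, h2⟩

lemma int_of_sq (I : Ideal A) (a a' : A) (ha : a ∈ I) (ha0 : a ≠ 0) (hI : ∀ x ∈ I ^ 2, ∃ y ∈ I, ∃ z ∈ I, x = a * y + a' * z) :
    ∀ x ∈ I, IsIntegralOverIdeal (Ideal.span {a, a'}) x := by
  intro x hx
  refine int_of_mul _ I (fun h => ha0 (by rwa [h] at ha)) x fun y hy => ?_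
  obtain ⟨u, hu, w, hw, e⟩ := hI (x * y) (by rw [pow_two]; exact Ideal.mul_mem_mul hx hy)
  rw [e]
  exact add_mem (Ideal.mul_mem_mul (Ideal.subset_span (by simp)) hu) (Ideal.mul_mem_mul (Ideal.subset_span (by simp)) hw)

set_option maxHeartbeats 1000000 in
theorem delta_main (hdim : ringKrullDim A = 2) (hIp : ∃ n : ℕ, maximalIdeal A ^ n ≤ I) (hJp : ∃ n : ℕ, maximalIdeal A ^ n ≤ J)
    (hcl : ∀ i j, IdealIsIntegrallyClosed (I ^ i * J ^ j)) (a a' b b' : A)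
    (ha : a ∈ I) (ha' : a' ∈ I) (hb : b ∈ J) (hb' : b' ∈ J)
    (ha0 : a ≠ 0) (ha0' : a' ≠ 0) (hb0 : b ≠ 0) (hb0' : b' ≠ 0)
    (hK : ∀ x ∈ I * J, ∃ y ∈ J, ∃ z ∈ I, x = a * y + b' * z)
    (hI : ∀ x ∈ I ^ 2, ∃ y ∈ I, ∃ z ∈ I, x = a * y + a' * z)
    (hJ : ∀ x ∈ J ^ 2, ∃ y ∈ J, ∃ z ∈ J, x = b' * y + b * z) : IsCohenMacaulayRing (RR I J) := by
  have hR : IsIntegrallyClosed (RR I J) := RR_normal hcl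
  refine ⟨RR_noeth, fun P hP => ?_⟩
  by_cases h1 : bm I J 1 0 a (m10 ha) ∈ P
  swap
  · exact RR_cm10 hdim.le hR a (m10 ha) ha0 b' b hb' hb hb0' hb0 hJ P h1
  by_cases h2 : bm I J 1 0 a' (m10 ha') ∈ P
  swap
  · exact RR_cm10 hdim.le hR a' (m10 ha') ha0' b' b hb' hb hb0' hb0 hJ P h2
  by_cases h3 : bm I J 0 1 b (m01 hb) ∈ P
  swap
  · exact RR_cm01 hdim.le hR b (m01 hb) hb0 a a' ha ha' ha0 ha0' hI P h3
  by_cases h4 : bm I J 0 1 b' (m01 hb') ∈ P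
  swap
  · exact RR_cm01 hdim.le hR b' (m01 hb') hb0' a a' ha ha' ha0 ha0' hI P h4
  have hp0 := pc_00_prime P
  by_cases h5 : maximalIdeal A ≤ pc P 0 0
  swap
  · obtain ⟨f, hf, hf'⟩ := SetLike.not_le_iff_exists.mp h5
    obtain ⟨n, hn⟩ := hIp
    obtain ⟨m, hm⟩ := hJp
    refine RR_cm00 hdim.le (f ^ (n + m)) (hn (Ideal.pow_le_pow_right (by omega) (Ideal.pow_mem_pow hf _)))
      (hm (Ideal.pow_le_pow_right (by omega) (Ideal.pow_mem_pow hf _))) P fun h => hf' ?_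
    rw [← pc_iff] at h
    exact hp0.mem_of_pow_mem _ h
  obtain ⟨β, hβ, hβ0⟩ := exists_beta hdim
  have hγ0 : a * b' * β ≠ 0 := mul_ne_zero (mul_ne_zero ha0 hb0') hβ0
  obtain ⟨v, hvm, hv1, hv2⟩ := exists_v hdim (a * b' * β) hγ0 (Ideal.mul_mem_left _ _ hβ)
  refine cm_crit' P [bm I J 1 0 a (m10 ha), bm I J 0 1 b' (m01 hb'), th a' b (a * b' * β) ha' hb, bm I J 0 0 v m00] ?_ ?_ ?_
  · simp only [List.mem_cons, List.not_mem_nil, or_false, forall_eq_or_imp, forall_eq]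
    refine ⟨h1, h4, add_mem (add_mem h2 h3) ?_, ?_⟩
    · exact (pc_iff P 0 0 _ m00).mp (h5 (Ideal.mul_mem_left _ _ hβ))
    · exact (pc_iff P 0 0 _ m00).mp (h5 hvm)
  · have h1P : (1 : RR I J) ∉ P := fun h => hP.ne_top ((Ideal.eq_top_iff_one _).mpr h)
    have hne : ∀ i j (x : A) hx, x ≠ 0 → bm I J i j x hx ≠ 0 := by
      intro i j x hx h h'
      have := congrArg (fun z => bc z i j) h'
      simp only [bc_bm, and_self, if_true, bc_zero] at this
      exact h this
    refine ⟨fun x hx => ⟨1, h1P, ?_⟩, fun x hx => ⟨1, h1P, ?_⟩, fun x hx => ⟨1, h1P, ?_⟩, fun x hx => ⟨1, h1P, ?_⟩, trivial⟩ <;> rw [one_mul]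
    · exact (mul_eq_zero.mp hx).resolve_left (hne _ _ _ _ ha0)
    · exact delta2 hcl a b' ha hb' ha0 hb0' hK x hx
    · exact delta3 hcl a a' b b' β ha ha' hb hb' ha0 hb0' hβ0 hK hI hJ x hx
    · exact delta4 a a' b b' β v ha ha' hb hb' ha0 hb0' hβ0 hK hI hJ hv1 x hx
  · intro Q hQ hQP hr
    simp only [List.mem_cons, List.not_mem_nil, or_false, forall_eq_or_imp, forall_eq] at hr
    obtain ⟨hr1, hr2, hr3, hr4⟩ := hr
    obtain ⟨k1, k2, k3⟩ := rad Q a a' b b' β ha ha' hb hb' (int_of_sq I a a' ha ha0 hI) (int_of_sq J b' b hb' hb0' hJ) 0 (by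
      have := mixed a b' hK 0 0
      exact this) hr1 hr2 hr3
    have hq0 := pc_00_prime Q
    refine le_of_pc Q P k1 k2 fun x hx => hv2 _ hq0 k3 ((pc_iff Q 0 0 _ m00).mpr hr4) ?_
    have hx1 : x - bm I J 0 0 (bc x 0 0) m00 ∈ P := by
      rw [← pc_iff] at h1 h2 h3 h4
      refine mem_of_pc P (fun y hy => pc_int1 P a a' h1 h2 y hy (int_of_sq I a a' ha ha0 hI y hy))
        (fun y hy => pc_int2 P b' b h4 h3 y hy (int_of_sq J b' b hb' hb0' hJ y hy)) _ ?_
      rw [bc_sub, bc_bm, if_pos ⟨rfl, rfl⟩, sub_self]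
      exact zero_mem _
    have := sub_mem hx hx1
    rw [sub_sub_cancel, ← pc_iff] at this
    exact le_maximalIdeal hp0.ne_top this

end De2
end MR

end Part15

section Part16
open RingTheory.Sequence IsLocalRing Polynomial

namespace MR

section G
variable {A : Type*} [CommRing A]

lemma avoid (k : Type*) [Field k] [Infinite k] [Algebra k A] (I : Ideal A) (ℬ : Set (Ideal A)) (hf : ℬ.Finite)
    (h : ∀ B ∈ ℬ, ¬ I ≤ B) : ∃ a ∈ I, ∀ B ∈ ℬ, a ∉ B := by
  have : Finite ℬ := hf
  let p : ℬ → Subspace k (I.restrictScalars k) := fun B => ((B : Ideal A).restrictScalars k).comap (I.restrictScalars k).subtype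
  by_contra hcon
  push Not at hcon
  obtain ⟨B, hB⟩ := Subspace.exists_eq_top_of_iUnion_eq_univ (p := p) (by
    rw [Set.eq_univ_iff_forall]
    intro x
    obtain ⟨B, hB, hx⟩ := hcon x.1 x.2
    exact Set.mem_iUnion.mpr ⟨⟨B, hB⟩, hx⟩)
  refine h B.1 B.2 fun x hx => ?_
  have : (⟨x, hx⟩ : I.restrictScalars k) ∈ p B := by rw [hB]; trivial
  exact this

lemma avoid2 (k : Type*) [Field k] [Infinite k] [Algebra k A] (I J : Ideal A) (ℬ : Set (Ideal A)) (hf : ℬ.Finite)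
    (h : ∀ B ∈ ℬ, ¬ I * J ≤ B) : ∃ a ∈ I, ∃ b ∈ J, ∀ B ∈ ℬ, a * b ∉ B := by
  obtain ⟨a, ha, ha'⟩ := avoid k I ((fun B => B.colon (J : Set A)) '' ℬ) (hf.image _) (by
    rintro _ ⟨B, hB, rfl⟩ hle
    refine h B hB ?_
    rw [Ideal.mul_le]
    intro r hr s hs
    have := hle hr
    rw [Submodule.mem_colon] at this
    exact this s hs)
  obtain ⟨b, hb, hb'⟩ := avoid k J ((fun B => B.colon ({a} : Set A)) '' ℬ) (hf.image _) (by
    rintro _ ⟨B, hB, rfl⟩ hle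
    refine ha' _ ⟨B, hB, rfl⟩ ?_
    rw [Submodule.mem_colon]
    intro s hs
    have := hle hs
    rw [Submodule.mem_colon] at this
    have := this a rfl
    rwa [smul_eq_mul, mul_comm] at this)
  refine ⟨a, ha, b, hb, fun B hB h => hb' _ ⟨B, hB, rfl⟩ ?_⟩
  rw [Submodule.mem_colon]
  rintro _ rfl
  rwa [smul_eq_mul, mul_comm]

variable {L : Type*} [Field L] [Algebra A L]

/-- elements `z` of `K` with `z/x ∈ P` -/
noncomputable def bq (K : Ideal A) (x : A) (P : Ideal (ch L K x)) : Ideal A where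
  carrier := {z | ∃ hz : z ∈ K ^ 1, (⟨_, ch_mem K x 1 z hz⟩ : ch L K x) ∈ P}
  add_mem' := by
    rintro y z ⟨hy, hy'⟩ ⟨hz, hz'⟩
    refine ⟨add_mem hy hz, ?_⟩
    convert add_mem hy' hz' using 1
    apply Subtype.ext
    simp [add_mul]
  zero_mem' := ⟨zero_mem _, by convert zero_mem P using 1; apply Subtype.ext; simp⟩
  smul_mem' := by
    rintro c y ⟨hy, hy'⟩
    refine ⟨Ideal.mul_mem_left _ _ hy, ?_⟩
    convert Ideal.mul_mem_left P (algebraMap A (ch L K x) c) hy' using 1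
    apply Subtype.ext
    change _ = algebraMap A L c * _
    simp [mul_assoc]

variable [IsDomain A] [IsFractionRing A L]

lemma bq_not (K : Ideal A) (x : A) (hx : x ∈ K) (hx0 : x ≠ 0) (P : Ideal (ch L K x)) (hP : P ≠ ⊤) : ¬ K ≤ bq K x P := by
  intro h
  obtain ⟨h1, h2⟩ := h hx
  apply hP
  rw [Ideal.eq_top_iff_one]
  have hxL : algebraMap A L x ≠ 0 := by simpa using hx0
  convert h2 using 1
  apply Subtype.ext
  simp [hxL]

/-- the graded target -/
def EE (K : Ideal A) (m : Ideal A) (c d : A) (n : ℕ) : Ideal A := Ideal.span {c, d} * K ^ n ⊔ m * K ^ (n + 1)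


lemma EE_mul (K m : Ideal A) (c d : A) (n j r : ℕ) (h : n + j = r) : EE K m c d n * K ^ j ≤ EE K m c d r := by
  subst h
  rw [EE, EE, Ideal.sup_mul, mul_assoc, mul_assoc, ← pow_add, ← pow_add, add_right_comm]

lemma EE_local (K m : Ideal A) (c d : A) (hc : c ∈ K ^ 1) (hd : d ∈ K ^ 1) (x : A) (hx : x ∈ K) (hx0 : x ≠ 0)
    (h : ∀ P : Ideal (ch L K x), P.IsPrime → (∀ μ ∈ m, algebraMap A (ch L K x) μ ∈ P) →
      (⟨_, ch_mem K x 1 c hc⟩ : ch L K x) ∈ P → (⟨_, ch_mem K x 1 d hd⟩ : ch L K x) ∈ P → False) :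
    ∃ N, x ^ (N + 1) ∈ EE K m c d N := by
  have hxL : algebraMap A L x ≠ 0 := by simpa using hx0
  let 𝔈 : Ideal (ch L K x) :=
    { carrier := {s | ∃ N, ∃ z ∈ EE K m c d N, (s : L) * algebraMap A L x ^ (N + 1) = algebraMap A L z}
      add_mem' := by
        rintro s s' ⟨N, z, hz, e⟩ ⟨N', z', hz', e'⟩
        refine ⟨N + N', z * x ^ N' + z' * x ^ N, add_mem ?_ ?_, ?_⟩
        · exact EE_mul K m c d N N' _ rfl (Ideal.mul_mem_mul hz (Ideal.pow_mem_pow hx _))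
        · exact EE_mul K m c d N' N _ (by ring) (Ideal.mul_mem_mul hz' (Ideal.pow_mem_pow hx _))
        · rw [map_add, map_mul, map_mul, ← e, ← e', map_pow, map_pow]
          change ((s : L) + s') * _ = _
          ring
      zero_mem' := ⟨0, 0, zero_mem _, by simp⟩
      smul_mem' := by
        rintro t s ⟨N, z, hz, e⟩
        obtain ⟨n, w, hw, e1⟩ := ch_exists K x hx hx0 t.1 t.2
        refine ⟨N + n, z * w, EE_mul K m c d N n _ rfl (Ideal.mul_mem_mul hz hw), ?_⟩
        change (t : L) * s * _ = _
        have e2 : (algebraMap A L x)⁻¹ ^ n * algebraMap A L x ^ n = 1 := by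
          rw [← mul_pow, inv_mul_cancel₀ hxL, one_pow]
        rw [map_mul, ← e, e1]
        linear_combination algebraMap A L w * s * algebraMap A L x ^ (N + 1) * e2 }
  have htop : 𝔈 = ⊤ := by
    by_contra hne
    obtain ⟨P, hP, hle⟩ := Ideal.exists_le_maximal 𝔈 hne
    refine h P hP.isPrime ?_ ?_ ?_
    · intro μ hμ
      refine hle ⟨0, μ * x, ?_, ?_⟩
      · exact (le_sup_right : _ ≤ EE K m c d 0) (Ideal.mul_mem_mul hμ (by simpa using hx))
      · change algebraMap A L μ * _ = _
        simp
    · refine hle ⟨0, c, ?_, ?_⟩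
      · exact (le_sup_left : _ ≤ EE K m c d 0) (by rw [pow_zero, mul_one]; exact Ideal.subset_span (by simp))
      · simp [hxL]
    · refine hle ⟨0, d, ?_, ?_⟩
      · exact (le_sup_left : _ ≤ EE K m c d 0) (by rw [pow_zero, mul_one]; exact Ideal.subset_span (by simp))
      · simp [hxL]
  obtain ⟨N, z, hz, e⟩ := (Ideal.eq_top_iff_one _).mp htop
  refine ⟨N, ?_⟩
  change (1 : L) * _ = _ at e
  rw [one_mul, ← map_pow] at e
  rwa [IsFractionRing.injective A L e]

lemma EE_sup (K m : Ideal A) (c d : A) (F F' : Ideal A) (hF : F ≤ K) (hF' : F' ≤ K)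
    (h : ∃ N, F ^ (N + 1) ≤ EE K m c d N) (h' : ∃ N, F' ^ (N + 1) ≤ EE K m c d N) :
    ∃ N, (F ⊔ F') ^ (N + 1) ≤ EE K m c d N := by
  obtain ⟨M, h⟩ := h
  obtain ⟨M', h'⟩ := h'
  refine ⟨M + M' + 1, ?_⟩
  rw [← Submodule.add_eq_sup, add_pow]
  refine Finset.sum_induction _ (· ≤ EE K m c d (M + M' + 1)) (fun x y hx hy => sup_le hx hy) bot_le ?_
  intro j hj
  rw [Finset.mem_range] at hj
  refine Ideal.mul_le_left.trans ?_
  by_cases hjM : M + 1 ≤ j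
  · obtain ⟨l, rfl⟩ : ∃ l, j = M + 1 + l := ⟨j - (M + 1), by omega⟩
    rw [pow_add, mul_assoc]
    have h3 : F ^ l * F' ^ (M + M' + 1 + 1 - (M + 1 + l)) ≤ K ^ (M' + 1) := by
      refine (Ideal.mul_mono (Ideal.pow_right_mono hF _) (Ideal.pow_right_mono hF' _)).trans ?_
      rw [← pow_add]
      exact Ideal.pow_le_pow_right (by omega)
    exact (Ideal.mul_mono h h3).trans (EE_mul K m c d _ _ (M + M' + 1) (by ring))
  · obtain ⟨l, hl⟩ : ∃ l, M + M' + 1 + 1 - j = M' + 1 + l := ⟨M + M' + 1 + 1 - j - (M' + 1), by omega⟩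
    rw [hl, pow_add, mul_left_comm]
    have h3 : F ^ j * F' ^ l ≤ K ^ (M + 1) := by
      refine (Ideal.mul_mono (Ideal.pow_right_mono hF _) (Ideal.pow_right_mono hF' _)).trans ?_
      rw [← pow_add]
      exact Ideal.pow_le_pow_right (by omega)
    exact (Ideal.mul_mono h' h3).trans (EE_mul K m c d _ _ (M + M' + 1) (by ring))

lemma EE_all (K m : Ideal A) (c d : A) (s : Finset A) (hs : ∀ x ∈ s, x ∈ K) (h : ∀ x ∈ s, ∃ N, x ^ (N + 1) ∈ EE K m c d N) :
    ∃ N, (Ideal.span (s : Set A)) ^ (N + 1) ≤ EE K m c d N := by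
  classical
  induction s using Finset.induction_on with
  | empty => exact ⟨0, by simp⟩
  | insert x s hx ih =>
    rw [Finset.coe_insert, Ideal.span_insert]
    refine EE_sup K m c d _ _ ?_ ?_ ?_ (ih (fun y hy => hs y (Finset.mem_insert_of_mem hy)) (fun y hy => h y (Finset.mem_insert_of_mem hy)))
    · rw [Ideal.span_singleton_le_iff_mem]; exact hs x (Finset.mem_insert_self _ _)
    · rw [Ideal.span_le]; exact fun y hy => hs y (Finset.mem_insert_of_mem hy)
    · obtain ⟨N, hN⟩ := h x (Finset.mem_insert_self _ _)
      refine ⟨N, ?_⟩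
      rwa [Ideal.span_singleton_pow, Ideal.span_singleton_le_iff_mem]

theorem generic (k : Type*) [Field k] [Infinite k] [Algebra k A] [IsNoetherianRing A] [IsLocalRing A] [IsIntegrallyClosed A]
    (hdim : ringKrullDim A = 2) (I J : Ideal A) (hI : I ≠ ⊥) (hJ : J ≠ ⊥) :
    ∃ a ∈ I, ∃ a' ∈ I, ∃ b ∈ J, ∃ b' ∈ J, a ≠ 0 ∧ a' ≠ 0 ∧ b ≠ 0 ∧ b' ≠ 0 ∧
      ∃ M, ∀ x ∈ (I * J) ^ (M + 1), ∃ y ∈ (I * J) ^ M, ∃ z ∈ (I * J) ^ M, x = a * b * y + a' * b' * z := by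
  classical
  let L := FractionRing A
  set K := I * J with hK
  have hK0 : K ≠ ⊥ := mul_ne_zero hI hJ
  obtain ⟨s, hs⟩ := IsNoetherian.noetherian K
  have hsK : ∀ x ∈ s, x ∈ K := fun x hx => by rw [← hs]; exact Ideal.subset_span hx
  have hno : ∀ x, IsNoetherianRing (ch L K x) := fun x => noeth_of_fg _ (ch_fg K x)
  have hdm : ∀ x, ringKrullDim (ch L K x) ≤ 2 := fun x => (dim_fg _ (ch_fg K x)).trans hdim.le
  let 𝔪 : ∀ x, Ideal (ch L K x) := fun x => (maximalIdeal A).map (algebraMap A (ch L K x))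
  obtain ⟨a, ha, b, hb, hab⟩ := avoid2 k I J (insert ⊥ (⋃ x ∈ {x | x ∈ s ∧ x ≠ 0}, (bq K x) '' (𝔪 x).minimalPrimes)) (by
    refine Set.Finite.insert _ (Set.Finite.biUnion (s.finite_toSet.subset fun x hx => hx.1) fun x _ => ?_)
    have := hno x
    exact (Ideal.finite_minimalPrimes_of_isNoetherianRing _ _).image _) (by
    rintro B (rfl | hB)
    · rwa [le_bot_iff]
    · simp only [Set.mem_iUnion] at hB
      obtain ⟨x, ⟨hx, hx0⟩, P, hP, rfl⟩ := hB
      exact bq_not K x (hsK x hx) hx0 P hP.1.1.ne_top)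
  have hab0 : a * b ≠ 0 := hab ⊥ (Set.mem_insert _ _)
  have hc : a * b ∈ K ^ 1 := by rw [pow_one]; exact Ideal.mul_mem_mul ha hb
  let 𝔫 : ∀ x, Ideal (ch L K x) := fun x => 𝔪 x ⊔ Ideal.span {⟨_, ch_mem K x 1 _ hc⟩}
  obtain ⟨a', ha', b', hb', hab'⟩ := avoid2 k I J (insert ⊥ (⋃ x ∈ {x | x ∈ s ∧ x ≠ 0}, (bq K x) '' (𝔫 x).minimalPrimes)) (by
    refine Set.Finite.insert _ (Set.Finite.biUnion (s.finite_toSet.subset fun x hx => hx.1) fun x _ => ?_)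
    have := hno x
    exact (Ideal.finite_minimalPrimes_of_isNoetherianRing _ _).image _) (by
    rintro B (rfl | hB)
    · rwa [le_bot_iff]
    · simp only [Set.mem_iUnion] at hB
      obtain ⟨x, ⟨hx, hx0⟩, P, hP, rfl⟩ := hB
      exact bq_not K x (hsK x hx) hx0 P hP.1.1.ne_top)
  have hab0' : a' * b' ≠ 0 := hab' ⊥ (Set.mem_insert _ _)
  have hd : a' * b' ∈ K ^ 1 := by rw [pow_one]; exact Ideal.mul_mem_mul ha' hb'
  refine ⟨a, ha, a', ha', b, hb, b', hb', left_ne_zero_of_mul hab0, left_ne_zero_of_mul hab0',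
    right_ne_zero_of_mul hab0, right_ne_zero_of_mul hab0', ?_⟩
  obtain ⟨M, hM⟩ := EE_all K (maximalIdeal A) (a * b) (a' * b') s hsK (by
    intro x hx
    by_cases hx0 : x = 0
    · subst hx0; exact ⟨0, by simp⟩
    refine EE_local (L := L) K _ _ _ hc hd x (hsK x hx) hx0 ?_
    intro P hP h1 h2 h3
    have hPn : 𝔫 x ≤ P := by
      refine sup_le ?_ ?_
      · rw [Ideal.map_le_iff_le_comap]; exact h1
      · rwa [Ideal.span_singleton_le_iff_mem]
    obtain ⟨Q, hQ, hQP⟩ := Ideal.exists_minimalPrimes_le hPn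
    have := hQ.1.1
    obtain ⟨T, hT, hTQ⟩ := Ideal.exists_minimalPrimes_le ((le_sup_left : 𝔪 x ≤ 𝔫 x).trans hQ.1.2)
    have := hT.1.1
    have l1 : Q < P := by
      refine lt_of_le_of_ne hQP ?_
      rintro rfl
      refine hab' (bq K x Q) (Set.mem_insert_of_mem _ ?_) ⟨hd, h3⟩
      simp only [Set.mem_iUnion]
      exact ⟨x, ⟨hx, hx0⟩, Q, hQ, rfl⟩
    have l2 : T < Q := by
      refine lt_of_le_of_ne hTQ ?_
      rintro rfl
      refine hab (bq K x T) (Set.mem_insert_of_mem _ ?_) ⟨hc, hQ.1.2 ((le_sup_right : _ ≤ 𝔫 x) (Ideal.mem_span_singleton_self _))⟩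
      simp only [Set.mem_iUnion]
      exact ⟨x, ⟨hx, hx0⟩, T, hT, rfl⟩
    have l3 : ⊥ < T := by
      refine bot_lt_iff_ne_bot.mpr ?_
      rintro rfl
      obtain ⟨β, hβ, hβ0⟩ := exists_beta hdim
      have : algebraMap A (ch L K x) β ∈ (⊥ : Ideal (ch L K x)) := hT.1.2 (Ideal.mem_map_of_mem _ hβ)
      have := congrArg (fun z : ch L K x => (z : L)) this
      exact hβ0 (IsFractionRing.injective A L (by simpa using this))
    have := hno x
    have k1 := Ideal.height_add_one_le_of_lt_of_isPrime l1
    have k2 := Ideal.height_add_one_le_of_lt_of_isPrime l2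
    have k3 := Ideal.height_add_one_le_of_lt_of_isPrime l3
    have k4 : (P.height : WithBot ℕ∞) ≤ 2 := (Ideal.height_le_ringKrullDim_of_isPrime).trans (hdm x)
    have k5 : P.height ≤ 2 := WithBot.coe_le_coe.mp k4
    have k6 : (3 : ℕ∞) ≤ P.height := by
      rw [Ideal.height_bot, zero_add] at k3
      calc (3 : ℕ∞) = 1 + 1 + 1 := by norm_num
        _ ≤ T.height + 1 + 1 := by gcongr
        _ ≤ Q.height + 1 := by gcongr
        _ ≤ _ := k1
    have := k6.trans k5
    exact absurd this (by decide))
  refine ⟨M, fun x hx => ?_⟩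
  change Ideal.span (s : Set A) = K at hs
  rw [hs] at hM
  have hle : K ^ (M + 1) ≤ Ideal.span {a * b, a' * b'} * K ^ M :=
    Submodule.le_of_le_smul_of_le_jacobson_bot (IsNoetherian.noetherian _) (maximalIdeal_le_jacobson _) hM
  have := hle hx
  rw [Ideal.span_insert, Ideal.sup_mul] at this
  obtain ⟨u, hu, w, hw, e⟩ := Submodule.mem_sup.mp this
  obtain ⟨y, hy, rfl⟩ := Ideal.mem_span_singleton_mul.mp hu
  obtain ⟨z, hz, rfl⟩ := Ideal.mem_span_singleton_mul.mp hw
  exact ⟨y, hy, z, hz, e.symm⟩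

end G
end MR

end Part16

section Part17
open RingTheory.Sequence IsLocalRing Polynomial

namespace MR

section Al
variable {A : Type*} [CommRing A] [IsDomain A] [IsNoetherianRing A] [IsLocalRing A] [IsIntegrallyClosed A]

lemma exists_q (hdim : ringKrullDim A = 2) : ∃ q : Ideal A, q.IsPrime ∧ ⊥ < q ∧ q < maximalIdeal A := by
  obtain ⟨β, hβ, hβ0⟩ := exists_beta hdim
  obtain ⟨q, hq, hqm⟩ := Ideal.exists_minimalPrimes_le (I := Ideal.span {β}) (J := maximalIdeal A)
    (by rwa [Ideal.span_singleton_le_iff_mem])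
  have hq1 := hq.1.1
  refine ⟨q, hq1, bot_lt_iff_ne_bot.mpr ?_, lt_of_le_of_ne hqm ?_⟩
  · rintro rfl
    exact hβ0 (hq.1.2 (Ideal.mem_span_singleton_self _))
  · rintro rfl
    have h1 := Ideal.height_le_one_of_isPrincipal_of_mem_minimalPrimes (Ideal.span {β}) (maximalIdeal A) hq
    rw [m_height hdim] at h1
    exact absurd h1 (by decide)

lemma height_lift {R : Type*} [CommRing R] [IsDomain R] [IsNoetherianRing R] (hdim : ringKrullDim A = 2) (π : R →+* A)
    (hπ : Function.Surjective π) : (RingHom.ker π).height + 1 + 1 ≤ ((maximalIdeal A).comap π).height := by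
  obtain ⟨q, hq, h0, h1⟩ := exists_q hdim
  have hmono : StrictMono (Ideal.comap π) :=
    (Monotone.strictMono_of_injective (fun _ _ h => Ideal.comap_mono h) (Ideal.comap_injective_of_surjective π hπ))
  have l0 : RingHom.ker π < q.comap π := by
    rw [RingHom.ker_eq_comap_bot]
    exact (hmono) h0
  have l1 := (hmono) h1
  have := RingHom.ker_isPrime π
  have k0 := Ideal.height_add_one_le_of_lt_of_isPrime l0
  have k1 := Ideal.height_add_one_le_of_lt_of_isPrime l1
  exact (add_le_add_left k0 1).trans k1

lemma locReg_pow {R : Type*} [CommRing R] (P 𝔞 : Ideal R) [hP : P.IsPrime] (v : R)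
    (h : ∀ x, v * x ∈ 𝔞 → ∃ s, s ∉ P ∧ s * x ∈ 𝔞) (n : ℕ) : ∀ x, v ^ n * x ∈ 𝔞 → ∃ s, s ∉ P ∧ s * x ∈ 𝔞 := by
  induction n with
  | zero => exact fun x hx => ⟨1, fun h => hP.ne_top ((Ideal.eq_top_iff_one _).mpr h), by simpa using hx⟩
  | succ n ih =>
    intro x hx
    obtain ⟨s, hs, h1⟩ := ih (v * x) (by rwa [← mul_assoc, ← pow_succ])
    obtain ⟨t, ht, h2⟩ := h (s * x) (by rwa [mul_left_comm])
    exact ⟨t * s, fun h => (hP.mem_or_mem h).elim ht hs, by rwa [mul_assoc]⟩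

lemma unit_of (s : A) (h : s ∉ maximalIdeal A) : ∃ t, t * s = 1 := by
  have : IsUnit s := by
    by_contra h'; exact h ((mem_maximalIdeal s).mpr h')
  obtain ⟨t, ht⟩ := this.exists_left_inv
  exact ⟨t, ht⟩

set_option maxHeartbeats 1000000 in
theorem alpha (hdim : ringKrullDim A = 2) (K : Ideal A) (hKp : ∃ n : ℕ, maximalIdeal A ^ n ≤ K)
    (hcm : IsCohenMacaulayRing (reesAlgebra K)) (a a' : A) (ha : a ∈ K) (ha' : a' ∈ K) (ha0 : a ≠ 0)
    (M : ℕ) (hM : ∀ x ∈ K ^ (M + 1), ∃ y ∈ K ^ M, ∃ z ∈ K ^ M, x = a * y + a' * z) :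
    ∀ x ∈ K ^ 2, ∃ y ∈ K, ∃ z ∈ K, x = a * y + a' * z := by
  have ha1 : a ∈ K ^ 1 := by rwa [pow_one]
  have ha1' : a' ∈ K ^ 1 := by rwa [pow_one]
  have m0 : ∀ x : A, x ∈ K ^ 0 := fun x => by simp
  obtain ⟨β, hβ, hβ0⟩ := exists_beta hdim
  obtain ⟨v, hvm, -, hv2⟩ := exists_v hdim (a * β) (mul_ne_zero ha0 hβ0) (Ideal.mul_mem_left _ _ hβ)
  have hsur : Function.Surjective (rpi K) := fun s => ⟨rin K s, by rw [rpi_apply, rin_eq, rc_rm]; simp⟩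
  set P := (maximalIdeal A).comap (rpi K) with hPd
  have hPm : ∀ x, x ∈ P ↔ rc x 0 ∈ maximalIdeal A := fun x => Iff.rfl
  have hPp : P.IsPrime := inferInstance
  have hk : (1 : ℕ∞) ≤ (RingHom.ker (rpi K)).height := by
    have := RingHom.ker_isPrime (rpi K)
    have l : ⊥ < RingHom.ker (rpi K) := by
      refine bot_lt_iff_ne_bot.mpr fun h => ?_
      have h1 : rm K 1 a ha1 ∈ RingHom.ker (rpi K) := by
        rw [RingHom.mem_ker, rpi_apply, rc_rm]; simp
      rw [h] at h1
      have := congrArg (fun z => rc z 1) ((Ideal.mem_bot).mp h1)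
      simp only [rc_rm, rc_zero, if_true] at this
      exact ha0 this
    have := Ideal.height_add_one_le_of_lt_of_isPrime l
    rwa [Ideal.height_bot, zero_add] at this
  have hht : (3 : ℕ∞) ≤ P.height := by
    refine le_trans ?_ (height_lift hdim (rpi K) hsur)
    calc (3 : ℕ∞) = 1 + 1 + 1 := by norm_num
      _ ≤ _ := by gcongr
  have hreg := cm_sop P (hcm.2 P hPp) [rm K 1 a ha1, rm K 1 a' ha1' + rm K 0 (a * β) (m0 _), rm K 0 v (m0 _)] (by
      simp only [List.mem_cons, List.not_mem_nil, or_false, forall_eq_or_imp, forall_eq, hPm, rc_rm, rc_add]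
      simp only [one_ne_zero, if_false, if_true, zero_add]
      exact ⟨zero_mem _, Ideal.mul_mem_left _ _ hβ, hvm⟩) (by
      intro Q hQ hQP hr
      simp only [List.mem_cons, List.not_mem_nil, or_false, forall_eq_or_imp, forall_eq] at hr
      obtain ⟨h1, h2, h3⟩ := hr
      have e1 : rm K 0 (a * β) (m0 _) ∈ Q := by
        have e2 : rm K 0 (a * (a * β)) (m0 _) ∈ Q := by
          have e3 : rm K 0 (a * (a * β)) (m0 _) = rm K 0 a (m0 _) * (rm K 1 a' ha1' + rm K 0 (a * β) (m0 _)) - rm K 0 a' (m0 _) * rm K 1 a ha1 := by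
            rw [mul_add, rm_mul 0 1 1 a a' (a * a') (m0 _) ha1' (Ideal.mul_mem_left _ _ ha1') (by ring) rfl,
              rm_mul 0 1 1 a' a (a * a') (m0 _) ha1 (Ideal.mul_mem_left _ _ ha1') (by ring) (by ring),
              rm_mul 0 0 0 a (a * β) (a * (a * β)) (m0 _) (m0 _) (m0 _) rfl rfl]
            ring
          rw [e3]
          exact sub_mem (Ideal.mul_mem_left _ _ h2) (Ideal.mul_mem_left _ _ h1)
        have e4 : rm K 0 (a * β) (m0 _) * rm K 0 (a * β) (m0 _) ∈ Q := by
          rw [rm_mul 0 0 0 (a * β) (a * β) (β * (a * (a * β))) (m0 _) (m0 _) (m0 _) rfl (by ring),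
            ← rm_mul 0 0 0 β (a * (a * β)) _ (m0 _) (m0 _) (m0 _) rfl rfl]
          exact Ideal.mul_mem_left _ _ e2
        exact (hQ.mem_or_mem e4).elim id id
      have e5 : rm K 1 a' ha1' ∈ Q := (Ideal.add_mem_iff_left _ e1).mp h2
      have e6 : ∀ x (hx : x ∈ K ^ 1), rm K 1 x hx ∈ Q := by
        intro x hx
        have hx' : x ∈ K := by rwa [pow_one] at hx
        have hpow : ∀ n, rm K 1 x hx ^ n = rm K n (x ^ n) (Ideal.pow_mem_pow hx' n) := by
          intro n
          apply Subtype.ext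
          change (monomial 1 x : A[X]) ^ n = monomial n (x ^ n)
          rw [monomial_pow, one_mul]
        refine hQ.mem_of_pow_mem (M + 1) ?_
        rw [hpow]
        obtain ⟨y, hy, z, hz, e⟩ := hM _ (Ideal.pow_mem_pow hx' (M + 1))
        have hy' : a * y ∈ K ^ (M + 1) := by rw [pow_succ']; exact Ideal.mul_mem_mul ha hy
        have hz' : a' * z ∈ K ^ (M + 1) := by rw [pow_succ']; exact Ideal.mul_mem_mul ha' hz
        rw [← rm_add (M + 1) _ _ _ hy' hz' _ e.symm, ← rm_mul 1 M (M + 1) a y _ ha1 hy hy' (by ring) rfl,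
          ← rm_mul 1 M (M + 1) a' z _ ha1' hz hz' (by ring) rfl]
        exact add_mem (Ideal.mul_mem_right _ _ h1) (Ideal.mul_mem_right _ _ e5)
      have hq0 : (Q.comap (rin K)).IsPrime := inferInstance
      have hm := hv2 (Q.comap (rin K)) hq0 (by rw [Ideal.mem_comap, rin_eq]; exact e1) (by rw [Ideal.mem_comap, rin_eq]; exact h3)
      intro x hx
      refine rees_mem Q x fun n => ?_
      cases n with
      | zero =>
        have := hm ((hPm x).mp hx)
        rw [Ideal.mem_comap, rin_eq] at this
        exact this
      | succ n =>
        exact rm_mem_of_one Q e6 n _ _) (by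
      exact hht)
  have hv3 := hreg.2.2.1
  rw [bot_sup_eq] at hv3
  obtain ⟨n, hn⟩ : ∃ n, v ^ n ∈ Ideal.span {a, a'} := by
    obtain ⟨n, hn⟩ := hKp
    have h1 : v ^ (n * (M + 1)) ∈ K ^ (M + 1) := by
      rw [pow_mul]; exact Ideal.pow_mem_pow (hn (Ideal.pow_mem_pow hvm n)) _
    obtain ⟨y, _, z, _, e⟩ := hM _ h1
    exact ⟨_, Ideal.mem_span_pair.mpr ⟨y, z, by rw [e]; ring⟩⟩
  obtain ⟨e, e', he⟩ := Ideal.mem_span_pair.mp hn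
  intro x hx
  have hxK : x ∈ K ^ 1 := Ideal.pow_le_pow_right (by omega) hx
  obtain ⟨s, hs, h1⟩ := locReg_pow P _ _ hv3 n (rm K 2 x hx) (by
    have hpow : rm K 0 v (m0 _) ^ n = rm K 0 (v ^ n) (m0 _) := by
      apply Subtype.ext
      change (monomial 0 v : A[X]) ^ n = monomial 0 (v ^ n)
      rw [monomial_pow, zero_mul]
    have e7 : rm K 0 v (m0 _) ^ n * rm K 2 x hx =
        rm K 1 a ha1 * (rm K 1 (e * x) (Ideal.mul_mem_left _ _ hxK) - rm K 0 (β * e' * x) (m0 _))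
          + (rm K 1 a' ha1' + rm K 0 (a * β) (m0 _)) * rm K 1 (e' * x) (Ideal.mul_mem_left _ _ hxK) := by
      rw [hpow]
      apply Subtype.ext
      change (monomial 0 (v ^ n) : A[X]) * monomial 2 x = monomial 1 a * (monomial 1 (e * x) - monomial 0 (β * e' * x)) + (monomial 1 a' + monomial 0 (a * β)) * monomial 1 (e' * x)
      rw [mul_sub, add_mul]
      simp only [monomial_mul_monomial]
      rw [← he, show a * (β * e' * x) = a * β * (e' * x) by ring]
      norm_num
      rw [show (e * a + e' * a') * x = a * (e * x) + a' * (e' * x) by ring, map_add]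
    rw [e7]
    refine add_mem (Ideal.mul_mem_right _ _ (Ideal.mem_sup_left (Ideal.mem_span_singleton_self _)))
      (Ideal.mul_mem_right _ _ (Ideal.mem_sup_right (Ideal.mem_span_singleton_self _))))
  rw [Submodule.mem_sup] at h1
  obtain ⟨p, hp, w, hw, h1⟩ := h1
  obtain ⟨p, rfl⟩ := Ideal.mem_span_singleton.mp hp
  obtain ⟨w, rfl⟩ := Ideal.mem_span_singleton.mp hw
  have c2 := congrArg (fun z => rc z 2) h1
  rw [mul_comm s] at c2
  simp only [add_mul, rc_add] at c2
  rw [rc_rm1_mul 1, rc_rm1_mul 1, rc_rm0_mul, rc_rm_mul 2 0] at c2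
  obtain ⟨t, ht⟩ := unit_of (rc s 0) hs
  have p1 : rc p 1 ∈ K := by have := rc_mem p 1; rwa [pow_one] at this
  have w1 : rc w 1 ∈ K := by have := rc_mem w 1; rwa [pow_one] at this
  have w2 : rc w 2 ∈ K := by
    have := rc_mem w 2; exact Ideal.pow_le_self (by omega) this
  refine ⟨t * (rc p 1 + β * rc w 2), Ideal.mul_mem_left _ _ (add_mem p1 (Ideal.mul_mem_left _ _ w2)), t * rc w 1,
    Ideal.mul_mem_left _ _ w1, ?_⟩
  linear_combination (-x) * ht - t * c2

end Al
end MR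

end Part17

section Part18
open RingTheory.Sequence IsLocalRing Polynomial

namespace MR

section Ga
variable {A : Type*} [CommRing A] [IsDomain A] [IsNoetherianRing A] [IsLocalRing A] [IsIntegrallyClosed A] {I J : Ideal A}

/-- projection to `A[t₂]` -/
noncomputable def bp1 (I J : Ideal A) : RR I J →+* A[X] :=
  (Polynomial.constantCoeff).comp (RR I J).val.toRingHom

/-- projection to `A` -/
noncomputable def bp2 (I J : Ideal A) : RR I J →+* A := (Polynomial.constantCoeff).comp (bp1 I J)

lemma bp1_coeff (x : RR I J) (j : ℕ) : (bp1 I J x).coeff j = bc x 0 j := rfl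
lemma bp2_apply (x : RR I J) : bp2 I J x = bc x 0 0 := rfl

lemma height4 (hdim : ringKrullDim A = 2) (a b : A) (ha : a ∈ I) (hb : b ∈ J) (ha0 : a ≠ 0) (hb0 : b ≠ 0) :
    (4 : ℕ∞) ≤ ((maximalIdeal A).comap (bp2 I J)).height := by
  have hsur : Function.Surjective (bp2 I J) := fun s => ⟨bm I J 0 0 s m00, by rw [bp2_apply, bc_bm]; simp⟩
  have i1 := RingHom.ker_isPrime (bp1 I J)
  have i2 := RingHom.ker_isPrime (bp2 I J)
  have l1 : ⊥ < RingHom.ker (bp1 I J) := by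
    refine bot_lt_iff_ne_bot.mpr fun h => ?_
    have h1 : bm I J 1 0 a (m10 ha) ∈ RingHom.ker (bp1 I J) := by
      rw [RingHom.mem_ker]
      ext j
      rw [bp1_coeff, bc_bm]; simp
    rw [h] at h1
    have := congrArg (fun z => bc z 1 0) ((Ideal.mem_bot).mp h1)
    simp only [bc_bm, bc_zero, and_self, if_true] at this
    exact ha0 this
  have l2 : RingHom.ker (bp1 I J) < RingHom.ker (bp2 I J) := by
    refine lt_of_le_of_ne ?_ fun h => ?_
    · intro x hx
      rw [RingHom.mem_ker] at hx ⊢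
      change Polynomial.constantCoeff (bp1 I J x) = 0
      rw [hx, map_zero]
    · have h1 : bm I J 0 1 b (m01 hb) ∈ RingHom.ker (bp2 I J) := by
        rw [RingHom.mem_ker, bp2_apply, bc_bm]; simp
      rw [← h, RingHom.mem_ker] at h1
      have := congrArg (fun z => z.coeff 1) h1
      simp only [bp1_coeff, bc_bm, and_self, if_true, coeff_zero] at this
      exact hb0 this
  have k1 := Ideal.height_add_one_le_of_lt_of_isPrime l1
  have k2 := Ideal.height_add_one_le_of_lt_of_isPrime l2
  rw [Ideal.height_bot, zero_add] at k1
  refine le_trans ?_ (height_lift hdim (bp2 I J) hsur)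
  calc (4 : ℕ∞) = 1 + 1 + 1 + 1 := by norm_num
    _ ≤ (RingHom.ker (bp1 I J)).height + 1 + 1 + 1 := by gcongr
    _ ≤ _ := by gcongr

lemma bm_v_pow (v : A) (n i j : ℕ) (x : A) (hx : x ∈ I ^ i * J ^ j) :
    bm I J 0 0 v m00 ^ n * bm I J i j x hx = bm I J i j (v ^ n * x) (Ideal.mul_mem_left _ _ hx) := by
  induction n generalizing x with
  | zero =>
    rw [pow_zero, one_mul]
    congr 1
    rw [pow_zero, one_mul]
  | succ n ih =>
    rw [pow_succ, mul_assoc, bm_mul 0 0 i j i j v x (v * x) m00 hx (Ideal.mul_mem_left _ _ hx) (by ring) (by ring) rfl, ih]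
    congr 1
    ring

set_option maxHeartbeats 2000000 in
theorem gamma (hdim : ringKrullDim A = 2) (hIp : ∃ n : ℕ, maximalIdeal A ^ n ≤ I) (hJp : ∃ n : ℕ, maximalIdeal A ^ n ≤ J)
    (hcm : IsCohenMacaulayRing (RR I J)) (a a' b b' : A) (ha : a ∈ I) (ha' : a' ∈ I) (hb : b ∈ J) (hb' : b' ∈ J)
    (ha0 : a ≠ 0) (hb0 : b ≠ 0) (hb0' : b' ≠ 0)
    (M : ℕ) (hM : ∀ x ∈ (I * J) ^ (M + 1), ∃ y ∈ (I * J) ^ M, ∃ z ∈ (I * J) ^ M, x = a * b * y + a' * b' * z) :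
    (∀ x ∈ I * J, ∃ y ∈ J, ∃ z ∈ I, x = a * y + b' * z) ∧
    (∀ x ∈ I ^ 2, ∃ y ∈ I, ∃ z ∈ I, x = a * y + a' * z) ∧
    (∀ x ∈ J ^ 2, ∃ y ∈ J, ∃ z ∈ J, x = b' * y + b * z) := by
  obtain ⟨β, hβ, hβ0⟩ := exists_beta hdim
  have hγ0 : a * b' * β ≠ 0 := mul_ne_zero (mul_ne_zero ha0 hb0') hβ0
  obtain ⟨v, hvm, -, hv2⟩ := exists_v hdim (a * b' * β) hγ0 (Ideal.mul_mem_left _ _ hβ)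
  set P := (maximalIdeal A).comap (bp2 I J) with hPd
  have hPm : ∀ x, x ∈ P ↔ bc x 0 0 ∈ maximalIdeal A := fun x => Iff.rfl
  have hPp : P.IsPrime := inferInstance
  have hht : (4 : ℕ∞) ≤ P.height := height4 hdim a b ha hb ha0 hb0
  have hI0 : I ≠ ⊥ := fun h => ha0 (by rwa [h] at ha)
  have hJ0 : J ≠ ⊥ := fun h => hb0 (by rwa [h] at hb)
  have hK0 : (I * J) ^ M ≠ ⊥ := pow_ne_zero M (mul_ne_zero hI0 hJ0)
  have hIi : ∀ x ∈ I, IsIntegralOverIdeal (Ideal.span {a, a'}) x := by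
    intro x hx
    refine int_of_mul _ (J * (I * J) ^ M) (mul_ne_zero hJ0 hK0) x fun y hy => ?_
    obtain ⟨u, hu, w, hw, e⟩ := hM (x * y) (by
      rw [pow_succ', mul_assoc]; exact Ideal.mul_mem_mul hx hy)
    rw [e, mul_assoc, mul_assoc]
    exact add_mem (Ideal.mul_mem_mul (Ideal.subset_span (by simp)) (Ideal.mul_mem_mul hb hu))
      (Ideal.mul_mem_mul (Ideal.subset_span (by simp)) (Ideal.mul_mem_mul hb' hw))
  have hJi : ∀ x ∈ J, IsIntegralOverIdeal (Ideal.span {b', b}) x := by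
    intro x hx
    refine int_of_mul _ (I * (I * J) ^ M) (mul_ne_zero hI0 hK0) x fun y hy => ?_
    obtain ⟨u, hu, w, hw, e⟩ := hM (x * y) (by
      rw [pow_succ', mul_comm I J, mul_assoc, mul_comm J I]; exact Ideal.mul_mem_mul hx hy)
    rw [e, mul_comm a, mul_comm a', mul_assoc, mul_assoc]
    exact add_mem (Ideal.mul_mem_mul (Ideal.subset_span (by simp)) (Ideal.mul_mem_mul ha hu))
      (Ideal.mul_mem_mul (Ideal.subset_span (by simp)) (Ideal.mul_mem_mul ha' hw))
  have hin : ∀ r ∈ [bm I J 1 0 a (m10 ha), bm I J 0 1 b' (m01 hb'), th a' b (a * b' * β) ha' hb, bm I J 0 0 v m00], r ∈ P := by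
    simp only [List.mem_cons, List.not_mem_nil, or_false, forall_eq_or_imp, forall_eq, hPm, bc_bm, th, bc_add]
    simp only [one_ne_zero, and_true, true_and, and_self, if_true, if_false, zero_add, and_false, false_and]
    exact ⟨zero_mem _, zero_mem _, Ideal.mul_mem_left _ _ hβ, hvm⟩
  have hmin : ∀ Q : Ideal (RR I J), Q.IsPrime → Q ≤ P →
      (∀ r ∈ [bm I J 1 0 a (m10 ha), bm I J 0 1 b' (m01 hb'), th a' b (a * b' * β) ha' hb, bm I J 0 0 v m00], r ∈ Q) → P ≤ Q := by
    intro Q hQ hQP hr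
    simp only [List.mem_cons, List.not_mem_nil, or_false, forall_eq_or_imp, forall_eq] at hr
    obtain ⟨hr1, hr2, hr3, hr4⟩ := hr
    obtain ⟨k1, k2, k3⟩ := rad Q a a' b b' β ha ha' hb hb' hIi hJi M (by
      intro x hx
      rw [← mul_pow] at hx
      obtain ⟨y, hy, z, hz, e⟩ := hM x hx
      rw [mul_pow] at hy hz
      refine ⟨b * y, ?_, a' * z, ?_, by rw [e]; ring⟩
      · rw [pow_succ', mul_left_comm]; exact Ideal.mul_mem_mul hb hy
      · rw [pow_succ', mul_assoc]; exact Ideal.mul_mem_mul ha' hz) hr1 hr2 hr3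
    have hq0 := pc_00_prime Q
    exact le_of_pc Q P k1 k2 fun x hx => hv2 _ hq0 k3 ((pc_iff Q 0 0 _ m00).mpr hr4) hx
  have R1 := cm_sop P (hcm.2 P hPp) _ hin hmin hht
  have R2 := cm_sop P (hcm.2 P hPp) [bm I J 1 0 a (m10 ha), bm I J 0 1 b' (m01 hb'), bm I J 0 0 v m00, th a' b (a * b' * β) ha' hb]
    (fun r hr => hin r (by simp only [List.mem_cons, List.not_mem_nil, or_false] at hr ⊢; tauto))
    (fun Q hQ hQP h => hmin Q hQ hQP fun r hr => h r (by simp only [List.mem_cons, List.not_mem_nil, or_false] at hr ⊢; tauto)) hht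
  have R1 := R1.2.2.2.1
  have R2 := R2.2.2.1
  rw [bot_sup_eq] at R1 R2
  set 𝔞 := Ideal.span {bm I J 1 0 a (m10 ha)} ⊔ Ideal.span {bm I J 0 1 b' (m01 hb')} with h𝔞
  set 𝔟 := 𝔞 ⊔ Ideal.span {th a' b (a * b' * β) ha' hb} with h𝔟
  have pa : a ∈ pc 𝔞 1 0 := (pc_iff 𝔞 1 0 a (m10 ha)).mpr (Ideal.mem_sup_left (Ideal.mem_span_singleton_self _))
  have pb : b' ∈ pc 𝔞 0 1 := (pc_iff 𝔞 0 1 b' (m01 hb')).mpr (Ideal.mem_sup_right (Ideal.mem_span_singleton_self _))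
  have qa : a ∈ pc 𝔟 1 0 := (pc_iff 𝔟 1 0 a (m10 ha)).mpr (Ideal.mem_sup_left (Ideal.mem_sup_left (Ideal.mem_span_singleton_self _)))
  have qb : b' ∈ pc 𝔟 0 1 := (pc_iff 𝔟 0 1 b' (m01 hb')).mpr (Ideal.mem_sup_left (Ideal.mem_sup_right (Ideal.mem_span_singleton_self _)))
  have qθ : th a' b (a * b' * β) ha' hb ∈ 𝔟 := Ideal.mem_sup_right (Ideal.mem_span_singleton_self _)
  obtain ⟨n, c, d, hn⟩ : ∃ n c d, v ^ n = a * b * c + a' * b' * d := by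
    obtain ⟨n, hn⟩ := hIp
    obtain ⟨m, hm⟩ := hJp
    have h1 : v ^ ((n + m) * (M + 1)) ∈ (I * J) ^ (M + 1) := by
      rw [pow_mul]
      refine Ideal.pow_mem_pow ?_ _
      rw [pow_add]
      exact Ideal.mul_mem_mul (hn (Ideal.pow_mem_pow hvm n)) (hm (Ideal.pow_mem_pow hvm m))
    obtain ⟨y, _, z, _, e⟩ := hM _ h1
    exact ⟨_, _, _, e⟩
  have G1 : ∀ x ∈ I * J, ∃ y ∈ J, ∃ z ∈ I, x = a * y + b' * z := by
    intro x hx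
    have hx11 : x ∈ I ^ 1 * J ^ 1 := by simpa using hx
    have hxI : x ∈ I := Ideal.mul_le_left hx
    have hxJ : x ∈ J := Ideal.mul_le_right hx
    obtain ⟨s, hs, h1⟩ := locReg_pow P _ _ R2 n (bm I J 1 1 x hx11) (by
      rw [bm_v_pow, ← pc_iff, show v ^ n * x = a * (b * c * x) + b' * (a' * d * x) by rw [hn]; ring]
      exact add_mem (pc_mul 𝔞 1 0 0 1 1 1 _ _ pa (m01 (Ideal.mul_mem_left _ _ hxJ)) rfl rfl)
        (pc_mul 𝔞 0 1 1 0 1 1 _ _ pb (m10 (Ideal.mul_mem_left _ _ hxI)) rfl rfl))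
    rw [h𝔞, Submodule.mem_sup] at h1
    obtain ⟨p, hp, w, hw, h1⟩ := h1
    obtain ⟨p, rfl⟩ := Ideal.mem_span_singleton.mp hp
    obtain ⟨w, rfl⟩ := Ideal.mem_span_singleton.mp hw
    have c2 := congrArg (fun z => bc z 1 1) h1
    rw [mul_comm s] at c2
    simp only [bc_add] at c2
    rw [bc_10 0 1, bc_01 1 0, bc_bm_mul 1 1 0 0] at c2
    obtain ⟨t, ht⟩ := unit_of (bc s 0 0) hs
    have p1 : bc p 0 1 ∈ J := by simpa using bc_mem p 0 1
    have w1 : bc w 1 0 ∈ I := by simpa using bc_mem w 1 0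
    refine ⟨t * bc p 0 1, Ideal.mul_mem_left _ _ p1, t * bc w 1 0, Ideal.mul_mem_left _ _ w1, ?_⟩
    linear_combination (-x) * ht - t * c2
  refine ⟨G1, ?_, ?_⟩
  · intro x hx
    have hx20 : x ∈ I ^ 2 * J ^ 0 := by simpa using hx
    have hxI : x ∈ I := Ideal.pow_le_self (by omega) hx
    obtain ⟨s, hs, h1⟩ := locReg_pow P _ _ R1 n (bm I J 2 0 x hx20) (by
      rw [bm_v_pow, ← pc_iff, show v ^ n * x = a * (b * c * x) + a' * (b' * d * x) by rw [hn]; ring]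
      refine add_mem (pc_mul 𝔟 1 0 1 0 2 0 _ _ qa (m10 (Ideal.mul_mem_left _ _ hxI)) rfl rfl) ?_
      have hu : b' * d * x ∈ I := Ideal.mul_mem_left _ _ hxI
      set u := b' * d * x with hud
      have k2 : a' * u ∈ I ^ 2 * J ^ 0 := by
        rw [pow_zero, Ideal.one_eq_top, Ideal.mul_top, pow_two]; exact Ideal.mul_mem_mul ha' hu
      have k1 : b * u ∈ I ^ 1 * J ^ 1 := by
        rw [pow_one, pow_one, mul_comm b]; exact Ideal.mul_mem_mul hu hb
      have k0 : a * b' * β * u ∈ I ^ 1 * J ^ 0 := m10 (Ideal.mul_mem_left _ _ hu)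
      rw [pc_iff 𝔟 2 0 _ k2]
      have e : bm I J 2 0 (a' * u) k2 = th a' b (a * b' * β) ha' hb * bm I J 1 0 u (m10 hu) - bm I J 1 1 (b * u) k1
          - bm I J 1 0 (a * b' * β * u) k0 := by
        rw [th, add_mul, add_mul, bm_mul 1 0 1 0 2 0 a' u _ _ _ k2 rfl rfl rfl, bm_mul 0 1 1 0 1 1 b u _ _ _ k1 rfl rfl rfl,
          bm_mul 0 0 1 0 1 0 _ u _ _ _ k0 rfl rfl rfl]
        ring
      rw [e]
      refine sub_mem (sub_mem (Ideal.mul_mem_right _ _ qθ) ?_) ?_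
      · rw [← pc_iff]
        obtain ⟨y, hy, z, hz, e1⟩ := G1 (b * u) (by rw [mul_comm b]; exact Ideal.mul_mem_mul hu hb)
        rw [e1]
        exact add_mem (pc_mul 𝔟 1 0 0 1 1 1 _ _ qa (m01 hy) rfl rfl) (pc_mul 𝔟 0 1 1 0 1 1 _ _ qb (m10 hz) rfl rfl)
      · rw [← pc_iff, mul_assoc, mul_assoc]
        exact pc_mul 𝔟 1 0 0 0 1 0 _ _ qa m00 rfl rfl)
    rw [h𝔟, h𝔞, Submodule.mem_sup] at h1
    obtain ⟨p, hp, w, hw, h1⟩ := h1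
    obtain ⟨p, hp', q, hq, rfl⟩ := Submodule.mem_sup.mp hp
    obtain ⟨p, rfl⟩ := Ideal.mem_span_singleton.mp hp'
    obtain ⟨q, rfl⟩ := Ideal.mem_span_singleton.mp hq
    obtain ⟨w, rfl⟩ := Ideal.mem_span_singleton.mp hw
    have c2 := congrArg (fun z => bc z 2 0) h1
    rw [mul_comm s] at c2
    simp only [bc_add, th, add_mul] at c2
    rw [bc_10 1 0, bc_10 1 0, bc_01z, bc_01z, bc_00, bc_bm_mul 2 0 0 0] at c2
    obtain ⟨t, ht⟩ := unit_of (bc s 0 0) hs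
    have p1 : bc p 1 0 ∈ I := by simpa using bc_mem p 1 0
    have w1 : bc w 1 0 ∈ I := by simpa using bc_mem w 1 0
    have w2 : bc w 2 0 ∈ I := by
      have := bc_mem w 2 0
      rw [pow_zero, Ideal.one_eq_top, Ideal.mul_top] at this
      exact Ideal.pow_le_self (by omega) this
    refine ⟨t * (bc p 1 0 + b' * β * bc w 2 0), Ideal.mul_mem_left _ _ (add_mem p1 (Ideal.mul_mem_left _ _ w2)),
      t * bc w 1 0, Ideal.mul_mem_left _ _ w1, ?_⟩
    linear_combination (-x) * ht - t * c2
  · intro x hx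
    have hx20 : x ∈ I ^ 0 * J ^ 2 := by simpa using hx
    have hxI : x ∈ J := Ideal.pow_le_self (by omega) hx
    obtain ⟨s, hs, h1⟩ := locReg_pow P _ _ R1 n (bm I J 0 2 x hx20) (by
      rw [bm_v_pow, ← pc_iff, show v ^ n * x = b' * (a' * d * x) + b * (a * c * x) by rw [hn]; ring]
      refine add_mem (pc_mul 𝔟 0 1 0 1 0 2 _ _ qb (m01 (Ideal.mul_mem_left _ _ hxI)) rfl rfl) ?_
      have hu : a * c * x ∈ J := Ideal.mul_mem_left _ _ hxI
      set u := a * c * x with hud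
      have k2 : b * u ∈ I ^ 0 * J ^ 2 := by
        rw [pow_zero, Ideal.one_eq_top, Ideal.top_mul, pow_two]; exact Ideal.mul_mem_mul hb hu
      have k1 : a' * u ∈ I ^ 1 * J ^ 1 := by
        rw [pow_one, pow_one]; exact Ideal.mul_mem_mul ha' hu
      have k0 : a * b' * β * u ∈ I ^ 0 * J ^ 1 := m01 (Ideal.mul_mem_left _ _ hu)
      rw [pc_iff 𝔟 0 2 _ k2]
      have e : bm I J 0 2 (b * u) k2 = th a' b (a * b' * β) ha' hb * bm I J 0 1 u (m01 hu) - bm I J 1 1 (a' * u) k1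
          - bm I J 0 1 (a * b' * β * u) k0 := by
        rw [th, add_mul, add_mul, bm_mul 1 0 0 1 1 1 a' u _ _ _ k1 rfl rfl rfl, bm_mul 0 1 0 1 0 2 b u _ _ _ k2 rfl rfl rfl,
          bm_mul 0 0 0 1 0 1 _ u _ _ _ k0 rfl rfl rfl]
        ring
      rw [e]
      refine sub_mem (sub_mem (Ideal.mul_mem_right _ _ qθ) ?_) ?_
      · rw [← pc_iff]
        obtain ⟨y, hy, z, hz, e1⟩ := G1 (a' * u) (Ideal.mul_mem_mul ha' hu)
        rw [e1]
        exact add_mem (pc_mul 𝔟 1 0 0 1 1 1 _ _ qa (m01 hy) rfl rfl) (pc_mul 𝔟 0 1 1 0 1 1 _ _ qb (m10 hz) rfl rfl)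
      · rw [← pc_iff, mul_comm a, mul_assoc, mul_assoc]
        exact pc_mul 𝔟 0 1 0 0 0 1 _ _ qb m00 rfl rfl)
    rw [h𝔟, h𝔞, Submodule.mem_sup] at h1
    obtain ⟨p, hp, w, hw, h1⟩ := h1
    obtain ⟨p, hp', q, hq, rfl⟩ := Submodule.mem_sup.mp hp
    obtain ⟨p, rfl⟩ := Ideal.mem_span_singleton.mp hp'
    obtain ⟨q, rfl⟩ := Ideal.mem_span_singleton.mp hq
    obtain ⟨w, rfl⟩ := Ideal.mem_span_singleton.mp hw
    have c2 := congrArg (fun z => bc z 0 2) h1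
    rw [mul_comm s] at c2
    simp only [bc_add, th, add_mul] at c2
    rw [bc_01 0 1, bc_01 0 1, bc_10z, bc_10z, bc_00, bc_bm_mul 0 2 0 0] at c2
    obtain ⟨t, ht⟩ := unit_of (bc s 0 0) hs
    have p1 : bc q 0 1 ∈ J := by simpa using bc_mem q 0 1
    have w1 : bc w 0 1 ∈ J := by simpa using bc_mem w 0 1
    have w2 : bc w 0 2 ∈ J := by
      have := bc_mem w 0 2
      rw [pow_zero, Ideal.one_eq_top, Ideal.top_mul] at this
      exact Ideal.pow_le_self (by omega) this
    refine ⟨t * (bc q 0 1 + a * β * bc w 0 2), Ideal.mul_mem_left _ _ (add_mem p1 (Ideal.mul_mem_left _ _ w2)),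
      t * bc w 0 1, Ideal.mul_mem_left _ _ w1, ?_⟩
    linear_combination (-x) * ht - t * c2

lemma red_K (a a' b b' : A) (ha : a ∈ I) (ha' : a' ∈ I) (hb : b ∈ J) (hb' : b' ∈ J)
    (h1 : ∀ x ∈ I * J, ∃ y ∈ J, ∃ z ∈ I, x = a * y + b' * z)
    (h2 : ∀ x ∈ I * J, ∃ y ∈ J, ∃ z ∈ I, x = a' * y + b * z)
    (h3 : ∀ x ∈ I ^ 2, ∃ y ∈ I, ∃ z ∈ I, x = a * y + a' * z)
    (h4 : ∀ x ∈ J ^ 2, ∃ y ∈ J, ∃ z ∈ J, x = b' * y + b * z) :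
    ∀ x ∈ (I * J) ^ 2, ∃ y ∈ I * J, ∃ z ∈ I * J, x = a * b * y + a' * b' * z := by
  intro x hx
  rw [pow_two] at hx
  refine Submodule.mul_induction_on hx ?_ ?_
  · intro x1 hx1 x2 hx2
    obtain ⟨y, hy, z, hz, rfl⟩ := h1 x1 hx1
    obtain ⟨y', hy', z', hz', rfl⟩ := h2 x2 hx2
    obtain ⟨p, hp, q, hq, e1⟩ := h4 (y * y') (by rw [pow_two]; exact Ideal.mul_mem_mul hy hy')
    obtain ⟨p', hp', q', hq', e2⟩ := h3 (z * z') (by rw [pow_two]; exact Ideal.mul_mem_mul hz hz')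
    refine ⟨z' * y + a' * q + p' * b', add_mem (add_mem (Ideal.mul_mem_mul hz' hy) (Ideal.mul_mem_mul ha' hq)) (Ideal.mul_mem_mul hp' hb'),
      z * y' + a * p + q' * b, add_mem (add_mem (Ideal.mul_mem_mul hz hy') (Ideal.mul_mem_mul ha hp)) (Ideal.mul_mem_mul hq' hb), ?_⟩
    linear_combination a * a' * e1 + b * b' * e2
  · rintro x y ⟨y1, h1, z1, h3, rfl⟩ ⟨y2, h4, z2, h5, rfl⟩
    exact ⟨y1 + y2, add_mem h1 h4, z1 + z2, add_mem h3 h5, by ring⟩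

end Ga
end MR

end Part18

section Part19
open RingTheory.Sequence IsLocalRing Polynomial

namespace MR

section Ko

/-- `uS ∩ u'T` -/
def FF {L : Type*} [Field L] {A : Type*} [CommRing A] [Algebra A L] (S T : Subalgebra A L) (u u' x : L) : Prop :=
  (∃ s ∈ S, x = u * s) ∧ (∃ t ∈ T, x = u' * t)

lemma kos {L : Type*} [Field L] {A : Type*} [CommRing A] [Algebra A L] (S T : Subalgebra A L)
    (hST : ∀ s ∈ S, ∀ t ∈ T, ∃ s1 ∈ S, ∃ t1 ∈ T, t * s = s1 + t1)
    (u u' f f' g g' : L) (hu' : u' ≠ 0) (hf : f ≠ 0) (hf' : f' ≠ 0) (hg : g ≠ 0) (hg' : g' ≠ 0)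
    (h1 : u / u' ∈ T) (h2 : f / f' ∈ T) (h3 : g / g' ∈ T) (h4 : g' / g ∈ S)
    (x : L) (hx : FF S T (u * f * g) (u' * f' * g') x) :
    ∃ y z, FF S T (u * g) (u' * g') y ∧ FF S T (u * f) (u' * f') z ∧ x = f * y + g' * z := by
  obtain ⟨⟨s, hs, e1⟩, ⟨t, ht, e2⟩⟩ := hx
  obtain ⟨s1, hs1, t1, ht1, e⟩ := hST s hs _ h3
  have e' : g * s = g' * (s1 + t1) := by rw [← e]; field_simp
  have e3 : x = u * f * g' * (s1 + t1) := by linear_combination e1 + u * f * e'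
  have e4 : u' * f' * t = u * f * (s1 + t1) := by
    apply mul_right_cancel₀ hg'
    linear_combination e3 - e2
  refine ⟨g' * u * t1, f * u * s1, ⟨⟨s - g' / g * s1, sub_mem hs (mul_mem h4 hs1), ?_⟩, ⟨u / u' * t1, mul_mem h1 ht1, ?_⟩⟩,
    ⟨⟨s1, hs1, by ring⟩, ⟨t - f / f' * (u / u') * t1, sub_mem ht (mul_mem (mul_mem h2 h1) ht1), ?_⟩⟩, ?_⟩
  · have : u * g * (s - g' / g * s1) = u * (g * s) - u * g' * s1 := by field_simp
    rw [this, e']; ring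
  · field_simp
  · have : u' * f' * (t - f / f' * (u / u') * t1) = u' * f' * t - f * u * t1 := by field_simp
    rw [this, e4]; ring
  · rw [e3]; ring

variable {A : Type*} [CommRing A] [IsDomain A] [IsNoetherianRing A] [IsIntegrallyClosed A]

lemma red_nm (K : Ideal A) (c d : A) (hc : c ∈ K) (hd : d ∈ K) (h2 : ∀ x ∈ K ^ 2, ∃ y ∈ K, ∃ z ∈ K, x = c * y + d * z) :
    ∀ k n m, n + m = k → ∀ x ∈ K ^ k, ∃ y ∈ K ^ m, ∃ z ∈ K ^ n, x = c ^ n * y + d ^ m * z := by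
  intro k
  induction k with
  | zero =>
    intro n m h x hx
    obtain ⟨rfl, rfl⟩ : n = 0 ∧ m = 0 := by omega
    exact ⟨x, hx, 0, zero_mem _, by simp⟩
  | succ k ih =>
    intro n m h x hx
    rcases n with _ | n
    · obtain rfl : m = k + 1 := by omega
      exact ⟨x, hx, 0, zero_mem _, by simp⟩
    rcases m with _ | m
    · obtain rfl : n = k := by omega
      exact ⟨0, zero_mem _, x, hx, by simp⟩
    obtain ⟨j, rfl⟩ : ∃ j, k = j + 1 := ⟨k - 1, by omega⟩
    obtain ⟨u, hu, w, hw, rfl⟩ := red_pow c d h2 j x hx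
    obtain ⟨y1, hy1, z1, hz1, rfl⟩ := ih n (m + 1) (by omega) u hu
    obtain ⟨y2, hy2, z2, hz2, rfl⟩ := ih (n + 1) m (by omega) w hw
    refine ⟨y1 + d * y2, add_mem hy1 ?_, c * z1 + z2, add_mem ?_ hz2, by ring⟩
    · rw [pow_succ']; exact Ideal.mul_mem_mul hd hy2
    · rw [pow_succ']; exact Ideal.mul_mem_mul hc hz1

variable {L : Type*} [Field L] [Algebra A L] [IsFractionRing A L]

lemma hST_of (K : Ideal A) (c d : A) (hc : c ∈ K) (hd : d ∈ K) (hc0 : c ≠ 0) (hd0 : d ≠ 0)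
    (h2 : ∀ x ∈ K ^ 2, ∃ y ∈ K, ∃ z ∈ K, x = c * y + d * z) :
    ∀ s ∈ ch L K c, ∀ t ∈ ch L K d, ∃ s1 ∈ ch L K c, ∃ t1 ∈ ch L K d, t * s = s1 + t1 := by
  intro s hs t ht
  obtain ⟨n, y, hy, rfl⟩ := ch_exists K c hc hc0 s hs
  obtain ⟨m, z, hz, rfl⟩ := ch_exists K d hd hd0 t ht
  obtain ⟨p, hp, q, hq, e⟩ := red_nm K c d hc hd h2 (n + m) n m rfl (y * z) (by rw [pow_add]; exact Ideal.mul_mem_mul hy hz)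
  refine ⟨_, ch_mem K c n q hq, _, ch_mem K d m p hp, ?_⟩
  have hc1 : algebraMap A L c ≠ 0 := by simpa using hc0
  have hd1 : algebraMap A L d ≠ 0 := by simpa using hd0
  have e1 := congrArg (algebraMap A L) e
  simp only [map_add, map_mul, map_pow] at e1
  have hcn : (algebraMap A L c)⁻¹ ^ n * (algebraMap A L c) ^ n = 1 := by
    rw [← mul_pow, inv_mul_cancel₀ hc1, one_pow]
  have hdm : (algebraMap A L d)⁻¹ ^ m * (algebraMap A L d) ^ m = 1 := by
    rw [← mul_pow, inv_mul_cancel₀ hd1, one_pow]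
  generalize (algebraMap A L c)⁻¹ ^ n = C at *
  generalize (algebraMap A L d)⁻¹ ^ m = D at *
  generalize (algebraMap A L c) ^ n = C1 at *
  generalize (algebraMap A L d) ^ m = D1 at *
  linear_combination C * D * e1 + algebraMap A L p * D * hcn + algebraMap A L q * C * hdm

lemma FF_base (K : Ideal A) (c d : A) (hc : c ∈ K) (hd : d ∈ K) (hc0 : c ≠ 0) (hd0 : d ≠ 0)
    (h2 : ∀ x ∈ K ^ 2, ∃ y ∈ K, ∃ z ∈ K, x = c * y + d * z) (𝔟 : Ideal A) (h𝔟 : IdealIsIntegrallyClosed 𝔟)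
    (u u' : A) (hu : u ∈ 𝔟) (hu' : u' ∈ 𝔟) (x : L)
    (hx : FF (ch L K c) (ch L K d) (algebraMap A L u) (algebraMap A L u') x) : ∃ r ∈ 𝔟, x = algebraMap A L r := by
  obtain ⟨⟨s, hs, e1⟩, ⟨t, ht, e2⟩⟩ := hx
  obtain ⟨n, y, hy, rfl⟩ := ch_exists K c hc hc0 s hs
  obtain ⟨m, z, hz, rfl⟩ := ch_exists K d hd hd0 t ht
  have hc1 : algebraMap A L c ≠ 0 := by simpa using hc0
  have hd1 : algebraMap A L d ≠ 0 := by simpa using hd0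
  obtain ⟨p, q, hq, rfl⟩ := IsFractionRing.div_surjective (A := A) x
  have hq0 : q ≠ 0 := nonZeroDivisors.ne_zero hq
  have hq1 : algebraMap A L q ≠ 0 := by simpa using hq0
  have hcn : (algebraMap A L c)⁻¹ ^ n * (algebraMap A L c) ^ n = 1 := by
    rw [← mul_pow, inv_mul_cancel₀ hc1, one_pow]
  have hdm : (algebraMap A L d)⁻¹ ^ m * (algebraMap A L d) ^ m = 1 := by
    rw [← mul_pow, inv_mul_cancel₀ hd1, one_pow]
  have f1 : p * c ^ n = q * (u * y) := by
    apply IsFractionRing.injective A L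
    simp only [map_mul, map_pow]
    have e3 := (div_eq_iff hq1).mp e1
    generalize (algebraMap A L c)⁻¹ ^ n = C at *
    generalize (algebraMap A L c) ^ n = C1 at *
    linear_combination C1 * e3 + algebraMap A L q * algebraMap A L u * algebraMap A L y * hcn
  have f2 : p * d ^ m = q * (u' * z) := by
    apply IsFractionRing.injective A L
    simp only [map_mul, map_pow]
    have e3 := (div_eq_iff hq1).mp e2
    generalize (algebraMap A L d)⁻¹ ^ m = C at *
    generalize (algebraMap A L d) ^ m = C1 at *
    linear_combination C1 * e3 + algebraMap A L q * algebraMap A L u' * algebraMap A L z * hdm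
  obtain ⟨w, hw, e⟩ := colon 𝔟 (K ^ (n + m)) (pow_ne_zero _ (fun h => hc0 (by rw [h] at hc; exact hc))) h𝔟 q p hq0 (by
    intro x hx
    obtain ⟨p1, hp1, q1, hq1, e⟩ := red_nm K c d hc hd h2 (n + m) n m rfl x hx
    refine ⟨u * (y * p1) + u' * (q1 * z), add_mem ?_ ?_, ?_⟩
    · refine Ideal.mul_mem_mul hu ?_; rw [pow_add]; exact Ideal.mul_mem_mul hy hp1
    · refine Ideal.mul_mem_mul hu' ?_; rw [pow_add]; exact Ideal.mul_mem_mul hq1 hz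
    · rw [e]; linear_combination p1 * f1 + q1 * f2)
  refine ⟨w, hw, ?_⟩
  rw [e, map_mul]
  field_simp

set_option maxHeartbeats 1000000 in
theorem koszul (I J : Ideal A) (a a' b b' : A) (ha : a ∈ I) (ha' : a' ∈ I) (hb : b ∈ J) (hb' : b' ∈ J)
    (ha0 : a ≠ 0) (ha0' : a' ≠ 0) (hb0 : b ≠ 0) (hb0' : b' ≠ 0)
    (h2 : ∀ x ∈ (I * J) ^ 2, ∃ y ∈ I * J, ∃ z ∈ I * J, x = a * b * y + a' * b' * z)
    (hI : IdealIsIntegrallyClosed I) (hJ : IdealIsIntegrallyClosed J)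
    (hK : ∀ n, IdealIsIntegrallyClosed ((I * J) ^ n)) :
    (∀ i j, IdealIsIntegrallyClosed (I ^ i * J ^ j)) ∧
    (∀ x ∈ I * J, ∃ y ∈ J, ∃ z ∈ I, x = a * y + b' * z) ∧
    (∀ x ∈ I ^ 2, ∃ y ∈ I, ∃ z ∈ I, x = a * y + a' * z) ∧
    (∀ x ∈ J ^ 2, ∃ y ∈ J, ∃ z ∈ J, x = b' * y + b * z) := by
  let L := FractionRing A
  let φ := algebraMap A L
  have hφ : Function.Injective φ := IsFractionRing.injective A L
  have hc : a * b ∈ I * J := Ideal.mul_mem_mul ha hb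
  have hd : a' * b' ∈ I * J := Ideal.mul_mem_mul ha' hb'
  have hc0 := mul_ne_zero ha0 hb0
  have hd0 := mul_ne_zero ha0' hb0'
  have fa : φ a ≠ 0 := fun h => ha0 (hφ (by rw [h, map_zero]))
  have fa' : φ a' ≠ 0 := fun h => ha0' (hφ (by rw [h, map_zero]))
  have fb : φ b ≠ 0 := fun h => hb0 (hφ (by rw [h, map_zero]))
  have fb' : φ b' ≠ 0 := fun h => hb0' (hφ (by rw [h, map_zero]))
  set S := ch L (I * J) (a * b) with hS
  set T := ch L (I * J) (a' * b') with hT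
  have hST := hST_of (L := L) (I * J) _ _ hc hd hc0 hd0 h2
  have memS : ∀ n, ∀ y ∈ (I * J) ^ n, φ y / (φ a * φ b) ^ n ∈ S := by
    intro n y hy
    have := ch_mem (L := L) (I * J) (a * b) n y hy
    rwa [map_mul, inv_pow, ← div_eq_mul_inv] at this
  have memT : ∀ n, ∀ y ∈ (I * J) ^ n, φ y / (φ a' * φ b') ^ n ∈ T := by
    intro n y hy
    have := ch_mem (L := L) (I * J) (a' * b') n y hy
    rwa [map_mul, inv_pow, ← div_eq_mul_inv] at this
  have rS1 : φ a' / φ a ∈ S := by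
    have := memS 1 (a' * b) (by rw [pow_one]; exact Ideal.mul_mem_mul ha' hb)
    rwa [pow_one, map_mul, mul_div_mul_right _ _ fb] at this
  have rS2 : φ b' / φ b ∈ S := by
    have := memS 1 (a * b') (by rw [pow_one]; exact Ideal.mul_mem_mul ha hb')
    rwa [pow_one, map_mul, mul_div_mul_left _ _ fa] at this
  have rT1 : φ a / φ a' ∈ T := by
    have := memT 1 (a * b') (by rw [pow_one]; exact Ideal.mul_mem_mul ha hb')
    rwa [pow_one, map_mul, mul_div_mul_right _ _ fb'] at this
  have rT2 : φ b / φ b' ∈ T := by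
    have := memT 1 (a' * b) (by rw [pow_one]; exact Ideal.mul_mem_mul ha' hb)
    rwa [pow_one, map_mul, mul_div_mul_left _ _ fa'] at this
  let F : ℕ → ℕ → L → Prop := fun m n x => FF S T (φ a ^ m * φ b ^ n) (φ a' ^ m * φ b' ^ n) x
  have ru : ∀ m n, (φ a ^ m * φ b ^ n) / (φ a' ^ m * φ b' ^ n) ∈ T := by
    intro m n
    rw [mul_div_mul_comm, ← div_pow, ← div_pow]
    exact mul_mem (pow_mem rT1 m) (pow_mem rT2 n)
  have nu : ∀ m n, φ a' ^ m * φ b' ^ n ≠ 0 := fun m n => mul_ne_zero (pow_ne_zero _ fa') (pow_ne_zero _ fb')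
  have K11 : ∀ m n x, F (m + 1) (n + 1) x → ∃ y z, F m (n + 1) y ∧ F (m + 1) n z ∧ x = φ a * y + φ b' * z := by
    intro m n x hx
    obtain ⟨y, z, hy, hz, e⟩ := kos S T hST (φ a ^ m * φ b ^ n) (φ a' ^ m * φ b' ^ n) (φ a) (φ a') (φ b) (φ b') (nu m n) fa fa' fb fb'
      (ru m n) rT1 rT2 rS2 x (by
        convert hx using 1 <;> ring)
    refine ⟨y, z, ?_, ?_, e⟩
    · convert hy using 1 <;> ring
    · convert hz using 1 <;> ring
  have K20 : ∀ m n x, F (m + 2) n x → ∃ y z, F (m + 1) n y ∧ F (m + 1) n z ∧ x = φ a * y + φ a' * z := by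
    intro m n x hx
    obtain ⟨y, z, hy, hz, e⟩ := kos S T hST (φ a ^ m * φ b ^ n) (φ a' ^ m * φ b' ^ n) (φ a) (φ a') (φ a) (φ a') (nu m n) fa fa' fa fa'
      (ru m n) rT1 rT1 rS1 x (by
        convert hx using 1 <;> ring)
    refine ⟨y, z, ?_, ?_, e⟩
    · convert hy using 1 <;> ring
    · convert hz using 1 <;> ring
  have K02 : ∀ m n x, F m (n + 2) x → ∃ y z, F m (n + 1) y ∧ F m (n + 1) z ∧ x = φ b * y + φ b' * z := by
    intro m n x hx
    obtain ⟨y, z, hy, hz, e⟩ := kos S T hST (φ a ^ m * φ b ^ n) (φ a' ^ m * φ b' ^ n) (φ b) (φ b') (φ b) (φ b') (nu m n) fb fb' fb fb'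
      (ru m n) rT2 rT2 rS2 x (by
        convert hx using 1 <;> ring)
    refine ⟨y, z, ?_, ?_, e⟩
    · convert hy using 1 <;> ring
    · convert hz using 1 <;> ring
  have base : ∀ 𝔟 : Ideal A, IdealIsIntegrallyClosed 𝔟 → ∀ u ∈ 𝔟, ∀ u' ∈ 𝔟, ∀ x, FF S T (φ u) (φ u') x → ∃ r ∈ 𝔟, x = φ r :=
    fun 𝔟 h𝔟 u hu u' hu' x hx => FF_base (L := L) (I * J) _ _ hc hd hc0 hd0 h2 𝔟 h𝔟 u u' hu hu' x hx
  have F10 : ∀ x, F 1 0 x → ∃ r ∈ I, x = φ r := by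
    intro x hx
    refine base I hI a ha a' ha' x ?_
    convert hx using 1 <;> ring
  have F01 : ∀ x, F 0 1 x → ∃ r ∈ J, x = φ r := by
    intro x hx
    refine base J hJ b hb b' hb' x ?_
    convert hx using 1 <;> ring
  have main : ∀ k m n, m + n = k → ∀ x, F m n x → ∃ r ∈ I ^ m * J ^ n, x = φ r := by
    intro k
    induction k with
    | zero =>
      intro m n h x hx
      obtain ⟨rfl, rfl⟩ : m = 0 ∧ n = 0 := by omega
      obtain ⟨r, -, e⟩ := base ⊤ (fun _ _ => trivial) 1 trivial 1 trivial x (by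
        convert hx using 1 <;> simp)
      exact ⟨r, m00, e⟩
    | succ k ih =>
      intro m n h x hx
      rcases m with _ | m
      · rcases n with _ | n
        · omega
        rcases n with _ | n
        · obtain ⟨r, hr, e⟩ := F01 x hx
          exact ⟨r, m01 hr, e⟩
        obtain ⟨y, z, hy, hz, e⟩ := K02 0 n x hx
        obtain ⟨r, hr, rfl⟩ := ih 0 (n + 1) (by omega) y hy
        obtain ⟨s, hs, rfl⟩ := ih 0 (n + 1) (by omega) z hz
        refine ⟨b * r + b' * s, ?_, by rw [e, map_add, map_mul, map_mul]⟩
        rw [show n + 1 + 1 = (n + 1) + 1 from rfl, pow_succ' J (n + 1), mul_left_comm]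
        exact add_mem (Ideal.mul_mem_mul hb hr) (Ideal.mul_mem_mul hb' hs)
      rcases n with _ | n
      · rcases m with _ | m
        · obtain ⟨r, hr, e⟩ := F10 x hx
          exact ⟨r, m10 hr, e⟩
        obtain ⟨y, z, hy, hz, e⟩ := K20 m 0 x hx
        obtain ⟨r, hr, rfl⟩ := ih (m + 1) 0 (by omega) y hy
        obtain ⟨s, hs, rfl⟩ := ih (m + 1) 0 (by omega) z hz
        refine ⟨a * r + a' * s, ?_, by rw [e, map_add, map_mul, map_mul]⟩
        rw [pow_succ' I (m + 1), mul_assoc]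
        exact add_mem (Ideal.mul_mem_mul ha hr) (Ideal.mul_mem_mul ha' hs)
      obtain ⟨y, z, hy, hz, e⟩ := K11 m n x hx
      obtain ⟨r, hr, rfl⟩ := ih m (n + 1) (by omega) y hy
      obtain ⟨s, hs, rfl⟩ := ih (m + 1) n (by omega) z hz
      refine ⟨a * r + b' * s, add_mem ?_ ?_, by rw [e, map_add, map_mul, map_mul]⟩
      · rw [pow_succ' I m, mul_assoc]; exact Ideal.mul_mem_mul ha hr
      · rw [pow_succ' J n, mul_left_comm]; exact Ideal.mul_mem_mul hb' hs
  have hin : ∀ m n x, IsIntegralOverIdeal (I ^ m * J ^ n) x → F m n (φ x) := by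
    intro m n x hx
    have key : ∀ α ∈ I, ∀ γ ∈ J, x * (α ^ n * γ ^ m) ∈ (I * J) ^ (m + n) := by
      intro α hα γ hγ
      refine hK (m + n) _ ?_
      have := int_mul (I ^ m * J ^ n) (I ^ n * J ^ m) x (α ^ n * γ ^ m) hx
        (Ideal.mul_mem_mul (Ideal.pow_mem_pow hα n) (Ideal.pow_mem_pow hγ m))
      rwa [show I ^ m * J ^ n * (I ^ n * J ^ m) = (I * J) ^ (m + n) by rw [mul_pow]; ring] at this
    refine ⟨⟨_, memS (m + n) _ (key a ha b hb), ?_⟩, ⟨_, memT (m + n) _ (key a' ha' b' hb'), ?_⟩⟩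
    · simp only [map_mul, map_pow]
      rw [← mul_div_assoc, eq_div_iff (pow_ne_zero _ (mul_ne_zero fa fb))]; ring
    · simp only [map_mul, map_pow]
      rw [← mul_div_assoc, eq_div_iff (pow_ne_zero _ (mul_ne_zero fa' fb'))]; ring
  have hcl : ∀ i j, IdealIsIntegrallyClosed (I ^ i * J ^ j) := by
    intro i j x hx
    obtain ⟨r, hr, e⟩ := main _ i j rfl _ (hin i j x hx)
    rwa [hφ e]
  have self : ∀ m n, ∀ x ∈ I ^ m * J ^ n, F m n (φ x) := by
    intro m n x hx
    refine hin m n x ⟨1, by omega, fun _ => -x, ?_, ?_⟩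
    · intro i h1 h2
      obtain rfl : i = 1 := by omega
      rw [pow_one]; exact neg_mem hx
    · simp
  refine ⟨hcl, ?_, ?_, ?_⟩
  · intro x hx
    obtain ⟨y, z, hy, hz, e⟩ := K11 0 0 _ (self 1 1 x (by simpa using hx))
    obtain ⟨r, hr, rfl⟩ := F01 y hy
    obtain ⟨s, hs, rfl⟩ := F10 z hz
    exact ⟨r, hr, s, hs, hφ (by rw [e, map_add, map_mul, map_mul])⟩
  · intro x hx
    obtain ⟨y, z, hy, hz, e⟩ := K20 0 0 _ (self 2 0 x (by simpa using hx))
    obtain ⟨r, hr, rfl⟩ := F10 y hy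
    obtain ⟨s, hs, rfl⟩ := F10 z hz
    exact ⟨r, hr, s, hs, hφ (by rw [e, map_add, map_mul, map_mul])⟩
  · intro x hx
    obtain ⟨y, z, hy, hz, e⟩ := K02 0 0 _ (self 0 2 x (by simpa using hx))
    obtain ⟨r, hr, rfl⟩ := F01 y hy
    obtain ⟨s, hs, rfl⟩ := F01 z hz
    exact ⟨s, hs, r, hr, hφ (by rw [e, map_add, map_mul, map_mul]; ring)⟩

end Ko
end MR

end Part19

section Part20
open RingTheory.Sequence IsLocalRing Polynomial

namespace MR

lemma ne_bot_of_primary {A : Type*} [CommRing A] [IsDomain A] [IsNoetherianRing A] [IsLocalRing A]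
    [IsIntegrallyClosed A] (hdim : ringKrullDim A = 2) (I : Ideal A)
    (hI : ∃ n : ℕ, IsLocalRing.maximalIdeal A ^ n ≤ I) : I ≠ ⊥ := by
  rintro rfl
  obtain ⟨β, hβ, hβ0⟩ := exists_beta hdim
  obtain ⟨n, hn⟩ := hI
  exact pow_ne_zero n hβ0 (by simpa using hn (Ideal.pow_mem_pow hβ n))

theorem final (k : Type*) [Field k] [IsAlgClosed k]
    (A : Type*) [CommRing A] [IsDomain A] [IsNoetherianRing A] [IsLocalRing A]
    [Algebra k A] [IsIntegrallyClosed A]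
    (hdim : ringKrullDim A = 2)
    (I : Ideal A) (hIprim : ∃ n : ℕ, IsLocalRing.maximalIdeal A ^ n ≤ I)
    (J : Ideal A) (hJprim : ∃ n : ℕ, IsLocalRing.maximalIdeal A ^ n ≤ J) :
    IsCMNormalDomain (multiReesAlgebra ![I, J]) ↔
      IdealIsIntegrallyClosed I ∧ IdealIsIntegrallyClosed J ∧
        IsCMNormalDomain (reesAlgebra (I * J)) := by
  haveI : Infinite k := IsAlgClosed.instInfinite
  have hI0 := ne_bot_of_primary hdim I hIprim
  have hJ0 := ne_bot_of_primary hdim J hJprim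
  have hK0 : I * J ≠ ⊥ := mul_ne_zero hI0 hJ0
  have hKprim : ∃ n : ℕ, IsLocalRing.maximalIdeal A ^ n ≤ I * J := by
    obtain ⟨n, hn⟩ := hIprim
    obtain ⟨m, hm⟩ := hJprim
    exact ⟨n + m, by rw [pow_add]; exact Ideal.mul_mono hn hm⟩
  obtain ⟨a, ha, a', ha', b, hb, b', hb', ha0, ha0', hb0, hb0', M, hM⟩ := generic k hdim I J hI0 hJ0
  obtain ⟨e⟩ := multi_equiv I J
  constructor
  · rintro ⟨h1, -, h3⟩
    have hcm := cm_equiv e h1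
    have hn := normal_equiv e h3
    have hp := RR_piece hn hI0 hJ0
    obtain ⟨g1, g2, g3⟩ := gamma hdim hIprim hJprim hcm a a' b b' ha ha' hb hb' ha0 hb0 hb0' M hM
    obtain ⟨g4, -, -⟩ := gamma hdim hIprim hJprim hcm a' a b' b ha' ha hb' hb ha0' hb0' hb0 M (by
      intro x hx
      obtain ⟨y, hy, z, hz, e⟩ := hM x hx
      exact ⟨z, hz, y, hy, by rw [e, add_comm]⟩)
    have h2 := red_K a a' b b' ha ha' hb hb' g1 g4 g2 g3
    have hrn : IsIntegrallyClosed (reesAlgebra (I * J)) := rees_normal (fun n => by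
      rw [mul_pow]; exact hp n n)
    refine ⟨?_, ?_, ?_, inferInstance, hrn⟩
    · simpa using hp 1 0
    · simpa using hp 0 1
    · exact T_main hdim.le hrn (a * b) (a' * b') (Ideal.mul_mem_mul ha hb) (Ideal.mul_mem_mul ha' hb')
        (mul_ne_zero ha0 hb0) (mul_ne_zero ha0' hb0') h2
  · rintro ⟨hI, hJ, hcm, -, hn⟩
    have h2 := alpha hdim (I * J) hKprim hcm (a * b) (a' * b') (Ideal.mul_mem_mul ha hb)
      (Ideal.mul_mem_mul ha' hb') (mul_ne_zero ha0 hb0) M hM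
    obtain ⟨hcl, g1, g2, g3⟩ := koszul I J a a' b b' ha ha' hb hb' ha0 ha0' hb0 hb0' h2 hI hJ
      (rees_pow_closed hK0 hn)
    have c1 := delta_main hdim hIprim hJprim hcl a a' b b' ha ha' hb hb' ha0 ha0' hb0 hb0' g1 g2 g3
    have c2 : IsIntegrallyClosed (RR I J) := RR_normal hcl
    exact ⟨cm_equiv e.symm c1, inferInstance, normal_equiv e.symm c2⟩

end MR

end Part20

/-- For `𝔪`-primary ideals `I`, `J` of a two-dimensional excellent
normal local domain over an algebraically closed field, the multi-Rees algebra
`A[It₁, Jt₂]` is a Cohen–Macaulay normal domain iff `I` and `J` are integrally closed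
and the Rees algebra `A[(IJ)t]` is a Cohen–Macaulay normal domain. -/
theorem stmt8 (k : Type*) [Field k] [IsAlgClosed k]
    (A : Type*) [CommRing A] [IsDomain A] [IsNoetherianRing A] [IsLocalRing A]
    [Algebra k A] [IsIntegrallyClosed A]
    (hdim : ringKrullDim A = 2)
    (I : Ideal A) (hIprim : ∃ n : ℕ, IsLocalRing.maximalIdeal A ^ n ≤ I)
    (J : Ideal A) (hJprim : ∃ n : ℕ, IsLocalRing.maximalIdeal A ^ n ≤ J) :
    IsCMNormalDomain (multiReesAlgebra ![I, J]) ↔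
      IdealIsIntegrallyClosed I ∧ IdealIsIntegrallyClosed J ∧
        IsCMNormalDomain (reesAlgebra (I * J)) := by
  exact MR.final k A hdim I hIprim J hJprim
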